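/- Let f ∈ ℚ[x] be the degree 24 polynomial f(x) = x^24 - 11x^23 + 53x^22 - 154x^21 + 330x^20 - 594x^19 + 1012x^18 - 2255x^17 + 6512x^16 - 17710x^15 + 42768x^14 - 89067x^13 + 154308x^12 - 237699x^11 + 351252x^10 - 483318x^9 + 623997x^8 - 753291x^7 + 733491x^6 - 520641x^5 + 278586x^4 - 104841x^3 + 15552x^2 + 2673x + 81. Then f is irreducible over ℚ, the Galois group of f over ℚ has cardinality 190080 (the order of M₁₂.2), and the number field K = ℚ[x]/(f) has discriminant of absolute value 2^12·3^24·11^22. -/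

import Mathlib

open Polynomial

/-- Value at `x` of the polynomial with coefficient list `l` (constant coefficient first). -/
def evalList {A : Type*} [CommRing A] (l : List ℤ) (x : A) : A :=
  l.foldr (fun (c : ℤ) (a : A) => (c : A) + x * a) 0

/-- Sum of coefficient lists. -/
def addList : List ℤ → List ℤ → List ℤ
  | [], m => m
  | a :: l, [] => a :: l
  | a :: l, b :: m => (a + b) :: addList l m

/-- Scalar multiple of a coefficient list. -/
def smulList (c : ℤ) (l : List ℤ) : List ℤ := l.map (c * ·)

/-- The sum of `acc` and of `c` times `l`. -/
def addMulList (c : ℤ) : List ℤ → List ℤ → List ℤ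
  | [], acc => acc
  | b :: l, acc => (acc.headD 0 + c * b) :: addMulList c l acc.tail

/-- Product of coefficient lists. -/
def mulList (l m : List ℤ) : List ℤ :=
  l.foldr (fun c a => if c = 0 then 0 :: a else addMulList c m (0 :: a)) []

section evalList
variable {A B : Type*} [CommRing A] [CommRing B]

@[simp] theorem evalList_nil (x : A) : evalList [] x = 0 := rfl

@[simp] theorem evalList_cons (c : ℤ) (l : List ℤ) (x : A) :
    evalList (c :: l) x = c + x * evalList l x := rfl

theorem map_evalList (φ : A →+* B) (l : List ℤ) (x : A) :
    φ (evalList l x) = evalList l (φ x) := by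
  induction l with
  | nil => simp
  | cons c l ih => simp [ih]

theorem evalList_addList (l m : List ℤ) (x : A) :
    evalList (addList l m) x = evalList l x + evalList m x := by
  induction l generalizing m with
  | nil => simp [addList]
  | cons a l ih =>
    cases m with
    | nil => simp [addList]
    | cons b m => simp only [addList, evalList_cons, ih]; push_cast; ring

theorem evalList_smulList (c : ℤ) (l : List ℤ) (x : A) :
    evalList (smulList c l) x = c * evalList l x := by
  induction l with
  | nil => simp [smulList]
  | cons a l ih =>
    simp only [smulList, List.map_cons, evalList_cons] at *
    rw [ih]; push_cast; ring

theorem evalList_addMulList (c : ℤ) (l acc : List ℤ) (x : A) :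
    evalList (addMulList c l acc) x = evalList acc x + c * evalList l x := by
  induction l generalizing acc with
  | nil => simp [addMulList]
  | cons a l ih =>
    cases acc with
    | nil => simp only [addMulList, evalList_cons, ih, List.headD, List.tail, evalList_nil]
             push_cast; ring
    | cons b m => simp only [addMulList, evalList_cons, ih, List.headD, List.tail]; push_cast; ring

theorem evalList_mulList (l m : List ℤ) (x : A) :
    evalList (mulList l m) x = evalList l x * evalList m x := by
  induction l with
  | nil => simp [mulList]
  | cons a l ih =>
    simp only [mulList, List.foldr_cons, evalList_cons] at *
    split_ifs with h
    · rw [evalList_cons, ih, h]; push_cast; ring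
    · rw [evalList_addMulList, evalList_cons, ih]; push_cast; ring

theorem coeff_evalList_X (l : List ℤ) (i : ℕ) :
    (evalList l (X : A[X])).coeff i = (l.getD i 0 : ℤ) := by
  induction l generalizing i with
  | nil => simp
  | cons c l ih =>
    rw [evalList_cons, coeff_add, ← C_eq_intCast, coeff_C]
    cases i with
    | zero => simp
    | succ i => simp [coeff_X_mul, ih]

theorem natDegree_evalList_X_le (l : List ℤ) (n : ℕ) (h : l.length ≤ n + 1) :
    (evalList l (X : A[X])).natDegree ≤ n := by
  rw [natDegree_le_iff_coeff_eq_zero]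
  intro i hi
  rw [coeff_evalList_X, List.getD_eq_default _ _ (by omega), Int.cast_zero]

theorem aeval_evalList_X [Algebra A B] (l : List ℤ) (x : B) :
    aeval x (evalList l (X : A[X])) = evalList l x := by
  have := map_evalList (aeval x : A[X] →ₐ[A] B).toRingHom l X
  simpa using this

theorem map_evalList_X (φ : A →+* B) (l : List ℤ) :
    (evalList l (X : A[X])).map φ = evalList l X := by
  have := map_evalList (mapRingHom φ) l X
  simpa using this

end evalList

/-- The elements fixed by a power of Frobenius modulo `π` and `p` form a subring. -/
theorem frobenius_fixed_closure {A : Type*} [CommRing A] (p k : ℕ) (hp : p.Prime) (π : A)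
    (s : Set A) (hs : ∀ y ∈ s, y ^ p ^ k - y ∈ Ideal.span {π, (p : A)}) (y : A)
    (hy : y ∈ Subring.closure s) : y ^ p ^ k - y ∈ Ideal.span {π, (p : A)} := by
  set I := Ideal.span {π, (p : A)}
  have hpI : (p : A) ∈ I := Ideal.subset_span (by simp)
  have key : ∀ x y : A, (x + y) ^ p ^ k - (x ^ p ^ k + y ^ p ^ k) ∈ I := by
    intro x y
    obtain ⟨r, hr⟩ := exists_add_pow_prime_pow_eq hp x y k
    rw [hr, add_sub_cancel_left]
    simp only [mul_assoc]
    exact I.mul_mem_right _ hpI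
  have h0 : ∀ x : A, (x ^ p ^ k - x ∈ I) ↔ Ideal.Quotient.mk I x ^ p ^ k = Ideal.Quotient.mk I x := by
    intro x
    rw [← map_pow, Ideal.Quotient.mk_eq_mk_iff_sub_mem]
  have hadd : ∀ x y : A, Ideal.Quotient.mk I (x + y) ^ p ^ k =
      Ideal.Quotient.mk I x ^ p ^ k + Ideal.Quotient.mk I y ^ p ^ k := by
    intro x y
    rw [← map_pow, ← map_pow, ← map_pow, ← map_add, Ideal.Quotient.mk_eq_mk_iff_sub_mem]
    exact key x y
  have hpk : p ^ k ≠ 0 := pow_ne_zero _ hp.ne_zero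
  induction hy using Subring.closure_induction with
  | mem x hx => exact hs x hx
  | zero => simp only [zero_pow hpk, sub_zero, I.zero_mem]
  | one => simp
  | add x y _ _ hx hy =>
    rw [h0] at *
    rw [hadd, hx, hy, map_add]
  | neg x _ hx =>
    rw [h0] at *
    have h := hadd x (-x)
    rw [hx, add_neg_cancel, map_zero, zero_pow hpk] at h
    rw [map_neg] at h ⊢
    exact (neg_eq_of_add_eq_zero_right h.symm).symm
  | mul x y _ _ hx hy =>
    rw [h0] at *
    rw [map_mul, mul_pow, hx, hy]

theorem pow_frobenius_fixed {A : Type*} [CommRing A] (I : Ideal A) (q : ℕ)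
    (h : ∀ y : A, y ^ q - y ∈ I) (y : A) (j : ℕ) : y ^ q ^ j - y ∈ I := by
  induction j with
  | zero => simp
  | succ j ih =>
    have := I.add_mem (h (y ^ q ^ j)) ih
    rwa [← pow_mul, ← pow_succ, sub_add_sub_cancel] at this

theorem exists_mul_pow_eq {K : Type*} [Field K] (R : Subring K) {x π : K} (hx : IsIntegral ℤ x)
    (hπ : π ∈ R) (hy : π * x ∈ R) : ∃ n : ℕ, ∃ z ∈ R, (π * x) ^ n = π * z := by
  obtain ⟨P, hP, hPx⟩ := hx
  rw [← aeval_def] at hPx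
  have hn : P.natDegree ≠ 0 := by
    intro h
    rw [hP.natDegree_eq_zero.mp h] at hPx
    simp at hPx
  refine ⟨P.natDegree, -∑ i ∈ Finset.range P.natDegree,
    (P.coeff i : K) * (π ^ (P.natDegree - i - 1) * (π * x) ^ i), ?_, ?_⟩
  · refine R.neg_mem (R.sum_mem fun i _ => R.mul_mem (intCast_mem R _)
      (R.mul_mem (R.pow_mem hπ _) (R.pow_mem hy _)))
  · rw [aeval_eq_sum_range, Finset.sum_range_succ, hP.coeff_natDegree, one_smul] at hPx
    rw [mul_pow, eq_neg_of_add_eq_zero_right hPx, mul_neg, mul_neg, Finset.mul_sum, Finset.mul_sum]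
    congr 1
    refine Finset.sum_congr rfl fun i hi => ?_
    have : P.natDegree = (P.natDegree - i - 1) + 1 + i := by
      have := Finset.mem_range.mp hi; omega
    rw [zsmul_eq_mul]
    conv_lhs => rw [this]
    rw [pow_add, pow_succ]
    ring

/-- If the radical of `p` in the order `R` is locally generated by `π`, then `R` is
maximal at `p`. -/
theorem mem_of_nsmul_mem {K : Type*} [Field K] (R : Subring K) (p N k : ℕ) (hp : p.Prime)
    (hk : k ≠ 0) (hR : ∀ y ∈ R, IsIntegral ℤ y) (π r e a b c : R) (hpK : (p : K) ≠ 0)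
    (h1 : π * r = p * e) (h2 : e = 1 + π * a + p * b) (h3 : π ^ p ^ N = p * c)
    (h4 : ∀ y : R, y ^ p ^ k - y ∈ Ideal.span {π, (p : R)})
    (x : K) (hx : IsIntegral ℤ x) (hpx : p * x ∈ R) : x ∈ R := by
  by_cases hπ0 : π = 0
  · have he : (p : K) * e = 0 := by
      have := congrArg (Subtype.val) h1
      rw [hπ0, zero_mul] at this
      exact this.symm
    have hb : (p : K) * b = -1 := by
      have := congrArg (Subtype.val) h2
      push_cast [(mul_eq_zero.mp he).resolve_left hpK, hπ0] at this
      linear_combination -this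
    rw [show x = -b * (p * x) by linear_combination x * hb]
    exact R.mul_mem (R.neg_mem b.2) hpx
  have hπ0' : (π : K) ≠ 0 := by simpa using hπ0
  have step : ∀ x : K, IsIntegral ℤ x → π * x ∈ R → e * x ∈ R := by
    intro x hx hy
    obtain ⟨n, z, hz, hn⟩ := exists_mul_pow_eq R hx π.2 hy
    set y : R := ⟨π * x, hy⟩ with hydef
    have hyn : y ^ n = π * ⟨z, hz⟩ := Subtype.ext (by simpa using hn)
    have hq : 1 < p ^ k := Nat.one_lt_pow hk hp.one_lt
    have hle : n ≤ (p ^ k) ^ n := (Nat.lt_pow_self hq).le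
    have hmem := pow_frobenius_fixed _ _ h4 y n
    have hmem2 : y ^ (p ^ k) ^ n ∈ Ideal.span {π, (p : R)} := by
      rw [← Nat.sub_add_cancel hle, pow_add, hyn]
      refine Ideal.mul_mem_left _ _ (Ideal.mul_mem_right _ _ (Ideal.subset_span (by simp)))
    have hyI : y ∈ Ideal.span {π, (p : R)} := by
      have := Ideal.sub_mem _ hmem2 hmem
      rwa [sub_sub_cancel] at this
    obtain ⟨u, v, huv⟩ := Ideal.mem_span_pair.mp hyI
    have : e * y = π * (e * u + r * v) := by
      rw [← huv]
      linear_combination -v * h1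
    have h5 := congrArg (Subtype.val) this
    simp only [Subring.coe_mul, hydef] at h5
    have h6 : (e : K) * x = ((e * u + r * v : R) : K) := by
      apply mul_left_cancel₀ hπ0'
      rw [← h5]; ring
    rw [h6]
    exact Subtype.mem _
  have iter : ∀ (n : ℕ) (x : K), IsIntegral ℤ x → π ^ n * x ∈ R → e ^ n * x ∈ R := by
    intro n
    induction n with
    | zero => intro x _ h; simpa using h
    | succ n ih =>
      intro x hx h
      have h' := step (π ^ n * x) (((hR _ π.2).pow n).mul hx) (by rw [pow_succ'] at h; rwa [← mul_assoc])
      have := ih (e * x) ((hR _ e.2).mul hx) (by convert h' using 1; ring)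
      convert this using 1
      ring
  have h5 : (π : K) ^ p ^ N * x ∈ R := by
    have := congrArg (Subtype.val) h3
    push_cast at this
    rw [this]
    convert R.mul_mem c.2 hpx using 1
    ring
  have h6 := iter _ x hx h5
  obtain ⟨w, hw⟩ : ∃ w : R, e ^ p ^ N = 1 + p * w := by
    obtain ⟨s, hs⟩ := exists_add_pow_prime_pow_eq hp (1 + π * a) (p * b) N
    obtain ⟨t, ht⟩ := exists_add_pow_prime_pow_eq hp 1 (π * a) N
    have hpN : p ^ N = (p ^ N - 1) + 1 := (Nat.sub_add_cancel (Nat.one_le_pow _ _ hp.pos)).symm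
    refine ⟨c * a ^ p ^ N + 1 * (π * a) * t + p ^ (p ^ N - 1) * b ^ p ^ N
      + (1 + π * a) * (p * b) * s, ?_⟩
    rw [h2, hs, ht, mul_pow, mul_pow, h3, one_pow]
    have : (p : R) ^ p ^ N = p * p ^ (p ^ N - 1) := by
      conv_lhs => rw [hpN]
      rw [pow_succ']
    rw [this]
    ring
  have h7 := congrArg (Subtype.val) hw
  push_cast at h7
  have : x = (e : K) ^ p ^ N * x - w * (p * x) := by rw [h7]; ring
  rw [this]
  exact R.sub_mem h6 (R.mul_mem w.2 hpx)

theorem exists_discr_eq_sq_mul {K : Type*} [Field K] [NumberField K] {n : ℕ} (b : Fin n → K)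
    (hb : LinearIndependent ℚ b) (hn : Module.finrank ℚ K = n)
    (hintegral : ∀ i, IsIntegral ℤ (b i)) :
    ∃ m : ℤ, Algebra.discr ℚ b = m ^ 2 * NumberField.discr K ∧
      ∀ p : ℕ, p.Prime → (∀ x : K, IsIntegral ℤ x → p * x ∈ Submodule.span ℤ (Set.range b) →
        x ∈ Submodule.span ℤ (Set.range b)) → ¬ (p : ℤ) ∣ m := by
  classical
  have hcard : Fintype.card (Module.Free.ChooseBasisIndex ℤ (NumberField.RingOfIntegers K)) = n := by
    rw [← Module.finrank_eq_card_chooseBasisIndex, NumberField.RingOfIntegers.rank, hn]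
  let B := (NumberField.RingOfIntegers.basis K).reindex (Fintype.equivFinOfCardEq hcard)
  let c : Fin n → NumberField.RingOfIntegers K := fun i => ⟨b i, hintegral i⟩
  let P : Matrix (Fin n) (Fin n) ℤ := Matrix.of fun i j => B.repr (c i) j
  have hP : ∀ i, b i = ∑ j, (P i j : K) * B j := by
    intro i
    have h := congrArg (algebraMap (NumberField.RingOfIntegers K) K) (B.sum_repr (c i))
    rw [map_sum] at h
    simp only [zsmul_eq_mul, map_mul, map_intCast] at h
    exact h.symm
  refine ⟨P.det, ?_, ?_⟩
  · have h1 : (NumberField.discr K : ℚ) = Algebra.discr ℚ (fun j => (B j : K)) := by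
      have h := Algebra.discr_localizationLocalization ℤ (nonZeroDivisors ℤ) K B (Rₘ := ℚ)
      rw [eq_intCast, NumberField.discr_eq_discr K B] at h
      rw [← h]
      congr 1
      funext j
      simp
    have h2 : b = ((P.map (Int.cast : ℤ → ℚ)).map (algebraMap ℚ K)).mulVec (fun j => (B j : K)) := by
      funext i
      rw [hP i]
      simp [Matrix.mulVec, dotProduct]
    rw [h1]
    conv_lhs => rw [h2]
    rw [Algebra.discr_of_matrix_mulVec]
    congr 2
    exact (Int.cast_det P).symm
  · intro p hp hmax hdvd
    have := Fact.mk hp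
    have hdet : (P.map (Int.cast : ℤ → ZMod p)).det = 0 := by
      rw [← Int.cast_det]
      exact (ZMod.intCast_zmod_eq_zero_iff_dvd _ p).mpr hdvd
    obtain ⟨v, hv0, hv⟩ := Matrix.exists_vecMul_eq_zero_iff.mpr hdet
    choose w hw using fun i => ZMod.intCast_surjective (v i)
    have hz : ∀ j, (p : ℤ) ∣ ∑ i, w i * P i j := by
      intro j
      rw [← ZMod.intCast_zmod_eq_zero_iff_dvd]
      have := congrFun hv j
      simp only [Matrix.vecMul, dotProduct, Matrix.map_apply, Pi.zero_apply] at this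
      push_cast
      simpa only [hw] using this
    choose z hz using hz
    have hpK : (p : K) ≠ 0 := Nat.cast_ne_zero.mpr hp.ne_zero
    let x : K := ∑ j, (z j : K) * B j
    have hx : IsIntegral ℤ x := IsIntegral.sum _ fun j _ =>
      (isIntegral_algebraMap (x := z j)).mul (B j).2
    have hpx : p * x = ∑ i, (w i : K) * b i := by
      simp only [hP, Finset.mul_sum, x]
      rw [Finset.sum_comm]
      refine Finset.sum_congr rfl fun j _ => ?_
      have := congrArg (Int.cast : ℤ → K) (hz j)
      push_cast at this
      rw [← mul_assoc, ← this, Finset.sum_mul]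
      exact Finset.sum_congr rfl fun i _ => by ring
    have hmem := hmax x hx (by
      rw [hpx]
      refine Submodule.sum_mem _ fun i _ => ?_
      rw [← zsmul_eq_mul]
      exact Submodule.smul_mem _ _ (Submodule.subset_span ⟨i, rfl⟩))
    obtain ⟨u, hu⟩ := (Submodule.mem_span_range_iff_exists_fun ℤ).mp hmem
    have hzero : ∑ i, ((w i - p * u i : ℤ) : ℚ) • b i = 0 := by
      have : ∑ i, (w i : K) * b i = p * ∑ i, u i • b i := by rw [hu, hpx]
      rw [Finset.mul_sum, ← sub_eq_zero, ← Finset.sum_sub_distrib] at this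
      rw [← this]
      refine Finset.sum_congr rfl fun i _ => ?_
      rw [zsmul_eq_mul, Rat.smul_def]
      push_cast
      ring
    have hall := Fintype.linearIndependent_iff.mp hb _ hzero
    apply hv0
    funext i
    have h3 : w i = p * u i := by
      have := hall i
      have h4 : w i - p * u i = 0 := by exact_mod_cast this
      linarith
    rw [← hw i, h3]
    simp

/-- Greatest common divisor of the entries of a list. -/
def contentList (l : List ℤ) : ℤ := (l.foldr (fun c g => Nat.gcd c.natAbs g) 0 : ℕ)

/-- Euclid's algorithm for the resultant of two polynomials of degrees `n + 1` and `n`: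
the resultant is, up to sign, the quotient of the two returned numbers. -/
def resultantList : ℕ → List ℤ → List ℤ → ℤ × ℤ
  | 0, _, B => (B.getD 0 0, 1)
  | n + 1, A, B =>
    let a := A.getD (n + 2) 0
    let b := B.getD (n + 1) 0
    let q := [b * A.getD (n + 1) 0 - a * B.getD n 0, a * b]
    let r := addList (smulList (b ^ 2) A) (smulList (-1) (mulList q B))
    let e := contentList r
    let s := (r.take (n + 1)).map (· / e)
    if r.take (n + 1) = smulList e s ∧ (r.drop (n + 1)).all (· == 0) then
      let v := resultantList n B s
      (e ^ (n + 1) * b ^ 2 * v.1, (b ^ 2) ^ (n + 1) * v.2)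
    else (0, 0)

theorem evalList_eq_zero_of_all {A : Type*} [CommRing A] (l : List ℤ) (x : A)
    (h : l.all (· == 0) = true) : evalList l x = 0 := by
  induction l with
  | nil => rfl
  | cons c l ih =>
    simp only [List.all_cons, Bool.and_eq_true, beq_iff_eq] at h
    simp [h.1, ih h.2]

theorem evalList_take_add_drop {A : Type*} [CommRing A] (l : List ℤ) (n : ℕ) (x : A) :
    evalList l x = evalList (l.take n) x + x ^ n * evalList (l.drop n) x := by
  induction n generalizing l with
  | zero => simp
  | succ n ih =>
    cases l with
    | nil => simp
    | cons c l =>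
      simp only [List.take_succ_cons, List.drop_succ_cons, evalList_cons]
      rw [ih l]; ring

theorem abs_resultant_step {A B R : ℤ[X]} {Q : ℤ[X]} {c e : ℤ} {n : ℕ}
    (hB : B.natDegree ≤ n + 1) (hR : R.natDegree ≤ n)
    (hQ : Q.natDegree ≤ 1) (h : C c * A = C e * R + B * Q) :
    |c ^ (n + 1) * resultant A B (n + 2) (n + 1)| =
      |e ^ (n + 1) * B.coeff (n + 1) ^ 2 * resultant B R (n + 1) n| := by
  rw [← resultant_C_mul_left, h, resultant_add_mul_left _ _ _ _ _ (by omega) hB,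
    resultant_C_mul_left, resultant_add_left_deg _ _ _ _ _ hR, resultant_comm]
  simp only [abs_mul, abs_pow, abs_neg, abs_one, one_pow, one_mul]
  ring

theorem abs_resultantList (n : ℕ) (A B : List ℤ) (hA : A.length ≤ n + 2) (hB : B.length ≤ n + 1) :
    |(resultantList n A B).2 * resultant (evalList A (X : ℤ[X])) (evalList B X) (n + 1) n| =
      |(resultantList n A B).1| := by
  induction n generalizing A B with
  | zero =>
    simp only [resultantList, resultant_zero_right_deg, coeff_evalList_X]
    simp
  | succ n ih =>
    unfold resultantList
    extract_lets a b q r e s v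
    split_ifs with hc
    · obtain ⟨h1, h2⟩ := hc
      have hs : s.length ≤ n + 1 := by simp [s]
      have hR : evalList r (X : ℤ[X]) = C e * evalList s X := by
        rw [evalList_take_add_drop r (n + 1), h1, evalList_smulList, evalList_eq_zero_of_all _ _ h2]
        simp
      have hr : evalList r (X : ℤ[X]) = C (b ^ 2) * evalList A X - evalList B X * evalList q X := by
        simp only [r, evalList_addList, evalList_smulList, evalList_mulList]
        rw [eq_intCast C (b ^ 2)]
        push_cast
        ring
      have hstep := abs_resultant_step (A := evalList A X) (B := evalList B X) (R := evalList s X)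
        (Q := evalList q X) (c := b ^ 2) (e := e) (n := n)
        (natDegree_evalList_X_le _ _ hB)
        (natDegree_evalList_X_le _ _ hs) (natDegree_evalList_X_le _ _ (by simp [q]))
        (by rw [← hR, hr]; ring)
      have hv := ih B s hB hs
      rw [abs_mul] at hv
      simp only [abs_mul] at hstep ⊢
      rw [← hv, coeff_evalList_X] at *
      calc _ = |v.2| * (|(b ^ 2) ^ (n + 1)| * |resultant (evalList A (X : ℤ[X])) (evalList B X)
          (n + 2) (n + 1)|) := by ring
        _ = _ := by rw [hstep]; simp only [b, Int.cast_id, v]; ring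
    · simp

theorem norm_aeval_gen {K : Type*} [Field K] [NumberField K] (pb : PowerBasis ℚ K) (g : ℚ[X])
    (n : ℕ) (hg : g.natDegree ≤ n) :
    Algebra.norm ℚ (aeval pb.gen g) = resultant (minpoly ℚ pb.gen) g pb.dim n := by
  let E := AlgebraicClosure ℚ
  have hs := IsAlgClosed.splits ((minpoly ℚ pb.gen).map (algebraMap ℚ E))
  have hsep : IsSeparable ℚ pb.gen := Algebra.IsSeparable.isSeparable ℚ pb.gen
  have hmonic := minpoly.monic pb.isIntegral_gen
  apply (algebraMap ℚ E).injective
  rw [Algebra.norm_eq_prod_embeddings, ← resultant_map_map, pb.natDegree_minpoly.symm,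
    ← hmonic.natDegree_map (algebraMap ℚ E),
    resultant_eq_prod_eval _ _ _ (natDegree_map_le.trans hg) hs, (hmonic.map _).leadingCoeff,
    one_pow, one_mul]
  classical
  rw [Fintype.prod_equiv pb.liftEquiv' _ (fun y => (g.map (algebraMap ℚ E)).eval (y : E))]
  · rw [Finset.prod_mem_multiset _ _ (fun y => (g.map (algebraMap ℚ E)).eval y) (fun _ => rfl),
      Finset.prod_eq_multiset_prod, Multiset.toFinset_val, Multiset.dedup_eq_self.mpr]
    exact nodup_roots (Separable.map hsep)
  · intro σ
    rw [PowerBasis.liftEquiv'_apply_coe, eval_map_algebraMap, aeval_algHom_apply]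

/-- Coefficient list of the derivative. -/
def derivList : List ℤ → List ℤ
  | [] => []
  | _ :: [] => []
  | _ :: b :: l => addList (b :: l) (0 :: derivList (b :: l))

theorem derivative_evalList {A : Type*} [CommRing A] (l : List ℤ) :
    derivative (evalList l (X : A[X])) = evalList (derivList l) X := by
  induction l with
  | nil => simp [derivList]
  | cons a l ih =>
    cases l with
    | nil => simp [derivList]
    | cons b l =>
      rw [evalList_cons, derivList, evalList_addList, evalList_cons 0, ← ih]
      simp

theorem length_addList (l m : List ℤ) : (addList l m).length = max l.length m.length := by
  induction l generalizing m with
  | nil => simp [addList]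
  | cons a l ih => cases m <;> simp [addList, ih]

theorem length_derivList (l : List ℤ) : (derivList l).length = l.length - 1 := by
  induction l with
  | nil => rfl
  | cons a l ih =>
    cases l with
    | nil => rfl
    | cons b l => rw [derivList, length_addList]; simp [ih]

theorem abs_discr_powers {K : Type*} [Field K] [NumberField K] (pb : PowerBasis ℚ K) (n : ℕ)
    (l : List ℤ) (hl : l.length = n + 2) (hpb : minpoly ℚ pb.gen = evalList l X)
    (hdim : pb.dim = n + 1) (D : ℕ)
    (h0 : (resultantList n l (derivList l)).2 ≠ 0)
    (h : (resultantList n l (derivList l)).1.natAbs =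
      (resultantList n l (derivList l)).2.natAbs * D) :
    |Algebra.discr ℚ (fun i : Fin (n + 1) => pb.gen ^ (i : ℕ))| = D := by
  have h1 : Algebra.discr ℚ (fun i : Fin (n + 1) => pb.gen ^ (i : ℕ)) =
      Algebra.discr ℚ pb.basis := by
    have : ∀ m (hm : pb.dim = m), Algebra.discr ℚ (fun i : Fin m => pb.gen ^ (i : ℕ)) =
      Algebra.discr ℚ pb.basis := by
      rintro m rfl
      congr 1
      funext i
      rw [pb.basis_eq_pow]
    exact this _ hdim
  have h2 := abs_resultantList n l (derivList l) hl.le (by rw [length_derivList, hl]; omega)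
  rw [h1, Algebra.discr_powerBasis_eq_norm, norm_aeval_gen pb _ n, hpb, derivative_evalList, hdim,
    abs_mul, abs_pow, abs_neg, abs_one, one_pow, one_mul]
  · rw [← map_evalList_X (Int.castRingHom ℚ) l, ← map_evalList_X (Int.castRingHom ℚ) (derivList l),
      resultant_map_map]
    have h3 : |resultant (evalList l (X : ℤ[X])) (evalList (derivList l) X) (n + 1) n| = D := by
      rw [abs_mul] at h2
      apply mul_left_cancel₀ (abs_ne_zero.mpr h0)
      rw [h2]
      rw [Int.abs_eq_natAbs, Int.abs_eq_natAbs, h]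
      push_cast
      rfl
    rw [eq_intCast, ← Int.cast_abs, h3]
    simp
  · rw [hpb, derivative_evalList]
    exact natDegree_evalList_X_le _ _ (by rw [length_derivList, hl]; omega)

theorem evalList_eq_sum {A : Type*} [CommRing A] (l : List ℤ) (n : ℕ) (x : A)
    (h : ∀ i, n ≤ i → l.getD i 0 = 0) :
    evalList l x = ∑ i : Fin n, (l.getD i 0 : A) * x ^ (i : ℕ) := by
  induction l generalizing n with
  | nil => simp
  | cons c l ih =>
    cases n with
    | zero =>
      have h0 := h 0 le_rfl
      have h1 := ih 0 (fun i _ => by simpa using h (i + 1) (by omega))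
      simp_all
    | succ n =>
      have h1 := ih n (fun i hi => by simpa using h (i + 1) (by omega))
      rw [evalList_cons, Fin.sum_univ_succ, h1, Finset.mul_sum]
      simp [pow_succ]
      exact Finset.sum_congr rfl fun i _ => by ring

theorem discr_triangular {K : Type*} [Field K] [NumberField K] {n : ℕ} (x : K)
    (l : List (List ℤ)) (d : ℤ) (hd : d ≠ 0)
    (h0 : ∀ i : Fin n, ∀ j : ℕ, (i : ℕ) < j → (l.getD i []).getD j 0 = 0) :
    Algebra.discr ℚ (fun i : Fin n => evalList (l.getD i []) x / (d : K)) * ((d : ℚ) ^ n) ^ 2 =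
      (∏ i : Fin n, ((l.getD i []).getD i 0 : ℚ)) ^ 2 *
        Algebra.discr ℚ (fun i : Fin n => x ^ (i : ℕ)) := by
  let P : Matrix (Fin n) (Fin n) ℚ := Matrix.of fun i j => ((l.getD i []).getD j 0 : ℚ) / d
  have hP : (fun i : Fin n => evalList (l.getD i []) x / (d : K)) =
      (P.map (algebraMap ℚ K)).mulVec (fun i : Fin n => x ^ (i : ℕ)) := by
    funext i
    rw [evalList_eq_sum (l.getD i []) n x (fun j hj => h0 i j (by omega))]
    simp only [Matrix.mulVec, dotProduct, P, Matrix.map_apply, Matrix.of_apply, Finset.sum_div]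
    refine Finset.sum_congr rfl fun j _ => ?_
    rw [map_div₀, map_intCast, map_intCast]
    ring
  have hdet : P.det * (d : ℚ) ^ n = ∏ i : Fin n, ((l.getD i []).getD i 0 : ℚ) := by
    rw [Matrix.det_of_isLowerTriangular]
    · have : (d : ℚ) ≠ 0 := by exact_mod_cast hd
      simp only [P, Matrix.of_apply, Finset.prod_div_distrib]
      simp
      field_simp
    · intro i j hij
      have : (i : ℕ) < j := hij
      simp only [P, Matrix.of_apply, h0 i j this]; simp
  rw [hP, Algebra.discr_of_matrix_mulVec, ← hdet]
  ring

/-- Whether two coefficient lists agree up to trailing zeros. -/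
def sameList (l m : List ℤ) : Bool := (addList l (smulList (-1) m)).all (· == 0)

theorem evalList_eq_of_sameList {A : Type*} [CommRing A] {l m : List ℤ} (h : sameList l m = true)
    (x : A) : evalList l x = evalList m x := by
  have := evalList_eq_zero_of_all _ x h
  rw [evalList_addList, evalList_smulList] at this
  push_cast at this
  linear_combination this

/-- Quotient and remainder of a coefficient list by a monic one of degree `n`. -/
def divModList (n : ℕ) (F l : List ℤ) : List ℤ × List ℤ :=
  l.foldr (fun c a =>
    let r := c :: a.2
    let t := r.getD n 0
    if t = 0 then (0 :: a.1, r.take n) else (t :: a.1, (addMulList (-t) F r).take n)) ([], [])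

theorem length_addMulList (c : ℤ) (l m : List ℤ) :
    (addMulList c l m).length = max l.length m.length := by
  induction l generalizing m with
  | nil => simp [addMulList]
  | cons a l ih => cases m <;> simp [addMulList, ih]

theorem getD_addMulList (c : ℤ) (l m : List ℤ) (i : ℕ) :
    (addMulList c l m).getD i 0 = m.getD i 0 + c * l.getD i 0 := by
  induction l generalizing m i with
  | nil => simp [addMulList]
  | cons a l ih =>
    cases i with
    | zero => cases m <;> simp [addMulList]
    | succ i =>
      cases m with
      | nil => simpa [addMulList] using ih [] i
      | cons b m => simpa [addMulList] using ih m i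

theorem evalList_take {A : Type*} [CommRing A] (l : List ℤ) (n : ℕ) (hl : l.length ≤ n + 1)
    (h : l.getD n 0 = 0) (x : A) : evalList (l.take n) x = evalList l x := by
  rw [evalList_take_add_drop l n]
  have : evalList (l.drop n) x = 0 := by
    rcases hd : l.drop n with _ | ⟨c, m⟩
    · simp
    · have h1 : m = [] := by
        have := congrArg List.length hd
        simp only [List.length_drop, List.length_cons] at this
        exact List.length_eq_zero_iff.mp (by omega)
      have h2 : c = 0 := by
        have h3 := congrArg (·.getD 0 0) hd
        rw [← h]
        simpa using h3.symm
      simp [h1, h2]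
  rw [this, mul_zero, add_zero]

theorem evalList_divModList {A : Type*} [CommRing A] {n : ℕ} {F : List ℤ}
    (hF : F.length = n + 1) (hlead : F.getD n 0 = 1) (l : List ℤ) (x : A) :
    (divModList n F l).2.length ≤ n ∧ evalList l x =
      evalList (divModList n F l).1 x * evalList F x + evalList (divModList n F l).2 x := by
  induction l with
  | nil => simp [divModList]
  | cons c l ih =>
    have h0 : divModList n F (c :: l) =
      (let r := c :: (divModList n F l).2
       let t := r.getD n 0
       if t = 0 then (0 :: (divModList n F l).1, r.take n)
       else (t :: (divModList n F l).1, (addMulList (-t) F r).take n)) := rfl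
    rw [h0]
    extract_lets r t
    have hr : r.length ≤ n + 1 := by simpa [r] using ih.1
    split_ifs with ht
    · refine ⟨by simp, ?_⟩
      dsimp only
      rw [evalList_take r n hr ht]
      simp only [evalList_cons, r]
      rw [ih.2]; push_cast; ring
    · refine ⟨by simp, ?_⟩
      dsimp only
      rw [evalList_take _ n (by rw [length_addMulList, hF]; omega)
        (by rw [getD_addMulList, hlead]; ring), evalList_addMulList]
      simp only [evalList_cons, r]
      rw [ih.2]; push_cast; ring

/-- Linear combination of coefficient lists. -/
def combList (q : List ℤ) (rows : List (List ℤ)) : List ℤ :=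
  (List.zip q rows).foldr (fun p acc => if p.1 = 0 then acc else addMulList p.1 p.2 acc) []

/-- Coordinates of `l` in a triangular family, listed from the top degree down. -/
def coordList : List (List ℤ) → List ℤ → List ℤ → List ℤ
  | [], _, acc => acc
  | row :: rs, l, acc =>
    let q := l.getD rs.length 0 / row.getD rs.length 0
    coordList rs (if q = 0 then l else addMulList (-q) row l) (q :: acc)

/-- Sufficient test for `l(x) / D` to be an integral combination of the `row(x) / d`, where `x` is
a root of `F`. -/
def checkMem (n : ℕ) (F : List ℤ) (rows : List (List ℤ)) (d D : ℤ) (l : List ℤ) : Bool :=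
  let r := (divModList n F l).2
  sameList (smulList d r)
    (smulList D (combList (coordList rows.reverse (r.map fun c => c * d / D) []) rows))

/-- The elements `row(x) / d`. -/
def rowSet {K : Type*} [Field K] (x : K) (d : ℤ) (rows : List (List ℤ)) : Set K :=
  {y | ∃ row ∈ rows, y = evalList row x / d}

theorem evalList_combList_mem {K : Type*} [Field K] (x : K) (d : ℤ) (q : List ℤ)
    (rows : List (List ℤ)) :
    evalList (combList q rows) x / d ∈ Submodule.span ℤ (rowSet x d rows) := by
  induction rows generalizing q with
  | nil => simp [combList]
  | cons row rows ih =>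
    cases q with
    | nil => simp [combList]
    | cons c q =>
      have h1 : evalList (combList (c :: q) (row :: rows)) x / d =
          c • (evalList row x / (d : K)) + evalList (combList q rows) x / d := by
        simp only [combList, List.zip_cons_cons, List.foldr_cons, zsmul_eq_mul]
        split_ifs with hc
        · simp [hc]
        · rw [evalList_addMulList]; ring
      rw [h1]
      refine Submodule.add_mem _ (Submodule.smul_mem _ _ (Submodule.subset_span ⟨row, by simp, rfl⟩))
        (Submodule.span_mono ?_ (ih q))
      rintro y ⟨r, hr, rfl⟩
      exact ⟨r, by simp [hr], rfl⟩

theorem mem_of_checkMem {K : Type*} [Field K] [CharZero K] {n : ℕ} {F : List ℤ}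
    {rows : List (List ℤ)} {d D : ℤ} {l : List ℤ} {x : K} (hF : evalList F x = 0)
    (hn : F.length = n + 1) (hlead : F.getD n 0 = 1) (hd : d ≠ 0) (hD : D ≠ 0)
    (h : checkMem n F rows d D l = true) (y : K) (hy : D * y = evalList l x) :
    y ∈ Submodule.span ℤ (rowSet x d rows) := by
  have h1 := (evalList_divModList hn hlead l x).2
  have h2 := evalList_eq_of_sameList h x
  rw [hF, mul_zero, zero_add] at h1
  rw [evalList_smulList, evalList_smulList, ← h1, ← hy] at h2
  have hd' : (d : K) ≠ 0 := by exact_mod_cast hd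
  have hD' : (D : K) ≠ 0 := by exact_mod_cast hD
  have : y = evalList (combList (coordList rows.reverse
      ((divModList n F l).2.map fun c => c * d / D) []) rows) x / d := by
    rw [eq_div_iff hd']
    apply mul_left_cancel₀ hD'
    linear_combination h2
  rw [this]
  exact evalList_combList_mem x d _ rows

/-- Powers of a coefficient list modulo `F`. -/
def powList (n : ℕ) (F l : List ℤ) : ℕ → List ℤ
  | 0 => [1]
  | e + 1 => (divModList n F (mulList l (powList n F l e))).2

theorem evalList_powList {A : Type*} [CommRing A] {n : ℕ} {F : List ℤ} (hn : F.length = n + 1)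
    (hlead : F.getD n 0 = 1) {x : A} (hF : evalList F x = 0) (l : List ℤ) (e : ℕ) :
    evalList (powList n F l e) x = evalList l x ^ e := by
  induction e with
  | zero => simp [powList]
  | succ e ih =>
    have h1 := (evalList_divModList hn hlead (mulList l (powList n F l e)) x).2
    rw [hF, mul_zero, zero_add] at h1
    rw [powList, ← h1, evalList_mulList, ih, pow_succ']

/-- The power of exponent `p ^ k` of a coefficient list modulo `F`. -/
def frobeniusList (n : ℕ) (F : List ℤ) (p : ℕ) (l : List ℤ) : ℕ → List ℤ
  | 0 => l
  | k + 1 => powList n F (frobeniusList n F p l k) p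

theorem evalList_frobeniusList {A : Type*} [CommRing A] {n : ℕ} {F : List ℤ}
    (hn : F.length = n + 1) (hlead : F.getD n 0 = 1) {x : A} (hF : evalList F x = 0) (p : ℕ)
    (l : List ℤ) (k : ℕ) : evalList (frobeniusList n F p l k) x = evalList l x ^ p ^ k := by
  induction k with
  | zero => simp [frobeniusList]
  | succ k ih => rw [frobeniusList, evalList_powList hn hlead hF, ih, ← pow_mul, pow_succ]

/-- The lists of the products by powers of the variable. -/
def shiftRows (blocks : List (List ℤ × ℕ)) : List (List ℤ) :=
  blocks.flatMap fun b => (List.range b.2).map fun i => List.replicate i 0 ++ b.1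

theorem evalList_replicate_append {A : Type*} [CommRing A] (i : ℕ) (l : List ℤ) (x : A) :
    evalList (List.replicate i 0 ++ l) x = x ^ i * evalList l x := by
  induction i with
  | zero => simp
  | succ i ih => rw [List.replicate_succ, List.cons_append, evalList_cons, ih]; push_cast; ring

/-- The generators of the order with basis `shiftRows blocks`. -/
def genRows (d : ℤ) (blocks : List (List ℤ × ℕ)) : List (List ℤ) := [0, d] :: blocks.map Prod.fst

/-- Sufficient test for `shiftRows blocks` to span a ring. -/
def checkRing (n : ℕ) (F : List ℤ) (d : ℤ) (blocks : List (List ℤ × ℕ)) : Bool :=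
  F.length == n + 1 && F.getD n 0 == 1 && checkMem n F (shiftRows blocks) d 1 [1] &&
    (shiftRows blocks).all (fun row => checkMem n F (shiftRows blocks) d d (0 :: row)) &&
    blocks.all fun g => blocks.all fun h =>
      checkMem n F (shiftRows blocks) d (d * d) (mulList g.1 h.1)

theorem span_rowSet_eq {K : Type*} [Field K] [CharZero K] {n : ℕ} {F : List ℤ} {d : ℤ}
    {blocks : List (List ℤ × ℕ)} {x : K} (hF : evalList F x = 0) (hd : d ≠ 0)
    (h : checkRing n F d blocks = true) (y : K) :
    y ∈ Submodule.span ℤ (rowSet x d (shiftRows blocks)) ↔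
      y ∈ Subring.closure (rowSet x d (genRows d blocks)) := by
  simp only [checkRing, Bool.and_eq_true, List.all_eq_true, beq_iff_eq] at h
  obtain ⟨⟨⟨⟨hn, hlead⟩, h1⟩, h2⟩, h3⟩ := h
  have hd' : (d : K) ≠ 0 := by exact_mod_cast hd
  constructor
  · intro hy
    induction hy using Submodule.span_induction with
    | mem y hy =>
      obtain ⟨row, hrow, rfl⟩ := hy
      simp only [shiftRows, List.mem_flatMap, List.mem_map, List.mem_range] at hrow
      obtain ⟨b, hb, i, -, rfl⟩ := hrow
      rw [evalList_replicate_append, mul_div_assoc]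
      have hx : x ∈ rowSet x d (genRows d blocks) := by
        refine ⟨[0, d], by simp [genRows], ?_⟩
        simp only [evalList_cons, evalList_nil]
        field_simp
        simp
      refine Subring.mul_mem _ (Subring.pow_mem _ (Subring.subset_closure hx) i)
        (Subring.subset_closure ⟨b.1, ?_, rfl⟩)
      exact List.mem_cons_of_mem _ (List.mem_map_of_mem hb)
    | zero => exact Subring.zero_mem _
    | add y z _ _ hy hz => exact Subring.add_mem _ hy hz
    | smul c y _ hy => exact Subring.zsmul_mem _ hy c
  · intro hy
    have hx : ∀ i : ℕ, ∀ z ∈ Submodule.span ℤ (rowSet x d (shiftRows blocks)),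
        x ^ i * z ∈ Submodule.span ℤ (rowSet x d (shiftRows blocks)) := by
      have h4 : ∀ z ∈ Submodule.span ℤ (rowSet x d (shiftRows blocks)),
          x * z ∈ Submodule.span ℤ (rowSet x d (shiftRows blocks)) := by
        intro z hz
        induction hz using Submodule.span_induction with
        | mem z hz =>
          obtain ⟨row, hrow, rfl⟩ := hz
          refine mem_of_checkMem hF hn hlead hd hd (h2 row hrow) _ ?_
          rw [evalList_cons]
          push_cast
          field_simp
          ring
        | zero => simp
        | add y z _ _ hy hz => rw [mul_add]; exact Submodule.add_mem _ hy hz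
        | smul c y _ hy => rw [mul_smul_comm]; exact Submodule.smul_mem _ _ hy
      intro i
      induction i with
      | zero => simp
      | succ i ih => intro z hz; rw [pow_succ', mul_assoc]; exact h4 _ (ih z hz)
    suffices h5 : ∀ z ∈ Submodule.span ℤ (rowSet x d (shiftRows blocks)),
        y * z ∈ Submodule.span ℤ (rowSet x d (shiftRows blocks)) by
      simpa using h5 1 (mem_of_checkMem hF hn hlead hd one_ne_zero h1 1 (by simp))
    induction hy using Subring.closure_induction with
    | mem y hy =>
      obtain ⟨g, hg, rfl⟩ := hy
      rcases List.mem_cons.mp hg with rfl | hg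
      · intro z hz
        have : evalList [0, d] x / (d : K) = x ^ 1 := by
          simp only [evalList_cons, evalList_nil]
          field_simp
          simp
        rw [this]
        exact hx 1 z hz
      intro z hz
      induction hz using Submodule.span_induction with
      | mem z hz =>
        obtain ⟨row, hrow, rfl⟩ := hz
        simp only [shiftRows, List.mem_flatMap, List.mem_map, List.mem_range] at hrow
        obtain ⟨b, hb, i, -, rfl⟩ := hrow
        obtain ⟨b', hb', rfl⟩ := List.mem_map.mp hg
        rw [evalList_replicate_append, mul_div_assoc, mul_left_comm]
        refine hx i _ (mem_of_checkMem hF hn hlead hd (mul_ne_zero hd hd) (h3 b' hb' b hb) _ ?_)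
        rw [evalList_mulList]
        push_cast
        field_simp
      | zero => simp
      | add y z _ _ hy hz => rw [mul_add]; exact Submodule.add_mem _ hy hz
      | smul c y _ hy => rw [mul_smul_comm]; exact Submodule.smul_mem _ _ hy
    | zero => simp
    | one => simp
    | add y z _ _ hy hz => intro w hw; rw [add_mul]; exact Submodule.add_mem _ (hy w hw) (hz w hw)
    | neg y _ hy => intro w hw; rw [neg_mul]; exact Submodule.neg_mem _ (hy w hw)
    | mul y z _ _ hy hz => intro w hw; rw [mul_assoc]; exact hy _ (hz w hw)

theorem isIntegral_of_mem_span {K : Type*} [Field K] [CharZero K] {n : ℕ} {F : List ℤ} {d : ℤ}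
    {blocks : List (List ℤ × ℕ)} {x : K} (hF : evalList F x = 0) (hd : d ≠ 0)
    (h : checkRing n F d blocks = true) (y : K)
    (hy : y ∈ Submodule.span ℤ (rowSet x d (shiftRows blocks))) : IsIntegral ℤ y := by
  let S := subalgebraOfSubring (Subring.closure (rowSet x d (genRows d blocks)))
  have hS : Subalgebra.toSubmodule S = Submodule.span ℤ (rowSet x d (shiftRows blocks)) := by
    ext z
    rw [span_rowSet_eq hF hd h]
    rfl
  refine IsIntegral.of_mem_of_fg S ?_ y ((span_rowSet_eq hF hd h y).mp hy)
  rw [hS]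
  refine Submodule.fg_span ?_
  refine ((shiftRows blocks).finite_toSet.image (fun row => evalList row x / (d : K))).subset ?_
  rintro z ⟨row, hrow, rfl⟩
  exact ⟨row, hrow, rfl⟩

/-- Sufficient test for the order with basis `shiftRows blocks` to be maximal at `p`. -/
def checkMaximal (n : ℕ) (F : List ℤ) (d : ℤ) (blocks : List (List ℤ × ℕ)) (p N k : ℕ)
    (π r a : List ℤ) (U : List (List ℤ)) : Bool :=
  let M := checkMem n F (shiftRows blocks) d
  M d π && M d r && M d a && M (p * d ^ 2) (mulList π r) &&
    M (p ^ 2 * d ^ 2) (addList (mulList π r) (addList [-(p * d ^ 2)]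
      (smulList (-p) (mulList π a)))) &&
    M (p * d ^ (p ^ N)) (frobeniusList n F p π N) &&
    (List.zip (genRows d blocks) U).all (fun g => M d g.2 &&
      M (p * d ^ (p ^ k)) (addList (frobeniusList n F p g.1 k) (addList
        (smulList (-d ^ (p ^ k - 1)) g.1) (smulList (-d ^ (p ^ k - 2)) (mulList π g.2))))) &&
    U.length == (genRows d blocks).length

theorem mem_span_of_checkMaximal {K : Type*} [Field K] [CharZero K] {n : ℕ} {F : List ℤ} {d : ℤ}
    {blocks : List (List ℤ × ℕ)} {x : K} (hF : evalList F x = 0) (hd : d ≠ 0)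
    (hR : checkRing n F d blocks = true) {p N k : ℕ} (hp : p.Prime) (hk : k ≠ 0)
    {π r a : List ℤ} {U : List (List ℤ)} (h : checkMaximal n F d blocks p N k π r a U = true)
    (y : K) (hy : IsIntegral ℤ y)
    (hpy : p * y ∈ Submodule.span ℤ (rowSet x d (shiftRows blocks))) :
    y ∈ Submodule.span ℤ (rowSet x d (shiftRows blocks)) := by
  have hR' := hR
  simp only [checkRing, Bool.and_eq_true, beq_iff_eq] at hR'
  obtain ⟨⟨⟨⟨hn, hlead⟩, -⟩, -⟩, -⟩ := hR'
  simp only [checkMaximal, Bool.and_eq_true, beq_iff_eq, List.all_eq_true] at h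
  obtain ⟨⟨⟨⟨⟨⟨⟨hπ, hr⟩, ha⟩, he⟩, hb⟩, hc⟩, hU⟩, hlen⟩ := h
  have hd' : (d : K) ≠ 0 := by exact_mod_cast hd
  have hp' : (p : K) ≠ 0 := by exact_mod_cast hp.ne_zero
  have hpz : (p : ℤ) ≠ 0 := by exact_mod_cast hp.ne_zero
  have hmem : ∀ {D : ℤ} {l : List ℤ}, D ≠ 0 →
      checkMem n F (shiftRows blocks) d D l = true → ∀ y : K, D * y = evalList l x →
        y ∈ Subring.closure (rowSet x d (genRows d blocks)) := fun hD h y hy =>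
    (span_rowSet_eq hF hd hR y).mp (mem_of_checkMem hF hn hlead hd hD h y hy)
  have hdiv : ∀ l : List ℤ, (d : K) * (evalList l x / d) = evalList l x := fun l => by field_simp
  have hq : 2 ≤ p ^ k := by
    calc 2 ≤ p := hp.two_le
      _ ≤ p ^ k := Nat.le_self_pow hk p
  rw [span_rowSet_eq hF hd hR] at hpy ⊢
  refine mem_of_nsmul_mem (Subring.closure (rowSet x d (genRows d blocks))) p N k hp hk
    (fun z hz => isIntegral_of_mem_span hF hd hR z ((span_rowSet_eq hF hd hR z).mpr hz))
    ⟨evalList π x / d, hmem hd hπ _ (hdiv _)⟩ ⟨evalList r x / d, hmem hd hr _ (hdiv _)⟩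
    ⟨(evalList π x / d) * (evalList r x / d) / p, hmem (mul_ne_zero hpz (pow_ne_zero 2 hd)) he _ ?_⟩
    ⟨evalList a x / d, hmem hd ha _ (hdiv _)⟩
    ⟨((evalList π x / d) * (evalList r x / d) / p - 1 - (evalList π x / d) * (evalList a x / d)) / p,
      hmem (mul_ne_zero (pow_ne_zero 2 hpz) (pow_ne_zero 2 hd)) hb _ ?_⟩
    ⟨(evalList π x / d) ^ p ^ N / p, hmem (mul_ne_zero hpz (pow_ne_zero _ hd)) hc _ ?_⟩
    hp' ?_ ?_ ?_ ?_ y hy hpy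
  · rw [evalList_mulList]; push_cast; field_simp
  · simp only [evalList_mulList, evalList_addList, evalList_smulList, evalList_cons, evalList_nil]
    push_cast
    field_simp
    ring
  · rw [evalList_frobeniusList hn hlead hF, div_pow]; push_cast; field_simp
  · apply Subtype.ext; simp only [Subring.coe_mul, Subring.coe_natCast]; field_simp
  · apply Subtype.ext
    simp only [Subring.coe_mul, Subring.coe_add, Subring.coe_one, Subring.coe_natCast]
    field_simp
    ring
  · apply Subtype.ext
    simp only [Subring.coe_mul, Subring.coe_pow, Subring.coe_natCast]
    field_simp
  · rintro ⟨z, hz⟩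
    set π' : Subring.closure (rowSet x d (genRows d blocks)) :=
      ⟨evalList π x / d, hmem hd hπ _ (hdiv _)⟩ with hπ'
    refine frobenius_fixed_closure p k hp π' {g | (g : K) ∈ rowSet x d (genRows d blocks)} ?_ _ ?_
    · rintro ⟨g, hg⟩ hg'
      obtain ⟨l, hl, rfl⟩ := hg'
      obtain ⟨i, hi, rfl⟩ := List.mem_iff_getElem.mp hl
      have h1 := hU ((genRows d blocks)[i], U[i]) (by
        rw [← List.getElem_zip (h := by simp [hi, hlen])]
        exact List.getElem_mem _)
      set l := (genRows d blocks)[i]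
      set u := U[i]
      rw [Ideal.mem_span_pair]
      refine ⟨⟨evalList u x / d, hmem hd h1.1 _ (hdiv _)⟩, ⟨((evalList l x / d) ^ p ^ k -
        evalList l x / d - (evalList π x / d) * (evalList u x / d)) / p,
        hmem (mul_ne_zero hpz (pow_ne_zero _ hd)) h1.2 _ ?_⟩, ?_⟩
      · simp only [evalList_mulList, evalList_addList, evalList_smulList,
          evalList_frobeniusList hn hlead hF]
        obtain ⟨m, hm⟩ := Nat.exists_eq_add_of_le hq
        rw [hm, show 2 + m - 1 = m + 1 by omega, show 2 + m - 2 = m by omega]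
        push_cast
        rw [div_pow]
        field_simp
        ring
      · apply Subtype.ext
        push_cast [hπ']
        field_simp
        ring
    · have : ∀ z (hz : z ∈ Subring.closure (rowSet x d (genRows d blocks))),
          (⟨z, hz⟩ : Subring.closure (rowSet x d (genRows d blocks))) ∈ Subring.closure
            {g : Subring.closure (rowSet x d (genRows d blocks)) |
              (g : K) ∈ rowSet x d (genRows d blocks)} := by
        intro z hz
        induction hz using Subring.closure_induction with
        | mem y hy => exact Subring.subset_closure hy
        | zero => exact Subring.zero_mem _
        | one => exact Subring.one_mem _
        | add y z _ _ h1 h2 => exact Subring.add_mem _ h1 h2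
        | neg y _ h1 => exact Subring.neg_mem _ h1
        | mul y z _ _ h1 h2 => exact Subring.mul_mem _ h1 h2
      exact this z hz

/-- Coefficients of the polynomial of degree 24. -/
def coeffList : List ℤ :=
[81, 2673, 15552, -104841, 278586, -520641, 733491, -753291, 623997, -483318, 351252, -237699,
  154308, -89067, 42768, -17710, 6512, -2255, 1012, -594, 330, -154, 53, -11, 1]

/-- A basis, up to the factor `81`, of an order maximal at `3`. -/
def blocks₃ : List (List ℤ × ℕ) :=
[([81], 13), (smulList 27 [0, 0, 0, 0, 0, 2, 0, 1, 0, 0, 0, 2, 0, 1], 5), (smulList 9 [0, 0, 0, 0,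
  0, 3, 6, 6, 3, 5, 8, 1, 7, 0, 0, 2, 2, 1, 1], 3), (smulList 3 [0, 0, 0, 9, 9, 0, 18, 0, 9, 6, 0,
  12, 23, 8, 7, 7, 3, 0, 2, 2, 1, 1], 2), ([0, 0, 27, 54, 54, 36, 63, 54, 45, 36, 0, 78, 12, 75, 53,
  71, 1, 43, 42, 18, 5, 65, 40, 1], 1)]

/-- A generator of the radical of `2`. -/
def radical₂ : List ℤ :=
[1, 1, 0, 1, 1, 0, 1, 0, 1, 1, 0, 1, 1]

/-- The product of `radical₂` with this is divisible by `2`. -/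
def cofactor₂ : List ℤ :=
[-340481, -170249, -245683, -214987, 113443, -392312, -149020, 86539, -41507, -323343, -176540,
  -243493, 124494, -56196, 23273, -9313, 3739, -1716, 866, -406, 167, -54, 11, -1]

/-- The product of `X ^ 2 - 2` with this is divisible by `11`. -/
def cofactor₁₁ : List ℤ :=
[-208004328, 147090735, -103932180, 73073583, -50712453, 34193907, -22055517, 13707144, -8219772,
  4678641, -2529252, 1269675, -570240, 234036, -92664, 37323, -17028, 8514, -3960, 1584, -495, 99,
  -9]

/-- A local generator of the radical of `3`. -/
def radical₃ : List ℤ :=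
combList [0, 1, 2, 0, 2, 0, 0, 0, 0, 0, 0, 0, 0, 1, 0, 0, 1, 0, 0, 0, 0, 0, 0, 0] (shiftRows
  blocks₃)

/-- The product of `radical₃` with this is divisible by `3`. -/
def cofactor₃ : List ℤ :=
combList [0, 0, -1, -1, -1, 0, -1, -1, -1, 1, 0, 1, 0, 0, 0, -1, 1, -1, 0, 0, -1, 0, 0, 0]
  (shiftRows blocks₃)

/-- Witness for the invertibility of `radical₃ * cofactor₃ / 3` modulo `radical₃`. -/
def unit₃ : List ℤ :=
combList [-1, 0, 0, -1, 0, 0, 1, -1, 1, 0, 0, 0, 0, 0, -1, 0, 0, 0, 0, -1, 0, 0, 1, 1] (shiftRows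
  blocks₃)

/-- Witnesses for the Frobenius congruences modulo `radical₃`. -/
def frobenius₃ : List (List ℤ) :=
[[-1, 0, 0, 0, 0, 0, 0, 1, 0, 0, 0, 0, 0, 1, 0, 0, -1, 0, -1, 0, 0, 0, 0, 0], [], [0, 0, 0, 0, 0,
  -1, 0, -1, -1, 0, 0, 0, 0, -1, 1, 0, 1, 0, 1, -1, 0, 0, 1, 0], [0, 0, 1, 1, 0, -1, -1, -1, -1, 0,
  0, 0, 0, -1, 0, 0, 0, 0, -1, 0, 0, 0, -1, 0], [0, 0, -1, 1, 0, 0, 0, 0, 1, 0, 0, 0, 0, -1, 1, 1,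
  0, 0, -1, -1, 0, 1, 1, 1], [0, 0, -1, -1, 0, -1, 1, -1, -1, 0, 0, 0, 0, -1, 0, -1, 1, 0, 1, 0, 0,
  -1, -1, -1]].map (combList · (shiftRows blocks₃))

theorem checkRing_blocks₃ : checkRing 24 coeffList 81 blocks₃ = true := by
  decide +kernel

theorem checkRing_powers : checkRing 24 coeffList 1 [([1], 24)] = true := by
  decide +kernel

theorem checkMaximal_three : checkMaximal 24 coeffList 81 blocks₃ 3 2 2 radical₃ cofactor₃ unit₃
    frobenius₃ = true := by
  decide +kernel

theorem checkMaximal_two : checkMaximal 24 coeffList 1 [([1], 24)] 2 2 6 radical₂ cofactor₂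
    [1, 1, 0, 0, 0, 1, 1, 0, 1, 0, 1]
    [(divModList 12 radical₂ (addMulList (-1) [0, 1]
      (frobeniusList 24 coeffList 2 [0, 1] 6))).1, []] = true := by
  decide +kernel

theorem checkMaximal_eleven : checkMaximal 24 coeffList 1 [([1], 24)] 11 2 2 [-2, 0, 1] cofactor₁₁
    []
    [(divModList 2 [-2, 0, 1] (addMulList (-1) [0, 1]
      (frobeniusList 24 coeffList 11 [0, 1] 2))).1, []] = true := by
  decide +kernel

theorem getD_eq_zero_of_all_drop {l : List ℤ} {i j : ℕ} (hij : i ≤ j)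
    (h : (l.drop i).all (· == 0) = true) : l.getD j 0 = 0 := by
  by_cases hj : j < l.length
  · rw [List.getD_eq_getElem _ _ hj]
    simp only [List.all_eq_true, beq_iff_eq] at h
    refine h _ (List.mem_drop_iff_getElem.mpr ⟨j - i, by omega, ?_⟩)
    congr 1
    omega
  · exact List.getD_eq_default _ _ (by omega)

theorem exists_sq_mul_discr_eq {K : Type*} [Field K] [NumberField K] {n : ℕ} (x : K)
    (hn : Module.finrank ℚ K = n) (D : ℕ) (hD0 : D ≠ 0)
    (hD : |Algebra.discr ℚ (fun i : Fin n => x ^ (i : ℕ))| = D)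
    (rows : List (List ℤ)) (hlen : rows.length = n) (d : ℤ) (hd : d ≠ 0) (c : ℕ)
    (h0 : ∀ i : Fin n, ((rows.getD i []).drop (i + 1)).all (· == 0) = true)
    (hc : ∏ i : Fin n, (rows.getD i []).getD i 0 = c) (hc0 : c ≠ 0)
    (hintegral : ∀ row ∈ rows, IsIntegral ℤ (evalList row x / d)) :
    ∃ m : ℕ, D * c ^ 2 = m ^ 2 * (NumberField.discr K).natAbs * (d.natAbs ^ n) ^ 2 ∧
      ∀ p : ℕ, p.Prime → (∀ y : K, IsIntegral ℤ y →
        p * y ∈ Submodule.span ℤ (rowSet x d rows) → y ∈ Submodule.span ℤ (rowSet x d rows)) →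
        ¬ p ∣ m := by
  set b : Fin n → K := fun i => evalList (rows.getD i []) x / (d : K) with hb
  have h1 := discr_triangular x rows d hd (n := n)
    (fun i j hij => getD_eq_zero_of_all_drop hij (h0 i))
  have h2 : ((∏ i : Fin n, ((rows.getD i []).getD i 0 : ℚ))) = c := by
    rw [← Int.cast_prod, hc, Int.cast_natCast]
  rw [h2, ← hb] at h1
  have hdisc : Algebra.discr ℚ b ≠ 0 := by
    intro h
    rw [h, zero_mul, eq_comm, mul_eq_zero] at h1
    rcases h1 with h1 | h1
    · exact hc0 (by exact_mod_cast pow_eq_zero_iff (two_ne_zero) |>.mp h1)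
    · rw [h1, abs_zero] at hD
      exact hD0 (by exact_mod_cast hD.symm)
  have hli : LinearIndependent ℚ b := by
    by_contra h
    exact hdisc (Algebra.discr_zero_of_not_linearIndependent ℚ h)
  have hrow : ∀ i : Fin n, rows.getD i [] ∈ rows := fun i => by
    rw [List.getD_eq_getElem _ _ (by rw [hlen]; exact i.2)]
    exact List.getElem_mem _
  have hrange : Set.range b = rowSet x d rows := by
    ext y
    constructor
    · rintro ⟨i, rfl⟩
      exact ⟨_, hrow i, rfl⟩
    · rintro ⟨row, h, rfl⟩
      obtain ⟨i, hi, rfl⟩ := List.mem_iff_getElem.mp h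
      exact ⟨⟨i, hlen ▸ hi⟩, by simp only [hb]; rw [List.getD_eq_getElem _ _ hi]⟩
  obtain ⟨m, hm, hp⟩ := exists_discr_eq_sq_mul b hli hn (fun i => hintegral _ (hrow i))
  refine ⟨m.natAbs, ?_, fun p hpp h hpm => hp p hpp (by rwa [hrange]) (Int.natCast_dvd.mpr hpm)⟩
  have h3 := congrArg abs h1
  rw [abs_mul, abs_mul, hD, hm, abs_mul, abs_pow, abs_pow, abs_pow, abs_pow, ← Int.cast_abs,
    ← Int.cast_abs, ← Int.cast_abs, Int.abs_eq_natAbs, Int.abs_eq_natAbs, Int.abs_eq_natAbs,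
    Nat.abs_cast] at h3
  have h4 : ((m.natAbs ^ 2 * (NumberField.discr K).natAbs * (d.natAbs ^ n) ^ 2 : ℕ) : ℚ) =
      (D * c ^ 2 : ℕ) := by
    push_cast at h3 ⊢
    simp only [Nat.cast_natAbs, Int.cast_abs]
    linear_combination h3
  exact_mod_cast h4.symm

/-- If `a` is a double root of `F` modulo the square of `q`, then the quotient of `F` by `X - a`
takes at a root `x` of `F` a value divisible by `q`. -/
theorem isIntegral_quotient_div {K : Type*} [Field K] [CharZero K] {x : K} {F P Q : List ℤ}
    (hx : IsIntegral ℤ x) (hF : evalList F x = 0) {a q c e : ℤ} (hq : q ≠ 0)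
    (hP : divModList 1 [-a, 1] F = (P, [q ^ 2 * c])) (hQ : divModList 1 [-a, 1] P = (Q, [q * e])) :
    IsIntegral ℤ (evalList P x / q) := by
  have h1 := (evalList_divModList (n := 1) (F := [-a, 1]) rfl rfl F x).2
  have h2 := (evalList_divModList (n := 1) (F := [-a, 1]) rfl rfl P x).2
  rw [hP, hF] at h1
  rw [hQ] at h2
  simp only [evalList_cons, evalList_nil] at h1 h2
  push_cast at h1 h2
  have hq' : (q : K) ≠ 0 := by exact_mod_cast hq
  have hQx : IsIntegral ℤ (evalList Q x) := by
    have : ∀ l : List ℤ, IsIntegral ℤ (evalList l x) := by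
      intro l
      induction l with
      | nil => simpa using isIntegral_zero
      | cons b l ih => exact (isIntegral_algebraMap (x := b)).add (hx.mul ih)
    exact this Q
  let S := integralClosure ℤ K
  refine isIntegral_trans (R := ℤ) (A := S) _
    ⟨X ^ 2 - C (e : S) * X + C ((⟨evalList Q x, hQx⟩ : S) * (c : S)), by monicity!, ?_⟩
  simp only [eval₂_add, eval₂_sub, eval₂_mul, eval₂_pow, eval₂_X, eval₂_C]
  rw [map_mul, map_intCast, map_intCast]
  have : algebraMap S K ⟨evalList Q x, hQx⟩ = evalList Q x := rfl
  rw [this]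
  field_simp
  linear_combination (evalList P x) * h2 - (evalList Q x) * h1

/-- The part of the index prime to `66`. -/
def indexFactor : ℤ := 109048512132640634942725658296125033539158355771527

/-- A double root modulo `indexFactor ^ 2`. -/
def doubleRoot : ℤ := 21613969213968955255643292165589734522333819575754

/-- Rows of a basis of an order maximal at the primes dividing `indexFactor`. -/
def rowsIndex : List (List ℤ) :=
  (List.range 23).map (fun i => List.replicate i 0 ++ [indexFactor]) ++
    [(divModList 1 [-doubleRoot, 1] coeffList).1]

theorem natAbs_discr_eq_of_index {T q δ m₀ m₁ m₂ : ℕ} (hT : T = 2 ^ 12 * 3 ^ 24 * 11 ^ 22)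
    (hq : Nat.Coprime q 3)
    (h0 : T * 3 ^ 42 * q ^ 2 = m₀ ^ 2 * δ) (h1 : T * q ^ 2 = m₁ ^ 2 * δ)
    (h2 : T * 3 ^ 42 = m₂ ^ 2 * δ) (h0₂ : ¬ 2 ∣ m₀) (h0₁₁ : ¬ 11 ∣ m₀) (h1₃ : ¬ 3 ∣ m₁) :
    δ = T := by
  have hT0 : T ≠ 0 := by rw [hT]; positivity
  have hδ : δ ∣ T := by
    have h3 : δ ∣ Nat.gcd (T * q ^ 2) (T * 3 ^ 42) :=
      Nat.dvd_gcd ⟨_, h1.trans (mul_comm _ _)⟩ ⟨_, h2.trans (mul_comm _ _)⟩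
    rwa [Nat.gcd_mul_left, Nat.Coprime.gcd_eq_one (hq.pow 2 42), mul_one] at h3
  obtain ⟨t, ht⟩ := hδ
  have hδ0 : 0 < δ := Nat.pos_of_ne_zero fun h => hT0 (by rw [ht, h, zero_mul])
  have h1' : t * q ^ 2 = m₁ ^ 2 := Nat.eq_of_mul_eq_mul_left hδ0 (by linarith [ht ▸ h1])
  have h0' : t * 3 ^ 42 * q ^ 2 = m₀ ^ 2 := by
    apply Nat.eq_of_mul_eq_mul_left hδ0
    rw [mul_comm δ (m₀ ^ 2), ← h0, ht]; ring
  have ht1 : t = 1 := by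
    by_contra h
    obtain ⟨p, hp, hpt⟩ := Nat.exists_prime_and_dvd h
    have hpT : p ∣ 2 ^ 12 * 3 ^ 24 * 11 ^ 22 := hT ▸ ht ▸ hpt.mul_left δ
    have hm₀ : p ∣ m₀ := hp.dvd_of_dvd_pow (h0' ▸ (hpt.mul_right _).mul_right _)
    have hm₁ : p ∣ m₁ := hp.dvd_of_dvd_pow (h1' ▸ hpt.mul_right _)
    rcases hp.dvd_mul.mp hpT with h | h
    · rcases hp.dvd_mul.mp h with h | h
      · exact h0₂ ((Nat.prime_dvd_prime_iff_eq hp Nat.prime_two).mp (hp.dvd_of_dvd_pow h) ▸ hm₀)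
      · exact h1₃ ((Nat.prime_dvd_prime_iff_eq hp Nat.prime_three).mp (hp.dvd_of_dvd_pow h) ▸ hm₁)
    · exact h0₁₁ ((Nat.prime_dvd_prime_iff_eq hp (by norm_num)).mp (hp.dvd_of_dvd_pow h) ▸ hm₀)
  rw [ht, ht1, mul_one]

theorem abs_discr_eq {K : Type*} [Field K] [NumberField K] (pb : PowerBasis ℚ K)
    (hmin : minpoly ℚ pb.gen = evalList coeffList X) (hdim : pb.dim = 24) :
    |NumberField.discr K| = 2 ^ 12 * 3 ^ 24 * 11 ^ 22 := by
  set x := pb.gen with hx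
  have hF : evalList coeffList x = 0 := by
    rw [← aeval_evalList_X (A := ℚ), ← hmin, minpoly.aeval]
  have hfin : Module.finrank ℚ K = 24 := by rw [pb.finrank, hdim]
  have hxint : IsIntegral ℤ x := by
    refine ⟨evalList coeffList X, ?_, ?_⟩
    · have h24 : (evalList coeffList (X : ℤ[X])).natDegree ≤ 24 :=
        natDegree_evalList_X_le _ _ (by decide)
      refine monic_of_natDegree_le_of_coeff_eq_one 24 h24 ?_
      rw [coeff_evalList_X]
      decide
    · rw [← aeval_def, aeval_evalList_X, hF]
  obtain ⟨D, hD⟩ : ∃ D : ℕ, D = (2 ^ 12 * 3 ^ 24 * 11 ^ 22) * 3 ^ 42 * indexFactor.natAbs ^ 2 :=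
    ⟨_, rfl⟩
  have hdisc : |Algebra.discr ℚ (fun i : Fin 24 => x ^ (i : ℕ))| = D := by
    have h1 : (resultantList 23 coeffList (derivList coeffList)).2 ≠ 0 ∧
      (resultantList 23 coeffList (derivList coeffList)).1.natAbs =
        (resultantList 23 coeffList (derivList coeffList)).2.natAbs *
          ((2 ^ 12 * 3 ^ 24 * 11 ^ 22) * 3 ^ 42 * indexFactor.natAbs ^ 2) := by decide +kernel
    rw [hD]
    exact abs_discr_powers pb 23 coeffList rfl hmin hdim _ h1.1 h1.2
  have hD0 : D ≠ 0 := by rw [hD]; decide +kernel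
  have hintegral : ∀ {d : ℤ} {blocks : List (List ℤ × ℕ)}, d ≠ 0 →
      checkRing 24 coeffList d blocks = true → ∀ row ∈ shiftRows blocks,
      IsIntegral ℤ (evalList row x / (d : K)) := fun hd h row hrow =>
    isIntegral_of_mem_span hF hd h _ (Submodule.subset_span ⟨row, hrow, rfl⟩)
  obtain ⟨m₀, h0, hm₀⟩ := exists_sq_mul_discr_eq x hfin D hD0 hdisc (shiftRows [([1], 24)])
    (by decide +kernel) 1 one_ne_zero 1 (by decide +kernel) (by decide +kernel) one_ne_zero
    (hintegral one_ne_zero checkRing_powers)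
  obtain ⟨m₁, h1, hm₁⟩ := exists_sq_mul_discr_eq x hfin D hD0 hdisc (shiftRows blocks₃)
    (by decide +kernel) 81 (by norm_num) (3 ^ 75) (by decide +kernel) (by decide +kernel)
    (by positivity) (hintegral (by norm_num) checkRing_blocks₃)
  obtain ⟨m₂, h2, -⟩ := exists_sq_mul_discr_eq x hfin D hD0 hdisc rowsIndex
    (by decide +kernel) indexFactor (by decide +kernel) (indexFactor.natAbs ^ 23)
    (by decide +kernel) (by decide +kernel) (by decide +kernel) (by
      intro row hrow
      have hq : indexFactor ≠ 0 := by decide +kernel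
      have hq' : (indexFactor : K) ≠ 0 := by exact_mod_cast hq
      rcases List.mem_append.mp hrow with h | h
      · obtain ⟨i, -, rfl⟩ := List.mem_map.mp h
        rw [evalList_replicate_append]
        simp only [evalList_cons, evalList_nil, mul_zero, add_zero]
        rw [mul_div_cancel_right₀ _ hq']
        exact hxint.pow i
      · rw [List.mem_singleton.mp h]
        refine isIntegral_quotient_div (a := doubleRoot)
          (c := (divModList 1 [-doubleRoot, 1] coeffList).2.headD 0 / indexFactor ^ 2)
          (e := (divModList 1 [-doubleRoot, 1]
            (divModList 1 [-doubleRoot, 1] coeffList).1).2.headD 0 / indexFactor)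
          (Q := (divModList 1 [-doubleRoot, 1] (divModList 1 [-doubleRoot, 1] coeffList).1).1)
          hxint hF hq ?_ ?_ <;> decide +kernel)
  have key := natAbs_discr_eq_of_index (q := indexFactor.natAbs) (δ := (NumberField.discr K).natAbs)
    (m₀ := m₀) (m₁ := m₁) (m₂ := m₂) rfl (by decide +kernel) ?_ ?_ ?_
    (hm₀ 2 Nat.prime_two fun y hy => mem_span_of_checkMaximal hF one_ne_zero checkRing_powers
      Nat.prime_two (by norm_num) checkMaximal_two y hy)
    (hm₀ 11 (by norm_num) fun y hy => mem_span_of_checkMaximal hF one_ne_zero checkRing_powers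
      (by norm_num) (by norm_num) checkMaximal_eleven y hy)
    (hm₁ 3 Nat.prime_three fun y hy => mem_span_of_checkMaximal hF (by norm_num) checkRing_blocks₃
      Nat.prime_three (by norm_num) checkMaximal_three y hy)
  · rw [Int.abs_eq_natAbs, key]
    norm_num
  · rw [← hD]
    simpa using h0
  · have h3 : 0 < 3 ^ 192 := by positivity
    apply Nat.eq_of_mul_eq_mul_left h3
    rw [hD] at h1
    simp only [show (81 : ℤ).natAbs = 3 ^ 4 from rfl] at h1
    linear_combination h1
  · have h3 : 0 < (indexFactor.natAbs ^ 24) ^ 2 :=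
      pow_pos (pow_pos (by decide +kernel) 24) 2
    apply Nat.eq_of_mul_eq_mul_left h3
    rw [hD] at h2
    linear_combination h2

theorem natDegree_evalList_X_of_monic {A : Type*} [CommRing A] [Nontrivial A] {n : ℕ} {l : List ℤ}
    (hl : l.length = n + 1) (hlead : l.getD n 0 = 1) :
    (evalList l (X : A[X])).Monic ∧ (evalList l (X : A[X])).natDegree = n := by
  have h1 := natDegree_evalList_X_le (A := A) l n hl.le
  have h2 : (evalList l (X : A[X])).coeff n = 1 := by
    rw [coeff_evalList_X, hlead, Int.cast_one]
  exact ⟨monic_of_natDegree_le_of_coeff_eq_one n h1 h2, natDegree_eq_of_le_of_coeff_ne_zero h1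
    (by rw [h2]; exact one_ne_zero)⟩

instance : Fact (Nat.Prime 11) := ⟨by norm_num⟩

theorem irreducible_X_sq_sub_two : Irreducible (X ^ 2 - 2 : (ZMod 11)[X]) := by
  have h : (X ^ 2 - 2 : (ZMod 11)[X]) = X ^ 2 - C 2 := by rw [map_ofNat]
  have hdeg : (X ^ 2 - C 2 : (ZMod 11)[X]).natDegree = 2 := natDegree_X_pow_sub_C
  rw [h, irreducible_iff_roots_eq_zero_of_degree_le_three (by rw [hdeg]) (by rw [hdeg]; norm_num),
    Multiset.eq_zero_iff_forall_notMem]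
  intro a ha
  have := isRoot_of_mem_roots ha
  simp only [IsRoot.def, eval_sub, eval_pow, eval_X, eval_C] at this
  clear ha
  revert a
  decide

theorem irreducible_evalList_coeffList : Irreducible (evalList coeffList (X : ℤ[X])) := by
  obtain ⟨hmonic, hdeg⟩ := natDegree_evalList_X_of_monic (A := ℤ) (n := 24) (l := coeffList) rfl rfl
  have hq : (evalList [-2, 0, 1] X : ℤ[X]) = X ^ 2 - 2 := by
    simp only [evalList_cons, evalList_nil]
    push_cast
    ring
  obtain ⟨hqmonic, hqdeg⟩ := natDegree_evalList_X_of_monic (A := ℤ) (n := 2) (l := [-2, 0, 1])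
    rfl rfl
  have hmod : evalList coeffList X %ₘ evalList [-2, 0, 1] X =
      evalList (divModList 2 [-2, 0, 1] coeffList).2 (X : ℤ[X]) := by
    have h1 := evalList_divModList (n := 2) (F := [-2, 0, 1]) rfl rfl coeffList (X : ℤ[X])
    refine (div_modByMonic_unique (evalList (divModList 2 [-2, 0, 1] coeffList).1 X) _ hqmonic
      ⟨by rw [h1.2]; ring, ?_⟩).2
    rw [degree_eq_natDegree hqmonic.ne_zero, hqdeg]
    refine lt_of_le_of_lt degree_le_natDegree ?_
    have := natDegree_evalList_X_le (A := ℤ) (divModList 2 [-2, 0, 1] coeffList).2 1 h1.1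
    exact_mod_cast Nat.lt_succ_of_le this
  have hker : RingHom.ker (algebraMap ℤ (ZMod 11)) = Ideal.span {11} := by
    have := ZMod.ker_intCastRingHom 11
    exact_mod_cast this
  refine generalizedEisenstein (K := ZMod 11) (q := evalList [-2, 0, 1] X) (p := 12)
    ?_ hqmonic hmonic.isPrimitive (by omega) ?_ ?_ ?_
  · rw [hq]
    simpa using irreducible_X_sq_sub_two
  · rw [hmonic.leadingCoeff]
    simp
  · rw [hmonic.leadingCoeff, map_one, map_one, one_mul, ← Polynomial.map_pow]
    have h1 : evalList coeffList (X : ℤ[X]) = evalList ((mulList [-2, 0, 1])^[12] [1]) X +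
        11 * evalList ((addMulList (-1) ((mulList [-2, 0, 1])^[12] [1]) coeffList).map (· / 11)) X := by
      rw [evalList_eq_of_sameList (l := coeffList) (m := addMulList 11 ((addMulList (-1)
        ((mulList [-2, 0, 1])^[12] [1]) coeffList).map (· / 11)) ((mulList [-2, 0, 1])^[12] [1]))
        (by decide +kernel), evalList_addMulList]
      push_cast
      rfl
    have h2 : ∀ n : ℕ, evalList ((mulList [-2, 0, 1])^[n] [1]) (X : ℤ[X]) =
        evalList [-2, 0, 1] X ^ n := by
      intro n
      induction n with
      | zero => simp
      | succ n ih => rw [Function.iterate_succ_apply', evalList_mulList, ih, pow_succ']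
    rw [h1, h2, Polynomial.map_add, Polynomial.map_mul]
    have h3 : (11 : ℤ[X]).map (algebraMap ℤ (ZMod 11)) = 0 := by
      rw [Polynomial.map_ofNat, ← C_ofNat]
      have : (OfNat.ofNat 11 : ZMod 11) = 0 := by decide
      rw [this, map_zero]
    rw [h3, zero_mul, add_zero]
  · rw [hmod, hker, Ideal.span_singleton_pow]
    intro h
    have h1 := congrArg (fun P => P.coeff 0) h
    simp only [coeff_map, coeff_evalList_X, coeff_zero] at h1
    rw [Ideal.Quotient.eq_zero_iff_mem, Ideal.mem_span_singleton] at h1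
    revert h1
    decide +kernel

theorem map_evalList_coeffList : (evalList coeffList (X : ℤ[X])).map (algebraMap ℤ ℚ) =
    evalList coeffList X := map_evalList_X _ _

theorem irreducible_evalList_coeffList_rat : Irreducible (evalList coeffList (X : ℚ[X])) := by
  rw [← map_evalList_coeffList]
  exact ((natDegree_evalList_X_of_monic (A := ℤ) (n := 24) (l := coeffList) rfl
    rfl).1.irreducible_iff_irreducible_map_fraction_map).mp irreducible_evalList_coeffList

theorem abs_discr_eq_of_adjoin_eq_top {K : Type*} [Field K] [NumberField K] (x : K)
    (hx : aeval x (evalList coeffList (X : ℚ[X])) = 0) (htop : IntermediateField.adjoin ℚ {x} = ⊤) :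
    |NumberField.discr K| = 2 ^ 12 * 3 ^ 24 * 11 ^ 22 := by
  obtain ⟨hmonic, hdeg⟩ := natDegree_evalList_X_of_monic (A := ℚ) (n := 24) (l := coeffList) rfl rfl
  have hmin := minpoly.eq_of_irreducible_of_monic irreducible_evalList_coeffList_rat hx hmonic
  have hintegral : IsIntegral ℚ x := Algebra.IsIntegral.isIntegral x
  have htop' : Algebra.adjoin ℚ {x} = ⊤ := by
    rw [← IntermediateField.adjoin_simple_toSubalgebra_of_isAlgebraic hintegral.isAlgebraic, htop,
      IntermediateField.top_toSubalgebra]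
  have hgen := PowerBasis.ofAdjoinEqTop'_gen hintegral htop'
  refine abs_discr_eq (PowerBasis.ofAdjoinEqTop' hintegral htop') ?_ ?_
  · rw [hgen, ← hmin]
  · rw [PowerBasis.ofAdjoinEqTop'_dim, ← hmin, hdeg]

/-- Value at `x` of the polynomial whose coefficients are the images of the entries of `l`. -/
def evalMap {α R : Type*} [CommRing R] (f : α → R) (x : R) (l : List α) : R :=
  l.foldr (fun a r => f a + x * r) 0

/-- Combination of the entries of two lists, the missing entries of the first being `o`. -/
def zipAcc {α : Type*} (o : α) (g : α → α → α) : List α → List α → List α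
  | [], acc => acc.map (g o)
  | a :: r, [] => a :: r
  | a :: r, b :: acc => g a b :: zipAcc o g r acc

/-- The residues modulo `M` of `r + y * acc`. -/
def addMulMod (M y : ℕ) : List ℕ → List ℕ → List ℕ := zipAcc 0 fun a b => (a + y * b) % M

/-- Partial evaluation at `y` modulo `M`, in the outer variable of two. -/
def contractMod₂ (M y : ℕ) (t : List (List ℕ)) : List ℕ := t.foldr (addMulMod M y) []

/-- Partial evaluation at `y` modulo `M`, in the outer variable of three. -/
def contractMod₃ (M y : ℕ) (t : List (List (List ℕ))) : List (List ℕ) :=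
  t.foldr (zipAcc [] (addMulMod M y)) []

/-- Evaluation at `x` modulo `M` of a polynomial with natural coefficients. -/
def contractMod₁ (M x : ℕ) (l : List ℕ) : ℕ := l.foldr (fun a r => (a + x * r) % M) 0

/-- The residue of an integer. -/
def residue (M : ℕ) (c : ℤ) : ℕ := (c % M).toNat

/-- The symmetric matrix with given lower triangular part. -/
def symmList {α : Type*} (n : ℕ) (t : List (List (List α))) : List (List (List α)) :=
  (List.range n).map fun u => (List.range n).map fun w => (t.getD (max u w) []).getD (min u w) []

/-- The residues of `p + s * q`. -/
def residueTriangle (M s : ℕ) (t : List (List (List (ℤ × ℤ)))) : List (List (List ℕ)) :=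
  t.map fun r => r.map fun l => l.map fun c => (residue M c.1 + s * residue M c.2) % M

/-- Coefficients of a polynomial `A` with `4 f = A ^ 2 + 11 B ^ 2`. -/
def listA : List ℤ :=
  [18, 297, -747, 924, -1038, 726, -320, 132, -12, -22, 20, -11, 2]

/-- Coefficients of a polynomial `B` with `4 f = A ^ 2 + 11 B ^ 2`. -/
def listB : List ℤ :=
  [0, 9, -45, 114, 6, -138, 118, -84, 48, -14, 4, -1]

/-- Coefficients, by increasing degrees, of half of a symmetric polynomial. -/
def triangle : List (List (List (ℤ × ℤ))) :=
  [[[(169294941, 10937187), (-559234368, -169090092), (421675227, 463041603), (-548825706,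
  -415240830), (795248118, 124723314), (-374399982, -7833510), (223740630, 5681826), (-165554928,
  20199780), (55101708, -4709016), (-22649814, -4559706), (5789610, 866484)]], [[(-363038841,
  -2232441), (1170512046, 99615906), (-1345609584, -393477750), (1575901008, 241525152),
  (-1119210048, 51369876), (386954172, -34607088), (-455377626, 23023278), (333719892, -50838084),
  (-111345894, 14322474), (37367352, -798768), (-6306201, 842589)], [(789517692, 24115806),
  (-2056789746, -174629682), (2561562387, 438134589), (-2401323408, -35137152), (771423588,
  -163627776), (-278090010, -59099382), (1004492340, -6937812), (-744565932, 58337172),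
  (237758220, -24043608), (-28789992, 13563936), (-4069575, -3725379)]], [[(388708632, 31988034),
  (-1412306280, -311842872), (1841043249, 714984327), (-2399944140, -556728876), (1983036978,
  117750510), (-841239432, -14592312), (659350368, -6785532), (-442668402, 49795398), (141182892,
  -21913632), (-33187968, 4382424), (4234707, -1223289)], [(-861005376, -98371260), (2281216608,
  829039536), (-3593975022, -1242591354), (2948718168, 521232408), (-648943812, -196642080),
  (417960972, 408237300), (-1207070964, -240120180), (839369520, 67184208), (-316735650, 2106486),
  (55869264, -20608776), (1566378, 5775678)], [(1137759858, 178937586), (-1694256102,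
  -1702693386), (3330917316, 2282022720), (-771094566, -494066790), (-2411868636, 499534452),
  (356934600, -1184303700), (1052063964, 705828492), (-693582912, -290958696), (447075072,
  50077656), (-123294798, 28951722), (3551310, -8225982)]], [[(-234863145, -46306323), (461260008,
  486075492), (-93270771, -903057255), (726535656, 776512008), (-1310633082, -350876826),
  (656534538, 101419938), (-408050676, -62852652), (334645344, 7730424), (-104674680, 6478164),
  (15883956, 858852), (-2891196, -260730)], [(715305654, 88116498), (-784643112, -967388832),
  (1209561498, 1535256018), (-898763580, -691409628), (-255500676, 277689492), (62924796,
  -425074068), (464393304, 315368856), (-397207404, -143207748), (181773468, 23896548),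
  (-34241724, 8514180), (1037880, -2689308)], [(-1099130472, -222609222), (-802878318,
  1660618746), (689684193, -2212914465), (-1722255480, 226734984), (4156602912, -428601564),
  (-2080416690, 1323283554), (341516736, -857052900), (48318336, 388997856), (-288039906,
  -113256882), (125880084, 1029204), (-12277683, 3161241)], [(1209382488, 295215192), (3276957816,
  -1198248336), (-5448999384, 1339931592), (4591748304, 474446592), (-6255875952, 224643600),
  (4187203812, -1366998300), (-1673076528, 892344096), (464777280, -438219864), (171533808,
  172340784), (-114727008, -27634848), (12145128, 1053192)]], [[(162226557, 39173301), (181765782,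
  -255175110), (-828134280, 422009838), (249509106, -355849470), (222117660, 166599720),
  (18972360, -46963692), (7659198, 61099542), (-105991182, -36292986), (29450034, 10168146),
  (-2559942, -4295574), (1905957, 645543)], [(-632934324, -124474806), (-343997874, 515008638),
  (876560751, -702347247), (-91542528, 130487328), (893333826, 56911950), (-1029813642,
  212038938), (284231376, -251202924), (-2796156, 146996676), (-28119960, -45918468), (14737536,
  1479744), (-2259675, 1605465)], [(1008987192, 249929388), (1758065364, -807406920),
  (-2600093682, 923818770), (1250141904, 228208752), (-3395196432, -49561740), (2971659438,
  -762031170), (-1063178748, 601548084), (291002184, -302450724), (79982478, 113680422),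
  (-80763408, -10459008), (10701090, -2367162)], [(-958780152, -349041636), (-2810944620,
  281170116), (4721076954, 161777358), (-2170162764, -889710084), (3931224858, 265709574),
  (-3802662864, 630610416), (1667102580, -505907604), (-517665324, 278228316), (-21177420,
  -124509504), (62257140, 19328436), (-6893304, 405924)], [(392349636, 399994470), (1518370722,
  216388674), (-1888279875, -1003254237), (-811407564, 881332920), (-912102732, -408849696),
  (2053818558, -62196534), (-1044587268, 154184256), (352488774, -122694618), (-30529326,
  55875954), (-20234544, -4764540), (1657521, -1224531)]], [[(-96616476, -47926728), (-191016144,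
  170657280), (532721772, -274852116), (-34998480, 294705864), (-280515906, -161623026),
  (121836528, 30753216), (-71642340, -25212384), (73759356, 18873324), (-16109280, -4447008),
  (4752, 1317600), (-742500, -202716)], [(343602000, 127261368), (339649200, -309957192),
  (-300519072, 461586600), (-950921532, -272238948), (419076720, -18477288), (228907404, 8019756),
  (-59956092, 54678348), (25460424, -47010744), (-14721768, 11072232), (-1169388, 6312780),
  (-55116, -2334708)], [(-536071041, -211781061), (-1197988110, 423709110), (1267425522,
  -579381876), (760179816, 139330800), (535789188, 8557920), (-1115983440, 275141556), (358963704,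
  -215983368), (-133814736, 109478016), (-37879182, -38552202), (44537724, -7028244), (-3936339,
  3960747)], [(315419292, 279135126), (1559706786, -88015518), (-1868401917, -58645539),
  (-603104832, 89384256), (-422420364, 44339040), (1006079778, -281778786), (-314849484,
  176819796), (89631432, -85564872), (58886928, 32277780), (-42569208, 5361120), (2493261,
  -2965455)], [(96404121, -244157517), (-414924444, -158297112), (-297660231, 365722101),
  (1941292584, 90980352), (-1166926266, -144411714), (299213046, 88928622), (-222176394,
  -48612366), (88777392, 17798592), (-72861162, 6245106), (34719960, -12732024), (-2765928,
  3082422)], [(-195271668, 93996396), (-15335100, 87258780), (672446088, 55883664), (-1254316932,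
  -504078372), (1197942300, 447083604), (-954835992, -224667792), (605416320, 76804704),
  (-244761264, -1695888), (128345472, -20034936), (-48024900, 15185196), (4642200, -3114504)]],
  [[(14516172, 26864784), (211092156, -91272096), (-431324190, 154332702), (176886666,
  -204245226), (142876008, 146378772), (-171683226, -42819138), (99163548, 15263316), (-56756700,
  -8739036), (16046910, -312066), (8910, 835002), (-185922, -45630)], [(-102293037, -61000209),
  (-256994694, 171540990), (186979914, -339935616), (586699740, 311541876), (-661304358,
  -105532686), (404780112, 7855380), (-226108674, 8601030), (50173992, -5430888), (-11212146,
  11609658), (519156, -10171116), (1742895, 2051073)], [(115844580, 107438400), (725712372,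
  -173594340), (-630995724, 356245884), (-837694440, -283176108), (566636418, 111676266),
  (-166213476, -113524164), (173507688, 32973012), (-19452510, 469386), (36992268, -7162596),
  (-21855240, 12798540), (35568, -3220128)], [(7115229, -125943201), (-680836860, -27555552),
  (653982417, -29788587), (776747664, 212888088), (-606118590, -204682374), (303937722,
  174517074), (-311423706, -42112566), (99430848, -7201512), (-67772826, 9830034), (28771776,
  -12819168), (-360756, 3145410)], [(-133194159, 76135329), (63423756, 112944348), (351801684,
  -37409094), (-1019451114, -310170906), (938004174, 289003590), (-676919232, -152857152),
  (456272406, 36669582), (-173372760, 16187184), (89792946, -19552986), (-36284886, 13037922),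
  (3145671, -2798523)], [(99872784, -4026294), (-26048682, -89401482), (-103478067, -83677293),
  (229984128, 361020384), (-439772256, -359299764), (560798370, 221700942), (-410939100,
  -72213192), (183652788, -4541484), (-102681018, 14785182), (39587460, -9435660), (-4212747,
  1998513)], [(-26387964, -18091620), (21927708, 86380200), (-151993638, 15860682), (213649920,
  -175414392), (-20900952, 223087176), (-173101830, -171326670), (194314530, 63036750),
  (-111284712, -528468), (68800206, -6315570), (-27437916, 4026996), (3252900, -957804)]],
  [[(7844364, -6716520), (-80500068, 7791228), (159006078, -9718218), (-98050392, 43332192),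
  (-25629912, -39246768), (57420792, 8149896), (-26934534, -1944198), (12154428, 1617300),
  (-4112064, 1121076), (181764, -712476), (15246, 67950)], [(-1195236, 22422582), (132318846,
  -18669042), (-117025749, 48366693), (-206395992, -76607856), (281834316, 22025736), (-186182370,
  10952946), (89853228, -13974084), (-9150768, 10957680), (1976328, -8942292), (-2263536,
  5309712), (-138411, -1020951)], [(18563985, -47030949), (-299355804, -27929448), (230550705,
  4991733), (530175888, 55717416), (-442879470, 19285362), (132185790, -23453226), (-78204654,
  27619902), (-14278968, -26485992), (3705174, 13155714), (8338176, -7750368), (-766260,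
  1832706)], [(-68528376, 47977704), (111611412, 112182732), (102406248, -127719072), (-773004276,
  -51953508), (640011780, 18419580), (-275608080, 21810024), (162537732, -40365612), (-27937008,
  39125376), (11139696, -18654768), (-13177692, 8728164), (1583028, -1959156)], [(108263034,
  -14677254), (121026312, -105493104), (-493285518, 65990538), (715757328, 143590032),
  (-661499388, -114988284), (441979560, 21252816), (-234550008, 22228812), (78327084, -33357396),
  (-38895186, 19302042), (19636980, -7537668), (-2797674, 1430754)], [(-58162860, -12148704),
  (-89002188, 76802508), (204042078, -4729230), (-175763808, -142133472), (258641352, 145286496),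
  (-261712704, -78618792), (164507892, 16510524), (-78146640, 14250840), (46482252, -10709964),
  (-20256984, 3803736), (2986338, -690894)], [(4929903, 11682387), (80149014, -53245350),
  (-51572466, 19205496), (-18736740, 59790348), (-38565648, -78978276), (62388348, 54942864),
  (-64424976, -18844728), (48883296, -4980960), (-29739666, 4255410), (12696684, -1019436),
  (-2053887, 193671)], [(1689984, -5924232), (-67732632, 24276024), (68635476, -11003796),
  (-18376776, -25352496), (35030988, 29743740), (-28933080, -15587592), (26303424, 5570304),
  (-25662780, 2710788), (13950012, -1955244), (-5567496, 49920), (1065888, 33648)]], [[(-12536532,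
  1884708), (38289834, 4621698), (-74021202, -11084526), (90110988, -7543260), (-42443784,
  14720184), (965250, -6307146), (-249624, 3260484), (-313038, -2107350), (1811142, 358002),
  (-891000, -18576), (186156, 15300)], [(22238469, -8836209), (-80728164, -6343272), (116815743,
  -3511701), (-46657512, 39334248), (-32623074, -27651618), (53388522, 6058602), (-27038088,
  1019664), (2310264, -2978064), (-4037616, 2544444), (4021776, -1415808), (-728640, 302598)],
  [(-33361551, 19015317), (170036064, 39636432), (-216348570, -31972968), (-57213486, -25747686),
  (82196442, 3126834), (-15959988, 8546292), (19318806, -12241818), (11006424, 12277080),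
  (-2522754, -5255910), (-5615082, 2806038), (1062333, -750213)], [(64188828, -13513284),
  (-92462040, -75811464), (46696122, 84916782), (161537112, 9326232), (-124485372, -4356324),
  (37015308, -9416556), (-34284492, 15121224), (-998712, -15900120), (-2351646, 6873102),
  (7681212, -3003084), (-1485792, 765792)], [(-61589700, -3832380), (-20430036, 58201416),
  (112563540, -42553836), (-120087396, -37595412), (107165772, 40035708), (-79859934, -16573374),
  (46448892, -2294244), (-14657940, 10629000), (13288356, -5487948), (-9355104, 1807632),
  (1702980, -379908)], [(16076610, 7696566), (24375384, -39874248), (-6756354, 26654310),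
  (-26685648, 14694048), (19042650, -27295074), (-12579996, 23515044), (-3730188, -8093028),
  (8179248, -3652368), (-10722492, 1942440), (7185156, -347124), (-1358082, 105654)], [(2182194,
  -3639060), (-30957498, 27581958), (3798243, -30854079), (15357276, 8810352), (-24980184,
  244116), (40207662, -4338558), (-13765368, 3914232), (-3660294, 1517130), (4749132, -617472),
  (-3678576, -217644), (861963, 14907)], [(62370, 2516454), (21455280, -12684600), (-24565068,
  14155092), (11724372, -4323492), (-4728636, 3367224), (-8152716, -3564156), (4227498, 728694),
  (2545488, -1164672), (-1787280, 435024), (1209912, 189864), (-352968, -51192)], [(-470340,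
  -1107972), (-9044838, 6754374), (18221076, -9562428), (-21457854, 6359778), (13100940,
  -7552980), (1241988, 6561384), (-3299376, -2753832), (1229712, 1357104), (-845616, -445344),
  (-17094, -32022), (96468, 17388)]], [[(6946236, -245268), (-25482600, -3392928), (50045688,
  7536240), (-69616800, -1943568), (50684832, -5261220), (-17849700, 5551524), (6418368,
  -3330576), (-2261952, 1976832), (-433818, -780066), (397188, 177804), (-62964, -23904)],
  [(-8156943, 2627397), (56384262, 1069362), (-121625766, 6591888), (119529432, -16725960),
  (-65620854, 20613258), (10843668, -16365096), (4944996, 6842988), (-1349568, -2027664),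
  (3366954, 706482), (-2287692, 91476), (321021, -73269)], [(11681010, -4318596), (-97062570,
  -15417378), (187413237, 8301447), (-132502392, 8187264), (95606280, -14423364), (-44063514,
  16652034), (1061280, -5762700), (-2899908, 534636), (-1654686, -574902), (2609244, -431820),
  (-306009, 212967)], [(-19849428, 836460), (76267224, 31132512), (-145487016, -40209696),
  (116984736, 22740048), (-130211352, -4588992), (91648260, -12616524), (-24803352, 7291512),
  (11535480, -1394640), (-885780, 1227276), (-2733456, 178320), (442140, -202164)], [(10561617,
  2673297), (-30687822, -24610554), (76280292, 33380046), (-78096348, -25653852), (100210176,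
  10310148), (-84980808, 6837300), (34244892, -5541876), (-13853004, 848076), (1905882, -1034466),
  (2095500, 198996), (-462231, 71523)], [(2742444, -834516), (12351240, 18768312), (-57028320,
  -31329864), (47849472, 29308104), (-72612576, -18217872), (78660912, 1551360), (-35036016,
  2680608), (12444564, -367452), (-3120336, 784704), (-1036200, -277776), (341892, -29604)],
  [(-1771902, -30402), (527472, -13976064), (13483404, 27132228), (-1066428, -25489332),
  (27738612, 20663424), (-49441920, -9284928), (25717758, 1254498), (-9438264, -480000), (3552120,
  -261288), (140184, 205272), (-213444, 4452)], [(-136404, -425844), (-5446188, 6249276),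
  (10515240, -11230992), (-16522308, 9648396), (4801644, -9723420), (10079784, 6726528),
  (-7617264, -2314608), (3269112, 959448), (-1642128, -223560), (126588, -49476), (75192, 7416)],
  [(459162, 86022), (5523012, -2643300), (-13510728, 4734252), (18416772, -3237516), (-12971376,
  4543488), (2157540, -4304388), (1055604, 1936056), (-889284, -901236), (754974, 332226),
  (-102696, -28776), (-34848, -204)], [(-488295, 49815), (-3861000, 882684), (9703305, -1698975),
  (-12003156, 677556), (9588726, -1721574), (-3384678, 2191290), (341724, -1066740), (109296,
  506688), (-272046, -212898), (36696, 25272), (21390, 0)]], [[(-1095363, -53055), (4485294,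
  997434), (-8994726, -2183112), (13066812, 1758348), (-11236320, -40716), (5229576, -805788),
  (-2094732, 581724), (890208, -363168), (-107442, 173682), (-31284, -40212), (3735, 4113)],
  [(907038, -407268), (-12214422, -677214), (29077785, 316683), (-28645056, 296784), (20598732,
  -2320272), (-9028602, 3418290), (1608156, -1784340), (-517176, 636984), (-345312, -309996),
  (380160, 29016), (-50391, 12609)], [(-1128492, 454572), (17926920, 3194208), (-40234266,
  -3217914), (34592184, 1988280), (-30507372, 1010916), (17330544, -3837600), (-3355146, 1994130),
  (1312344, -660384), (40698, 406746), (-382140, 5220), (30996, -33732)], [(1556280, 70848),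
  (-13461228, -5770980), (30661092, 9899604), (-27451512, -9988200), (36019764, 5172012),
  (-29513880, 1381824), (10737540, -1752876), (-4408932, 724404), (1120944, -541920), (258192,
  62208), (-52008, 29472)], [(18414, -131328), (6213042, 4897890), (-16922565, -9496071),
  (12047112, 10367856), (-21980574, -7215642), (24499530, 1548126), (-11426976, 296712), (4815228,
  -103908), (-1587630, 284682), (-57156, -73956), (54549, -13419)], [(-807840, -272808),
  (-1715472, -3804192), (7785756, 8232660), (-1901988, -8485884), (10672992, 6788232), (-16904976,
  -2739552), (8496048, 341472), (-3436488, -103776), (1348116, -117948), (-25740, 47724), (-46860,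
  8652)], [(106866, 155898), (-806256, 2762784), (1304064, -6077304), (-6111468, 5970564),
  (-1144278, -5567058), (8607192, 3234408), (-5297274, -891738), (2363196, 296628), (-1105488,
  -20832), (102168, -21432), (29712, -3744)], [(106920, -3672), (1495692, -1094148), (-3762396,
  2171340), (5910696, -1818144), (-3273336, 2107368), (-768108, -1665444), (1122528, 662664),
  (-640728, -283176), (395868, 89796), (-52272, -5016), (-12144, 768)], [(-157680, 12960),
  (-1342440, 322272), (3333510, -603450), (-4133448, 245088), (3313548, -602532), (-1177044,
  758820), (130902, -370830), (30888, 177744), (-91878, -74454), (12408, 8856), (7320, 0)],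
  [(120285, -4995), (864270, -80190), (-2156220, 132030), (2397780, 93060), (-2125530, 151110),
  (1041480, -354420), (-247500, 194220), (63360, -95040), (14850, 44010), (-2640, -5280), (-4125,
  -375)], [(-25056, -1188), (-188892, 324), (457650, 12798), (-460944, -62208), (455328, 8424),
  (-279180, 51948), (88344, -34344), (-31680, 17856), (5832, -9072), (-528, 1104), (750, 150)]]]

/-- Approximations of the roots in the `1270747`-adic integers. -/
def approxRoots : List ℕ :=
  [1507968116401177797882816409301537315907681580193021234687675424021871688517568666132570966360520884995305377852265686181904774908286876777210951977846521913181720365479891515054312938508846090889,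
  805439130065511649484253695355517003057079832049148658719940194450259181616534554139530712763405391425214361205663080091604175513144193955555411516394675875618011625792397486981913478280625081639,
  648179173542356772221588774422439802487677859840963670173645542564223799203767585013909412672670375365747824220362978883476832656746829159224315965675565044836778588076367956553418120747320511656,
  1009983749229295397473978551746126625180422380240220570331357685257115688045505327178855642119637734284099151388909672080468188847036389696418201592283786466567050405963137308150816775012906235897,
  940728584868727904996654597617619758940455337142907114966045756883805714008709858772460595064000254457426340989104601710398288560782146717577667127716244338216570005697610257321186438578579431451,
  1401185357839575360220847052412600567582760174589390532251845179637230254180626604259754847997081198262937892850575532817952441086465476565988125477193952797399421478039369835815417841322731216063,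
  925557322435419107410020921773924441031631797847682284795980074213017677631736351548460438456336485804439501568581806244395564752113648111918001845179906993861493685122966947696538859417029427234,
  880133360663079398799766836520098582351018959923689084008456968581820929037377649762001804974690311983798608063829232855716701436933902544860749984842452927097497032305586153644505284802851238929,
  754598780368382161413217386500200689882133309319897164750827580973827188524826357182186828294387407897360031470520970786526760226261881715197655516925657075073128003627552663540592042354006344304,
  1675512437218441174422191914761345066616125049669838860470386631083784660927390845816047707193429169945442510618414048249133684267565758385866658512397083336567525566003369066268708954763498359028,
  1732484190240033410616647042493999264626028382696263722990966558134648940562616012784680081119295064250917866088009901183598747852888229791798694564599576226492060603701442913679507286620130578962,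
  642618344328637896272560414876739117255845814621735602630955833729241248876894373103856118912489310411332992606038292432934638961039056906001294023073662804416224939106028471141503673638524459089,
  640401595819790876701496201336260499384876556080030919370949868938866602094902261374494949536200873449992166428074330654026736062043848964638353564472348350896306713426930704790337661268910642936,
  1552501570665045168342652893542865980941354089893382705530865589857014574989880160777580421197880660801211825563334039475253268184107147525356157323771010655952678498554364945431813700049967262433,
  1582281640181226801172011042842177353099629462442708028902021821552105690276137084118116574324923497852538082931373946091812550368789307903059082979155489372941565263513529411060971142190465282391,
  801253976370603835830565922076114374139849377369966812160546733792647819708382782599076954922183330538851087233533475236448978038513137331276125661163303006960715667549923974721916471540579855966,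
  2085383959020860757720749815333513767549064231129376637864568113347901048698902848334239041590790434467364509150587509716619564057315341010374730847322112991607994281809556304992900406743201200434,
  1884359048330510869826230471051731655792225333248283069314911690182125391430656881474468250517516036730294043801183899307511720921143298124197366104412674848855233169186383722080384229886584952149,
  1892243173368928443784887389308813638383591884253654994423791425976612586994589549413068463064493821023770211353890400455183076370572218336793298319142937296581515858362444528445822931569891949512,
  1470023382414380857850225624266926526208102496840291998232537500385555718418612905792338310179307196408104926079970757174669753562161677927136013993663420325864563860969853637780039066593868034738,
  681611062291583960075081614423418443953745044398354261413411440793887181376868547595204303122929613214719052098376745777426398249728810037599774954107027732376679349198443138957138890640666281807,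
  1400942283377727851542786819025165659554579568844880204175932039152121132371006263679055353844041120902130516950531286295616229227741308617364174343335900049815431729892302939098325295272780984146,
  860361147399130857599134877502751681207631212135158549636256263433928886128807646189542005505614577546502984989950774625914607646033430182387724253839445641450187160097723454285441022652888311025,
  10779630269640143015199169536518317854934170323835062351499451158895152992098368197418632550154663758879530089335922765272429203345342326771780226059632948114109178087178786653955778271663837266]

/-- Approximation of a square root of `-11` in the `1270747`-adic integers. -/
def approxSqrt : ℕ :=
  199671540515059027343949868153460039386849659259041545412743442351685859238431923475782542978367717449539014220780322949575957251674080395630246354804889425660075647464343190945334196652389424179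

/-- The sign relations between the roots. -/
def signMasks : List (List ℕ) :=
  [[0, 814, 2962, 222, 1762, 2680, 1876, 3724, 1464, 3126, 3402, 2532], [814, 0, 2236, 1008, 1484,
  2390, 1146, 3490, 1686, 3864, 3684, 2762], [2962, 2236, 0, 2892, 3440, 490, 3270, 1310, 3626,
  1956, 1752, 630], [222, 1008, 2892, 0, 1596, 2726, 1930, 3666, 1382, 3304, 3476, 2362], [1762,
  1484, 3440, 1596, 0, 3226, 438, 2158, 858, 2772, 2984, 3846], [2680, 2390, 490, 2726, 3226, 0,
  3372, 1268, 4032, 1614, 1842, 924], [1876, 1146, 3270, 1930, 438, 3372, 0, 2520, 748, 2914,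
  2590, 3760], [3724, 3490, 1310, 3666, 2158, 1268, 2520, 0, 2868, 698, 966, 1896], [1464, 1686,
  3626, 1382, 858, 4032, 748, 2868, 0, 2446, 2290, 3164], [3126, 3864, 1956, 3304, 2772, 1614,
  2914, 698, 2446, 0, 380, 1490], [3402, 3684, 1752, 3476, 2984, 1842, 2590, 966, 2290, 380, 0,
  1198], [2532, 2762, 630, 2362, 3846, 924, 3760, 1896, 3164, 1490, 1198, 0], [0, 1566, 2762,
  1450, 876, 2866, 3192, 2460, 3398, 246, 2000, 3748], [1566, 0, 3284, 948, 1394, 3372, 2662,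
  3970, 2904, 1768, 462, 2234], [2762, 3284, 0, 3936, 2470, 504, 1714, 854, 1932, 2620, 3354,
  1134], [1450, 948, 3936, 0, 1734, 3736, 2514, 3126, 2284, 1372, 634, 2830], [876, 1394, 2470,
  1734, 0, 2142, 3860, 2800, 3626, 922, 1212, 3528], [2866, 3372, 504, 3736, 2142, 0, 1866, 686,
  1652, 3012, 3298, 1430], [3192, 2662, 1714, 2514, 3860, 1866, 0, 1508, 318, 3214, 2984, 732],
  [2460, 3970, 854, 3126, 2800, 686, 1508, 0, 1242, 2410, 3660, 1848], [3398, 2904, 1932, 2284,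
  3626, 1652, 318, 1242, 0, 3504, 2710, 994], [246, 1768, 2620, 1372, 922, 3012, 3214, 2410, 3504,
  0, 1830, 3666], [2000, 462, 3354, 634, 1212, 3298, 2984, 3660, 2710, 1830, 0, 2420], [3748,
  2234, 1134, 2830, 3528, 1430, 732, 1848, 994, 3666, 2420, 0]]

/-- Inverses of the values of `listW` used to normalize the two halves of the table. -/
def wInverses : List ℕ :=
  [1447656126754135725569981658514863533802324083622222794522154836639050863490849659914017965107147812529097102219318853594392313787749053944522315182398696750702611293153894597119624400626421684100,
  1038849170781085970178704790452172969104225604047526270202571438076524535697322838742189564555063095731358436604473375933729663906461657010145472533534660751956067300667785179909128347676347032]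

/-- Coefficients of the Wronskian of `listB` and `listA`. -/
def listW : List ℤ :=
  addMulList (-1) (mulList listA (derivList listB)) (mulList (derivList listA) listB)

/-- The sign relating three roots, the first two on side `s` and the third on the other side. -/
def signBit (s : Bool) (i j k : ℕ) : Bool :=
  ((signMasks.getD (cond s 12 0 + i) []).getD j 0).testBit k

/-- The approximate roots with the values of `listB` and of `listW`. -/
def rootData (M : ℕ) : List (ℕ × ℕ × ℕ) :=
  approxRoots.map fun x =>
    (x, contractMod₁ M x (listB.map (residue M)), contractMod₁ M x (listW.map (residue M)))

/-- Check that a row of the table takes values `± c` times those of `listW`. -/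
def checkVals (M c : ℕ) (s : Bool) (i j : ℕ) (row : List ℕ) (D : List (ℕ × ℕ × ℕ)) : Bool :=
  Nat.gcd c M == 1 && (List.range 12).all fun k =>
    let x := D.getD (cond s 0 12 + k) (0, 0, 0)
    let v := contractMod₁ M x.1 row * x.2.1
    if signBit s i j k then (v + c * x.2.2) % M == 0 else v % M == (c * x.2.2) % M

/-- Check of the table of signs on side `s`. -/
def checkSide (M : ℕ) (s : Bool) (inv : ℕ) (t : List (List (List ℕ)))
    (D : List (ℕ × ℕ × ℕ)) : Bool :=
  (List.range 12).all fun i =>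
    let m := contractMod₃ M (D.getD (cond s 12 0 + i) (0, 0, 0)).1 t
    (List.range 12).all fun j => i == j ||
      (let row := contractMod₂ M (D.getD (cond s 12 0 + j) (0, 0, 0)).1 m
       let x := D.getD (cond s 0 12) (0, 0, 0)
       checkVals M ((contractMod₁ M x.1 row * x.2.1) * inv % M) s i j row D)

/-- An approximate root of the quadratic polynomial attached to side `s`. -/
def sideSqrt (M : ℕ) (s : Bool) : ℕ := cond s approxSqrt (M - approxSqrt)

/-- Check of the approximate roots. -/
def checkRoots (M : ℕ) : Bool :=
  M % 2 == 1 && Nat.gcd approxSqrt M == 1 && (sideSqrt M true + sideSqrt M false) % M == 0 &&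
  (List.range 24).all fun i =>
    let x := approxRoots.getD i 0
    let D := (rootData M).getD i (0, 0, 0)
    Nat.gcd D.2.1 M == 1 && Nat.gcd D.2.2 M == 1 &&
    contractMod₁ M x (coeffList.map (residue M)) == 0 &&
    Nat.gcd (contractMod₁ M x ((derivList coeffList).map (residue M))) M == 1 &&
    contractMod₁ M x (listA.map (residue M)) == (sideSqrt M (12 ≤ i) * D.2.1) % M

section evalMap
variable {α β R S : Type*} [CommRing R] [CommRing S]

theorem evalMap_cons (f : α → R) (x : R) (a : α) (l : List α) :
    evalMap f x (a :: l) = f a + x * evalMap f x l := rfl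

theorem evalMap_map (f : β → R) (g : α → β) (x : R) (l : List α) :
    evalMap f x (l.map g) = evalMap (fun a => f (g a)) x l := by
  induction l with
  | nil => rfl
  | cons a l ih => rw [List.map_cons, evalMap_cons, evalMap_cons, ih]

theorem map_evalMap (φ : R →+* S) (f : α → R) (x : R) (l : List α) :
    φ (evalMap f x l) = evalMap (fun a => φ (f a)) (φ x) l := by
  induction l with
  | nil => exact map_zero φ
  | cons a l ih => rw [evalMap_cons, evalMap_cons, map_add, map_mul, ih]

theorem evalMap_const_mul (b : R) (f : α → R) (x : R) (l : List α) :
    evalMap (fun a => b * f a) x l = b * evalMap f x l := by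
  induction l with
  | nil => exact (mul_zero b).symm
  | cons a l ih => rw [evalMap_cons, evalMap_cons, ih]; ring

theorem evalMap_intCast (x : R) (l : List ℤ) : evalMap (fun c : ℤ => (c : R)) x l = evalList l x :=
  rfl

theorem evalMap_zipAcc {f : α → R} {o : α} {g : α → α → α} {y : R} (ho : f o = 0)
    (hg : ∀ a b, f (g a b) = f a + y * f b) (x : R) (l acc : List α) :
    evalMap f x (zipAcc o g l acc) = evalMap f x l + y * evalMap f x acc := by
  induction l generalizing acc with
  | nil =>
    rw [zipAcc, evalMap_map]
    simp only [hg, ho, zero_add, evalMap_const_mul]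
    exact (zero_add _).symm
  | cons a l ih =>
    cases acc with
    | nil => rw [zipAcc]; simp [evalMap]
    | cons b acc => rw [zipAcc, evalMap_cons, evalMap_cons, evalMap_cons, ih, hg]; ring

theorem contractMod₁_cast (M x : ℕ) (l : List ℕ) :
    (contractMod₁ M x l : ZMod M) = evalMap (fun a : ℕ => (a : ZMod M)) x l := by
  induction l with
  | nil => exact Nat.cast_zero
  | cons a l ih =>
    rw [evalMap_cons, ← ih]
    simp [contractMod₁]

theorem evalMap_addMulMod (M y : ℕ) (x : ZMod M) (l acc : List ℕ) :
    evalMap (fun a : ℕ => (a : ZMod M)) x (addMulMod M y l acc) =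
      evalMap (fun a : ℕ => (a : ZMod M)) x l + y * evalMap (fun a : ℕ => (a : ZMod M)) x acc :=
  evalMap_zipAcc (by simp) (by simp) _ _ _

theorem evalMap_contractMod₂ (M y : ℕ) (x : ZMod M) (t : List (List ℕ)) :
    evalMap (fun a : ℕ => (a : ZMod M)) x (contractMod₂ M y t) =
      evalMap (fun l => evalMap (fun a : ℕ => (a : ZMod M)) x l) y t := by
  induction t with
  | nil => rfl
  | cons r t ih => rw [evalMap_cons, ← ih, contractMod₂, List.foldr_cons, evalMap_addMulMod]; rfl

theorem evalMap_contractMod₃ (M y : ℕ) (z x : ZMod M) (t : List (List (List ℕ))) :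
    evalMap (fun l => evalMap (fun a : ℕ => (a : ZMod M)) x l) z (contractMod₃ M y t) =
      evalMap (fun r => evalMap (fun l => evalMap (fun a : ℕ => (a : ZMod M)) x l) z r) y t := by
  induction t with
  | nil => rfl
  | cons r t ih =>
    rw [evalMap_cons, ← ih, contractMod₃, List.foldr_cons,
      evalMap_zipAcc (f := fun l => evalMap (fun a : ℕ => (a : ZMod M)) x l) rfl
        (evalMap_addMulMod M y x)]
    rfl

theorem residue_cast (M : ℕ) [NeZero M] (c : ℤ) : (residue M c : ZMod M) = c := by
  have h : ((residue M c : ℕ) : ℤ) = c % M :=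
    Int.toNat_of_nonneg (Int.emod_nonneg _ (by exact_mod_cast NeZero.ne M))
  have h2 : ((residue M c : ℕ) : ZMod M) = (((residue M c : ℕ) : ℤ) : ZMod M) := by simp
  rw [h2, h]
  simp

theorem contractMod₁_residue_cast (M : ℕ) [NeZero M] (x : ℕ) (l : List ℤ) :
    (contractMod₁ M x (l.map (residue M)) : ZMod M) = evalList l (x : ZMod M) := by
  rw [contractMod₁_cast, evalMap_map, ← evalMap_intCast]
  simp only [residue_cast]

/-- Value of the polynomial in three variables attached to `triangle`. -/
def triVal (f : ℤ × ℤ → R) (y z x : R) : R :=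
  evalMap (fun r => evalMap (fun l => evalMap f x l) z r) y (symmList 11 triangle)

theorem map_triVal (φ : R →+* S) (f : ℤ × ℤ → R) (y z x : R) :
    φ (triVal f y z x) = triVal (fun c => φ (f c)) (φ y) (φ z) (φ x) := by
  simp only [triVal, map_evalMap]

theorem triVal_const_mul (b : R) (f : ℤ × ℤ → R) (y z x : R) :
    triVal (fun c => b * f c) y z x = b * triVal f y z x := by
  simp only [triVal, evalMap_const_mul]

theorem evalMap_residueTriangle (M : ℕ) [NeZero M] (s : ℕ) (y z x : ZMod M) :
    evalMap (fun r => evalMap (fun l => evalMap (fun a : ℕ => (a : ZMod M)) x l) z r) y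
      (residueTriangle M s (symmList 11 triangle)) =
      triVal (fun c : ℤ × ℤ => (c.1 : ZMod M) + s * c.2) y z x := by
  simp only [residueTriangle, evalMap_map, triVal, ZMod.natCast_mod, Nat.cast_add, Nat.cast_mul,
    residue_cast]

end evalMap

/-- The approximate roots, labelled by the side they are on and by a number. -/
def approx (a : Bool × Fin 12) : ℕ := approxRoots.getD (cond a.1 12 0 + a.2) 0

theorem rootData_getD (M : ℕ) (n : ℕ) (hn : n < 24) : (rootData M).getD n (0, 0, 0) =
    (approxRoots.getD n 0, contractMod₁ M (approxRoots.getD n 0) (listB.map (residue M)),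
      contractMod₁ M (approxRoots.getD n 0) (listW.map (residue M))) := by
  have h : n < approxRoots.length := hn
  rw [rootData, List.getD_eq_getElem _ _ (by simpa using h), List.getElem_map,
    List.getD_eq_getElem _ _ h]

theorem isUnit_natCast_of_gcd {c M : ℕ} (h : (Nat.gcd c M == 1) = true) : IsUnit (c : ZMod M) :=
  (ZMod.isUnit_iff_coprime c M).mpr (by simpa using h)

section approx
variable {M : ℕ}

theorem isUnit_two_of_checkRoots (h : checkRoots M = true) : IsUnit (2 : ZMod M) := by
  simp only [checkRoots, Bool.and_eq_true, beq_iff_eq] at h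
  exact_mod_cast (ZMod.isUnit_iff_coprime 2 M).mpr (Nat.coprime_two_left.mpr
    (Nat.odd_iff.mpr h.1.1.1))

theorem sideSqrt_not (h : checkRoots M = true) (s : Bool) :
    (sideSqrt M (!s) : ZMod M) = - sideSqrt M s := by
  simp only [checkRoots, Bool.and_eq_true, beq_iff_eq] at h
  have h1 : ((sideSqrt M true + sideSqrt M false : ℕ) : ZMod M) = 0 :=
    (ZMod.natCast_eq_zero_iff _ _).mpr (Nat.dvd_of_mod_eq_zero h.1.2)
  push_cast at h1
  cases s
  · exact eq_neg_of_add_eq_zero_left h1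
  · exact eq_neg_of_add_eq_zero_right h1

theorem isUnit_sideSqrt (h : checkRoots M = true) (s : Bool) : IsUnit (sideSqrt M s : ZMod M) := by
  have h1 : IsUnit (sideSqrt M true : ZMod M) := by
    simp only [checkRoots, Bool.and_eq_true] at h
    exact isUnit_natCast_of_gcd h.1.1.2
  cases s
  · rw [← Bool.not_true, sideSqrt_not h]
    exact h1.neg
  · exact h1

theorem approx_spec [NeZero M] (h : checkRoots M = true) (a : Bool × Fin 12) :
    IsUnit (evalList listB (approx a : ZMod M)) ∧ IsUnit (evalList listW (approx a : ZMod M)) ∧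
    evalList coeffList (approx a : ZMod M) = 0 ∧
    IsUnit (evalList (derivList coeffList) (approx a : ZMod M)) ∧
    evalList listA (approx a : ZMod M) = sideSqrt M a.1 * evalList listB (approx a : ZMod M) := by
  simp only [checkRoots, Bool.and_eq_true, List.all_eq_true, List.mem_range] at h
  obtain ⟨s, i⟩ := a
  have hn : cond s 12 0 + (i : ℕ) < 24 := by cases s <;> simp <;> omega
  have hs : decide (12 ≤ cond s 12 0 + (i : ℕ)) = s := by cases s <;> simp
  obtain ⟨⟨⟨⟨h1, h2⟩, h3⟩, h4⟩, h5⟩ := h.2 _ hn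
  rw [rootData_getD M _ hn] at h1 h2 h5
  rw [hs] at h5
  dsimp only at h1 h2 h5
  replace h1 := isUnit_natCast_of_gcd h1
  replace h2 := isUnit_natCast_of_gcd h2
  replace h4 := isUnit_natCast_of_gcd h4
  replace h3 := congrArg (Nat.cast (R := ZMod M)) (beq_iff_eq.mp h3)
  replace h5 := congrArg (Nat.cast (R := ZMod M)) (beq_iff_eq.mp h5)
  rw [contractMod₁_residue_cast] at h1 h2 h3 h4 h5
  rw [ZMod.natCast_mod, Nat.cast_mul, contractMod₁_residue_cast] at h5
  exact ⟨h1, h2, h3.trans Nat.cast_zero, h4, h5⟩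

theorem cond_add_lt (s : Bool) (i : Fin 12) : cond s 12 0 + (i : ℕ) < 24 := by
  cases s <;> simp <;> omega

theorem checkVals_spec [NeZero M] {c : ℕ} {s : Bool} {i j : ℕ} {row : List ℕ}
    (h : checkVals M c s i j row (rootData M) = true) : IsUnit (c : ZMod M) ∧ ∀ k : Fin 12,
    evalMap (fun a : ℕ => (a : ZMod M)) (approx (!s, k) : ZMod M) row *
      evalList listB (approx (!s, k) : ZMod M) =
    (if signBit s i j k then -1 else 1) * (c * evalList listW (approx (!s, k) : ZMod M)) := by
  simp only [checkVals, Bool.and_eq_true, List.all_eq_true, List.mem_range] at h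
  refine ⟨isUnit_natCast_of_gcd h.1, fun k => ?_⟩
  have hk := h.2 k k.2
  have hnot : cond s 0 12 = cond (!s) 12 0 := by cases s <;> rfl
  rw [hnot, rootData_getD M _ (cond_add_lt _ _)] at hk
  change (if signBit s i j k = true then
    (contractMod₁ M (approx (!s, k)) row * contractMod₁ M (approx (!s, k)) (listB.map (residue M)) +
      c * contractMod₁ M (approx (!s, k)) (listW.map (residue M))) % M == 0
    else contractMod₁ M (approx (!s, k)) row *
      contractMod₁ M (approx (!s, k)) (listB.map (residue M)) % M ==
      c * contractMod₁ M (approx (!s, k)) (listW.map (residue M)) % M) = true at hk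
  rw [← contractMod₁_cast, ← contractMod₁_residue_cast, ← contractMod₁_residue_cast]
  split_ifs at hk ⊢ with hb
  · replace hk := congrArg (Nat.cast (R := ZMod M)) (beq_iff_eq.mp hk)
    rw [ZMod.natCast_mod] at hk
    push_cast at hk
    linear_combination hk
  · replace hk := congrArg (Nat.cast (R := ZMod M)) (beq_iff_eq.mp hk)
    rw [ZMod.natCast_mod, ZMod.natCast_mod] at hk
    push_cast at hk
    linear_combination hk

theorem signBit_spec [NeZero M] {s : Bool} {inv : ℕ} (h : checkSide M s inv
    (residueTriangle M (sideSqrt M s) (symmList 11 triangle)) (rootData M) = true)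
    {i j : Fin 12} (hij : i ≠ j) : ∃ c : ZMod M, IsUnit c ∧ ∀ k : Fin 12,
    triVal (fun c : ℤ × ℤ => (c.1 : ZMod M) + sideSqrt M s * c.2)
      (approx (s, i) : ZMod M) (approx (s, j)) (approx (!s, k)) *
      evalList listB (approx (!s, k) : ZMod M) =
    (if signBit s i j k then -1 else 1) * (c * evalList listW (approx (!s, k) : ZMod M)) := by
  simp only [checkSide, List.all_eq_true, List.mem_range] at h
  replace h := h i i.2 j j.2
  rw [Bool.or_eq_true] at h
  replace h := checkVals_spec (h.resolve_left (by simpa [Fin.ext_iff] using hij))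
  refine ⟨_, h.1, fun k => ?_⟩
  rw [← h.2 k, rootData_getD M _ (cond_add_lt s i), rootData_getD M _ (cond_add_lt s j),
    evalMap_contractMod₂, evalMap_contractMod₃, evalMap_residueTriangle]
  rfl

end approx

set_option maxRecDepth 100000 in
theorem checkRoots_eq : checkRoots (1270747 ^ 32) = true := by decide +kernel

set_option maxRecDepth 100000 in
theorem checkSide_eq (s : Bool) : checkSide (1270747 ^ 32) s (wInverses.getD (cond s 1 0) 0)
    (residueTriangle (1270747 ^ 32) (sideSqrt (1270747 ^ 32) s) (symmList 11 triangle))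
    (rootData (1270747 ^ 32)) = true := by
  revert s
  decide +kernel

instance : Fact (Nat.Prime 1270747) := ⟨by norm_num⟩

section padic
variable {p : ℕ} [Fact p.Prime] {n : ℕ}

theorem isUnit_of_isUnit_toZModPow (hn : n ≠ 0) {x : ℤ_[p]}
    (h : IsUnit (PadicInt.toZModPow n x)) : IsUnit x := by
  have : Fact (1 < p ^ n) := ⟨Nat.one_lt_pow hn (Fact.out : p.Prime).one_lt⟩
  have := Function.Surjective.isLocalHom (PadicInt.toZModPow (p := p) n)
    (ZMod.ringHom_surjective _)
  exact isUnit_of_map_unit _ _ h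

theorem toZModPow_eq_zero_iff {x : ℤ_[p]} : PadicInt.toZModPow n x = 0 ↔ (p : ℤ_[p]) ^ n ∣ x := by
  rw [← RingHom.mem_ker, PadicInt.ker_toZModPow, Ideal.mem_span_singleton]

/-- Hensel's lemma for simple roots of a polynomial modulo a power of `p`. -/
theorem exists_root_toZModPow_eq (hn : n ≠ 0) (l : List ℤ) (a : ℕ)
    (h0 : evalList l (a : ZMod (p ^ n)) = 0)
    (h1 : IsUnit (evalList (derivList l) (a : ZMod (p ^ n)))) :
    ∃ z : ℤ_[p], evalList l z = 0 ∧ PadicInt.toZModPow n z = a := by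
  set F : ℤ_[p][X] := evalList l X
  have heval (x : ℤ_[p]) : F.eval x = evalList l x := by
    rw [← coe_aeval_eq_eval]
    exact aeval_evalList_X l x
  have hderiv (x : ℤ_[p]) : F.derivative.eval x = evalList (derivList l) x := by
    rw [← coe_aeval_eq_eval, derivative_evalList]
    exact aeval_evalList_X _ x
  have hu : IsUnit (F.derivative.eval (a : ℤ_[p])) := by
    refine isUnit_of_isUnit_toZModPow hn ?_
    rw [hderiv, map_evalList, map_natCast]
    exact h1
  have hdvd : (p : ℤ_[p]) ^ n ∣ F.eval (a : ℤ_[p]) := by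
    rw [← toZModPow_eq_zero_iff, heval, map_evalList, map_natCast]
    exact h0
  have hnorm : ‖F.derivative.eval (a : ℤ_[p])‖ = 1 := PadicInt.isUnit_iff.mp hu
  have hlt : ‖F.eval (a : ℤ_[p])‖ < 1 :=
    (PadicInt.norm_lt_one_iff_dvd _).mpr ((dvd_pow_self _ hn).trans hdvd)
  obtain ⟨z, hz, hza, -⟩ := hensels_lemma (F := F) (a := (a : ℤ_[p]))
    (by simpa only [coe_aeval_eq_eval, hnorm, one_pow] using hlt)
  rw [coe_aeval_eq_eval] at hz
  rw [coe_aeval_eq_eval, hnorm] at hza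
  refine ⟨z, by rw [← heval, hz], ?_⟩
  obtain ⟨k, hk⟩ := binomExpansion F (a : ℤ_[p]) (z - a)
  rw [add_sub_cancel, hz] at hk
  have hunit : IsUnit (F.derivative.eval (a : ℤ_[p]) + k * (z - a)) := by
    rw [PadicInt.isUnit_iff, ← hnorm, ← norm_neg]
    refine PadicInt.norm_eq_of_norm_add_lt_right ?_
    rw [hnorm, neg_add_rev, neg_add_cancel_right, norm_neg, norm_mul]
    exact (mul_le_of_le_one_left (norm_nonneg _) (PadicInt.norm_le_one k)).trans_lt hza
  have h2 : (p : ℤ_[p]) ^ n ∣ z - a := by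
    rw [← hunit.dvd_mul_left]
    have : (F.derivative.eval (a : ℤ_[p]) + k * (z - a)) * (z - a) = - F.eval (a : ℤ_[p]) := by
      linear_combination -hk
    rw [this]
    exact hdvd.neg_right
  rw [← toZModPow_eq_zero_iff, map_sub, map_natCast, sub_eq_zero] at h2
  exact h2

theorem norm_le_one_of_isIntegral {x : ℚ_[p]} (hx : IsIntegral ℤ x) : ‖x‖ ≤ 1 := by
  obtain ⟨y, rfl⟩ := IsIntegrallyClosed.isIntegral_iff.mp (hx.tower_top (A := ℤ_[p]))
  exact y.2

end padic

section NumberField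
open NumberField
variable {L : Type*} [Field L]

/-- The restriction to the ring of integers of an embedding in the field of `p`-adic numbers. -/
noncomputable def integersToPadicInt {p : ℕ} [Fact p.Prime] (φ : L →+* ℚ_[p]) : 𝓞 L →+* ℤ_[p] :=
  (φ.comp (algebraMap (𝓞 L) L)).codRestrict (PadicInt.subring p) fun x =>
    norm_le_one_of_isIntegral (map_isIntegral_int φ (RingOfIntegers.isIntegral_coe x))

theorem norm_eq_prod_smul [NumberField L] [IsGalois ℚ L] (t : 𝓞 L) :
    ((Algebra.norm ℤ t : ℤ) : 𝓞 L) = ∏ σ : L ≃ₐ[ℚ] L, σ • t := by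
  apply RingOfIntegers.ext
  have h := Algebra.norm_eq_prod_automorphisms ℚ (t : L)
  rw [← Algebra.coe_norm_int] at h
  simp only [map_intCast] at h
  have h2 : (((Algebra.norm ℤ t : ℤ) : 𝓞 L) : L) = ((Algebra.norm ℤ t : ℤ) : L) :=
    map_intCast (algebraMap (𝓞 L) L) _
  rw [h2, h]
  exact (map_prod (algebraMap (𝓞 L) L) (fun σ : L ≃ₐ[ℚ] L => σ • t) Finset.univ).symm

/-- An integer of a Galois number field is zero if its conjugates are divisible by a power of `p`
and of smaller absolute value. -/
theorem eq_zero_of_toZModPow_of_norm_lt [NumberField L] [IsGalois ℚ L] {p : ℕ} [Fact p.Prime] {n : ℕ}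
    (Φ : 𝓞 L →+* ℤ_[p]) (j : L →+* ℂ) (t : 𝓞 L)
    (h1 : ∀ σ : L ≃ₐ[ℚ] L, PadicInt.toZModPow n (Φ (σ • t)) = 0)
    (h2 : ∀ σ : L ≃ₐ[ℚ] L, ‖j (σ • t : 𝓞 L)‖ < p ^ n) : t = 0 := by
  by_contra ht
  have hN := norm_eq_prod_smul t
  have hdvd : ((p : ℤ) ^ n) ^ Fintype.card (L ≃ₐ[ℚ] L) ∣ Algebra.norm ℤ t := by
    have h3 : ((p : ℤ_[p]) ^ n) ^ Fintype.card (L ≃ₐ[ℚ] L) ∣ ((Algebra.norm ℤ t : ℤ) : ℤ_[p]) := by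
      have := congrArg Φ hN
      rw [map_intCast, map_prod] at this
      rw [this, ← Finset.card_univ, ← Finset.prod_const]
      exact Finset.prod_dvd_prod_of_dvd _ _ fun σ _ => toZModPow_eq_zero_iff.mp (h1 σ)
    rw [← pow_mul] at h3 ⊢
    rw [← Ideal.mem_span_singleton, ← PadicInt.norm_le_pow_iff_mem_span_pow] at h3
    exact PadicInt.norm_int_le_pow_iff_dvd.mp h3
  have hlt : |Algebra.norm ℤ t| < ((p : ℤ) ^ n) ^ Fintype.card (L ≃ₐ[ℚ] L) := by
    have h3 := congrArg (fun x : 𝓞 L => ‖j x‖) hN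
    simp only [map_intCast, map_prod, norm_prod, Complex.norm_intCast] at h3
    have h4 : (|(Algebra.norm ℤ t : ℝ)|) < ((p : ℝ) ^ n) ^ Fintype.card (L ≃ₐ[ℚ] L) := by
      rw [h3, ← Finset.card_univ, ← Finset.prod_const]
      refine Finset.prod_lt_prod_of_nonempty (fun σ _ => norm_pos_iff.mpr ?_) (fun σ _ => h2 σ)
        Finset.univ_nonempty
      simpa [smul_eq_zero_iff_eq] using ht
    exact_mod_cast h4
  apply ht
  rw [← Algebra.norm_eq_zero_iff (R := ℤ)]
  exact Int.eq_zero_of_abs_lt_dvd hdvd hlt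

end NumberField

section bound
variable {α : Type*}

theorem norm_evalMap_le {f : α → ℂ} {g : α → ℤ} {x : ℂ} {n : ℤ} (hx : ‖x‖ ≤ n) (l : List α)
    (h : ∀ a, ‖f a‖ ≤ g a) : ‖evalMap f x l‖ ≤ (evalMap g n l : ℤ) := by
  induction l with
  | nil => simp [evalMap]
  | cons a l ih =>
    rw [evalMap_cons, evalMap_cons]
    push_cast
    have := (norm_nonneg x).trans hx
    refine (norm_add_le _ _).trans (add_le_add (h a) ?_)
    rw [norm_mul]
    gcongr

theorem norm_evalList_le {x : ℂ} {n : ℤ} (hx : ‖x‖ ≤ n) (l : List ℤ) :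
    ‖evalList l x‖ ≤ (evalMap (fun c : ℤ => |c|) n l : ℤ) := by
  rw [← evalMap_intCast]
  exact norm_evalMap_le hx l fun c => by simp

theorem norm_triVal_le {f : ℤ × ℤ → ℂ} {g : ℤ × ℤ → ℤ} {y z x : ℂ} {n : ℤ} (hy : ‖y‖ ≤ n)
    (hz : ‖z‖ ≤ n) (hx : ‖x‖ ≤ n) (h : ∀ a, ‖f a‖ ≤ g a) :
    ‖triVal f y z x‖ ≤ (triVal g n n n : ℤ) :=
  norm_evalMap_le hy _ fun _ => norm_evalMap_le hz _ fun _ => norm_evalMap_le hx _ h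

/-- Outside a disc, the norm of a value is bounded below by the dominant term. -/
theorem le_norm_evalList_append_one {x : ℂ} {n : ℕ} (hx : n ≤ ‖x‖) (l : List ℤ) :
    ((l.foldr (fun c h => n * h - c.natAbs) 1 : ℕ) : ℝ) ≤ ‖evalList (l ++ [1]) x‖ := by
  induction l with
  | nil => simp
  | cons c l ih =>
    rw [List.cons_append, evalList_cons, List.foldr_cons]
    generalize List.foldr (fun c h => n * h - c.natAbs) 1 l = m at ih ⊢
    rcases le_total (n * m) c.natAbs with h | h
    · rw [Nat.sub_eq_zero_of_le h, Nat.cast_zero]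
      exact norm_nonneg _
    · rw [Nat.cast_sub h, Nat.cast_mul, Nat.cast_natAbs, Int.cast_abs]
      have h1 : (n : ℝ) * m ≤ ‖x * evalList (l ++ [1]) x‖ := by
        rw [norm_mul]
        gcongr
      have h2 := norm_sub_norm_le (x * evalList (l ++ [1]) x) (-(c : ℂ))
      rw [norm_neg, Complex.norm_intCast, sub_neg_eq_add, add_comm] at h2
      linarith

theorem norm_le_of_evalList_coeffList_eq_zero {x : ℂ} (h : evalList coeffList x = 0) :
    ‖x‖ ≤ (16 : ℤ) := by
  by_contra! hx
  have h1 := le_norm_evalList_append_one (n := 16) (x := x) (by exact_mod_cast hx.le)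
    (coeffList.take 24)
  have h2 : coeffList.take 24 ++ [1] = coeffList := rfl
  rw [h2, h, norm_zero] at h1
  have h3 : 0 < (coeffList.take 24).foldr (fun c h => 16 * h - c.natAbs) 1 := by decide +kernel
  exact h1.not_gt (by exact_mod_cast h3)

end bound

section relations
variable {R S : Type*} [CommRing R] [CommRing S]

/-- Value at three roots of the polynomial defining the sign relations. -/
def hexVal (y z x : R) : R :=
  triVal (fun c : ℤ × ℤ => evalList listB y * (c.1 : R) + evalList listA y * c.2) y z x *
    evalList listB x

/-- Difference of squares that vanishes at four roots. -/
def hexDiff (y z x x' : R) : R :=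
  (hexVal y z x * evalList listW x') ^ 2 - (hexVal y z x' * evalList listW x) ^ 2

theorem map_hexVal (φ : R →+* S) (y z x : R) : φ (hexVal y z x) = hexVal (φ y) (φ z) (φ x) := by
  simp only [hexVal, map_mul, map_triVal, map_add, map_evalList, map_intCast]

theorem map_hexDiff (φ : R →+* S) (y z x x' : R) :
    φ (hexDiff y z x x') = hexDiff (φ y) (φ z) (φ x) (φ x') := by
  simp only [hexDiff, map_sub, map_pow, map_mul, map_hexVal, map_evalList]

/-- Bound for the absolute values of `hexVal`. -/
def hexBound : ℤ :=
  triVal (fun c : ℤ × ℤ => evalMap (fun c : ℤ => |c|) 16 listB * |c.1| +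
    evalMap (fun c : ℤ => |c|) 16 listA * |c.2|) 16 16 16 * evalMap (fun c : ℤ => |c|) 16 listB

theorem norm_hexVal_le {y z x : ℂ} (hy : ‖y‖ ≤ (16 : ℤ)) (hz : ‖z‖ ≤ (16 : ℤ))
    (hx : ‖x‖ ≤ (16 : ℤ)) : ‖hexVal y z x‖ ≤ hexBound := by
  rw [hexVal, norm_mul, hexBound, Int.cast_mul]
  have h := norm_triVal_le (f := fun c : ℤ × ℤ => evalList listB y * (c.1 : ℂ) +
    evalList listA y * c.2) (g := fun c : ℤ × ℤ => evalMap (fun c : ℤ => |c|) 16 listB * |c.1| +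
    evalMap (fun c : ℤ => |c|) 16 listA * |c.2|) hy hz hx fun c => by
      refine (norm_add_le _ _).trans ?_
      rw [norm_mul, norm_mul, Complex.norm_intCast, Complex.norm_intCast]
      push_cast
      gcongr
      · exact norm_evalList_le hy _
      · exact norm_evalList_le hy _
  exact mul_le_mul h (norm_evalList_le hx _) (norm_nonneg _) ((norm_nonneg _).trans h)

theorem norm_hexDiff_le {y z x x' : ℂ} (hy : ‖y‖ ≤ (16 : ℤ)) (hz : ‖z‖ ≤ (16 : ℤ))
    (hx : ‖x‖ ≤ (16 : ℤ)) (hx' : ‖x'‖ ≤ (16 : ℤ)) : ‖hexDiff y z x x'‖ ≤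
      (2 * (hexBound * evalMap (fun c : ℤ => |c|) 16 listW) ^ 2 : ℤ) := by
  have key {u v : ℂ} (hu : ‖u‖ ≤ (16 : ℤ)) (hv : ‖v‖ ≤ (16 : ℤ)) :
      ‖(hexVal y z u * evalList listW v) ^ 2‖ ≤
        ((hexBound * evalMap (fun c : ℤ => |c|) 16 listW) ^ 2 : ℤ) := by
    rw [norm_pow, norm_mul, Int.cast_pow, Int.cast_mul]
    have h1 := norm_hexVal_le hy hz hu
    have h2 := norm_evalList_le hv listW
    have := (norm_nonneg _).trans h1
    gcongr
  refine (norm_sub_le _ _).trans ((add_le_add (key hx hx') (key hx' hx)).trans_eq ?_)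
  push_cast
  ring

end relations

section residues
variable {M : ℕ} [NeZero M]

/-- The sign attached to three labels, the first two on the same side and the last on the other. -/
abbrev labelBit (a b c : Bool × Fin 12) : Bool := signBit a.1 a.2 b.2 c.2

theorem hexVal_approx (hR : checkRoots M = true) {inv : ℕ} {a b : Bool × Fin 12}
    (hS : checkSide M a.1 inv (residueTriangle M (sideSqrt M a.1) (symmList 11 triangle))
      (rootData M) = true) (hab : a ≠ b) (h1 : b.1 = a.1) : ∃ u : ZMod M, IsUnit u ∧
    ∀ c : Bool × Fin 12, c.1 ≠ a.1 → hexVal (approx a : ZMod M) (approx b) (approx c) =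
      (if labelBit a b c then -1 else 1) * (u * evalList listW (approx c : ZMod M)) := by
  obtain ⟨s, i⟩ := a
  obtain ⟨s', j⟩ := b
  obtain rfl : s' = s := h1
  obtain ⟨u, hu, h⟩ := signBit_spec hS (i := i) (j := j) (by rintro rfl; exact hab rfl)
  obtain ⟨hB, -, -, -, hA⟩ := approx_spec hR (s', i)
  refine ⟨evalList listB (approx (s', i) : ZMod M) * u, hB.mul hu, ?_⟩
  rintro ⟨t, k⟩ ht
  obtain rfl : t = !s' := Bool.eq_not.mpr ht
  have hk := h k
  rw [hexVal, hA]
  have : (fun c : ℤ × ℤ => evalList listB (approx (s', i) : ZMod M) * (c.1 : ZMod M) +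
      sideSqrt M s' * evalList listB (approx (s', i) : ZMod M) * c.2) = fun c : ℤ × ℤ =>
      evalList listB (approx (s', i) : ZMod M) * ((c.1 : ZMod M) + sideSqrt M s' * c.2) := by
    funext c
    ring
  rw [this, triVal_const_mul]
  linear_combination evalList listB (approx (s', i) : ZMod M) * hk

end residues

/-- The permutations of the labels that preserve the sides and the relations between signs. -/
def IsHexAut (π : Equiv.Perm (Bool × Fin 12)) : Prop :=
  (∀ a b, (π a).1 = (π b).1 ↔ a.1 = b.1) ∧ ∀ a b c d, a ≠ b → b.1 = a.1 → c.1 ≠ a.1 → d.1 ≠ a.1 →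
    (labelBit (π a) (π b) (π c) = labelBit (π a) (π b) (π d) ↔ labelBit a b c = labelBit a b d)

section roots
variable {R : Type*} [CommRing R] {M : ℕ} [NeZero M]
  {Ψ : R →+* ZMod M} {r : Bool × Fin 12 → R}

theorem four_mul_evalList_coeffList (x : R) : 4 * evalList coeffList x =
    evalList listA x ^ 2 + 11 * evalList listB x ^ 2 := by
  have h := evalList_eq_of_sameList (l := smulList 4 coeffList)
    (m := addMulList 11 (mulList listB listB) (mulList listA listA)) (by decide +kernel) x
  rw [evalList_smulList, evalList_addMulList, evalList_mulList, evalList_mulList] at h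
  push_cast at h
  linear_combination h

theorem evalList_listA_mul_eq_iff [IsDomain R] [Nontrivial (ZMod M)] (hR : checkRoots M = true)
    (hΨ : ∀ a, Ψ (r a) = approx a) (hr : ∀ a, evalList coeffList (r a) = 0) (a b : Bool × Fin 12) :
    evalList listA (r a) * evalList listB (r b) = evalList listA (r b) * evalList listB (r a) ↔
      a.1 = b.1 := by
  obtain ⟨hBa, -, -, -, hAa⟩ := approx_spec hR a
  obtain ⟨hBb, -, -, -, hAb⟩ := approx_spec hR b
  have hu : IsUnit (2 * (sideSqrt M b.1 : ZMod M) * (evalList listB (approx a : ZMod M) *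
    evalList listB (approx b : ZMod M))) :=
    ((isUnit_two_of_checkRoots hR).mul (isUnit_sideSqrt hR _)).mul (hBa.mul hBb)
  have ha := four_mul_evalList_coeffList (r a)
  have hb := four_mul_evalList_coeffList (r b)
  rw [hr, mul_zero] at ha hb
  have hsq : (evalList listA (r a) * evalList listB (r b)) ^ 2 =
      (evalList listA (r b) * evalList listB (r a)) ^ 2 := by
    linear_combination evalList listB (r a) ^ 2 * hb - evalList listB (r b) ^ 2 * ha
  constructor
  · intro h
    by_contra hab
    apply hu.ne_zero
    have h1 := congrArg Ψ h
    simp only [map_mul, map_evalList, hΨ, hAa, hAb] at h1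
    rw [Bool.eq_not.mpr hab, sideSqrt_not hR] at h1
    linear_combination -h1
  · intro hab
    rcases sq_eq_sq_iff_eq_or_eq_neg.mp hsq with h | h
    · exact h
    · exfalso
      apply hu.ne_zero
      have h1 := congrArg Ψ h
      simp only [map_neg, map_mul, map_evalList, hΨ, hAa, hAb] at h1
      rw [hab] at h1
      linear_combination h1

theorem hexVal_mul_eq_iff [IsDomain R] [Nontrivial (ZMod M)] (hR : checkRoots M = true)
    (hΨ : ∀ a, Ψ (r a) = approx a) {inv : ℕ} {a b c d : Bool × Fin 12}
    (hS : checkSide M a.1 inv (residueTriangle M (sideSqrt M a.1) (symmList 11 triangle))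
      (rootData M) = true) (hab : a ≠ b) (hb : b.1 = a.1) (hc : c.1 ≠ a.1) (hd : d.1 ≠ a.1)
    (h0 : hexDiff (r a) (r b) (r c) (r d) = 0) :
    hexVal (r a) (r b) (r c) * evalList listW (r d) =
      hexVal (r a) (r b) (r d) * evalList listW (r c) ↔ labelBit a b c = labelBit a b d := by
  obtain ⟨u, hu, h⟩ := hexVal_approx hR hS hab hb
  have hunit : IsUnit (2 * (u * (evalList listW (approx c : ZMod M) *
    evalList listW (approx d : ZMod M)))) := (isUnit_two_of_checkRoots hR).mul
      (hu.mul ((approx_spec hR c).2.1.mul (approx_spec hR d).2.1))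
  constructor
  · intro h1
    by_contra hcd
    apply hunit.ne_zero
    have h2 := congrArg Ψ h1
    simp only [map_mul, map_hexVal, map_evalList, hΨ, h c hc, h d hd] at h2
    rw [Bool.eq_not.mpr hcd] at h2
    cases hd : labelBit a b d <;> rw [hd] at h2 <;> simp at h2
    · linear_combination -h2
    · linear_combination h2
  · intro hcd
    rcases sq_eq_sq_iff_eq_or_eq_neg.mp (sub_eq_zero.mp h0) with h1 | h1
    · exact h1
    · exfalso
      apply hunit.ne_zero
      have h2 := congrArg Ψ h1
      simp only [map_neg, map_mul, map_hexVal, map_evalList, hΨ, h c hc, h d hd] at h2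
      rw [hcd] at h2
      cases hd : labelBit a b d <;> rw [hd] at h2 <;> simp at h2
      · linear_combination h2
      · linear_combination -h2

theorem toZMod_hexDiff_eq_zero (hR : checkRoots M = true)
    (hΨ : ∀ a, Ψ (r a) = approx a) {inv : ℕ} {a b c d : Bool × Fin 12}
    (hS : checkSide M a.1 inv (residueTriangle M (sideSqrt M a.1) (symmList 11 triangle))
      (rootData M) = true) (hab : a ≠ b) (hb : b.1 = a.1) (hc : c.1 ≠ a.1) (hd : d.1 ≠ a.1) :
    Ψ (hexDiff (r a) (r b) (r c) (r d)) = 0 := by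
  obtain ⟨u, hu, h⟩ := hexVal_approx hR hS hab hb
  rw [map_hexDiff, hexDiff, hΨ, hΨ, hΨ, hΨ, h c hc, h d hd]
  cases labelBit a b c <;> cases labelBit a b d <;> simp <;> ring

end roots

section
open NumberField
variable {L : Type*} [Field L] [NumberField L] [IsGalois ℚ L]

theorem isHexAut_of_smul {p n : ℕ} [Fact p.Prime] (hn : n ≠ 0) (hR : checkRoots (p ^ n) = true)
    (hS : ∀ s, ∃ inv, checkSide (p ^ n) s inv (residueTriangle (p ^ n) (sideSqrt (p ^ n) s)
      (symmList 11 triangle)) (rootData (p ^ n)) = true)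
    (hp : 2 * (hexBound * evalMap (fun c : ℤ => |c|) 16 listW) ^ 2 < (p : ℤ) ^ n)
    (Φ : 𝓞 L →+* ℤ_[p]) {r : Bool × Fin 12 → 𝓞 L}
    (hΦ : ∀ a, PadicInt.toZModPow n (Φ (r a)) = approx a) (hr : ∀ a, evalList coeffList (r a) = 0)
    {ψ : (L ≃ₐ[ℚ] L) → Equiv.Perm (Bool × Fin 12)} (hψ : ∀ σ a, r (ψ σ a) = σ • r a)
    (σ : L ≃ₐ[ℚ] L) : IsHexAut (ψ σ) := by
  have : Fact (1 < p ^ n) := ⟨Nat.one_lt_pow hn (Fact.out : p.Prime).one_lt⟩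
  have : NeZero (p ^ n) := ⟨(pow_pos (Fact.out : p.Prime).pos n).ne'⟩
  have hΨ (a : Bool × Fin 12) : ((PadicInt.toZModPow n).comp Φ) (r a) = approx a := hΦ a
  have hside (σ : L ≃ₐ[ℚ] L) (a b : Bool × Fin 12) : (ψ σ a).1 = (ψ σ b).1 ↔ a.1 = b.1 := by
    rw [← evalList_listA_mul_eq_iff hR hΨ hr, ← evalList_listA_mul_eq_iff hR hΨ hr]
    have h (x : 𝓞 L) (l : List ℤ) : evalList l (σ • x) = σ • evalList l x :=
      (map_evalList (MulSemiringAction.toRingHom (L ≃ₐ[ℚ] L) (𝓞 L) σ) l x).symm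
    rw [hψ, hψ, h, h, h, h, ← smul_mul', ← smul_mul', smul_left_cancel_iff]
  obtain ⟨j⟩ : Nonempty (L →+* ℂ) := inferInstance
  have hnorm (a : Bool × Fin 12) : ‖j (r a : L)‖ ≤ (16 : ℤ) := by
    apply norm_le_of_evalList_coeffList_eq_zero
    have := map_evalList (j.comp (algebraMap (𝓞 L) L)) coeffList (r a)
    rw [hr, map_zero] at this
    exact this.symm
  have hzero {a b c d : Bool × Fin 12} (hab : a ≠ b) (hb : b.1 = a.1) (hc : c.1 ≠ a.1)
      (hd : d.1 ≠ a.1) : hexDiff (r a) (r b) (r c) (r d) = 0 := by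
    have hsmul (σ : L ≃ₐ[ℚ] L) : σ • hexDiff (r a) (r b) (r c) (r d) =
        hexDiff (r (ψ σ a)) (r (ψ σ b)) (r (ψ σ c)) (r (ψ σ d)) := by
      rw [hψ, hψ, hψ, hψ]
      exact map_hexDiff (MulSemiringAction.toRingHom (L ≃ₐ[ℚ] L) (𝓞 L) σ) _ _ _ _
    refine eq_zero_of_toZModPow_of_norm_lt Φ j _ (fun σ => ?_) (fun σ => ?_) (p := p) (n := n)
    · obtain ⟨inv, h⟩ := hS (ψ σ a).1
      rw [hsmul]
      exact toZMod_hexDiff_eq_zero hR hΨ h ((ψ σ).injective.ne hab) ((hside σ _ _).mpr hb)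
        (mt (hside σ _ _).mp hc) (mt (hside σ _ _).mp hd)
    · rw [hsmul]
      have h1 := map_hexDiff (j.comp (algebraMap (𝓞 L) L)) (r (ψ σ a)) (r (ψ σ b)) (r (ψ σ c))
        (r (ψ σ d))
      have h2 := norm_hexDiff_le (hnorm (ψ σ a)) (hnorm (ψ σ b)) (hnorm (ψ σ c)) (hnorm (ψ σ d))
      have h3 : ((2 * (hexBound * evalMap (fun c : ℤ => |c|) 16 listW) ^ 2 : ℤ) : ℝ) <
          (p : ℝ) ^ n := by exact_mod_cast hp
      refine lt_of_le_of_lt (le_of_eq_of_le (congrArg norm h1) h2) h3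
  refine ⟨hside σ, fun a b c d hab hb hc hd => ?_⟩
  obtain ⟨inv, h⟩ := hS a.1
  obtain ⟨inv', h'⟩ := hS (ψ σ a).1
  rw [← hexVal_mul_eq_iff hR hΨ h hab hb hc hd (hzero hab hb hc hd),
    ← hexVal_mul_eq_iff hR hΨ h' ((ψ σ).injective.ne hab) ((hside σ _ _).mpr hb)
      (mt (hside σ _ _).mp hc) (mt (hside σ _ _).mp hd)
      (hzero ((ψ σ).injective.ne hab) ((hside σ _ _).mpr hb)
      (mt (hside σ _ _).mp hc) (mt (hside σ _ _).mp hd))]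
  have h (x : 𝓞 L) (l : List ℤ) : evalList l (σ • x) = σ • evalList l x :=
    (map_evalList (MulSemiringAction.toRingHom (L ≃ₐ[ℚ] L) (𝓞 L) σ) l x).symm
  have h' (y z x : 𝓞 L) : hexVal (σ • y) (σ • z) (σ • x) = σ • hexVal y z x :=
    (map_hexVal (MulSemiringAction.toRingHom (L ≃ₐ[ℚ] L) (𝓞 L) σ) y z x).symm
  rw [hψ, hψ, hψ, hψ, h, h, h', h', ← smul_mul', ← smul_mul', smul_left_cancel_iff]

end

theorem hexBound_lt : 2 * (hexBound * evalMap (fun c : ℤ => |c|) 16 listW) ^ 2 <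
    ((1270747 : ℕ) : ℤ) ^ 32 := by decide +kernel

section
variable (L : Type) [Field L] [NumberField L]

/-- A splitting field of the polynomial embeds in the field of `p`-adic numbers, with roots close
to the approximate ones. -/
theorem exists_labelling {p n : ℕ} [Fact p.Prime] (hn : n ≠ 0) (hR : checkRoots (p ^ n) = true)
    (hinj : Function.Injective fun a => (approx a : ZMod (p ^ n)))
    [IsSplittingField ℚ L (evalList coeffList X)] : ∃ (Φ : NumberField.RingOfIntegers L →+* ℤ_[p])
    (r : Bool × Fin 12 → NumberField.RingOfIntegers L),
    (∀ a, PadicInt.toZModPow n (Φ (r a)) = approx a) ∧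
    (∀ a, evalList coeffList (r a) = 0) ∧ ∀ x : L, evalList coeffList x = 0 → ∃ a, x = r a := by
  classical
  have : NeZero (p ^ n) := ⟨(pow_pos (Fact.out : p.Prime).pos n).ne'⟩
  have hz (a : Bool × Fin 12) := exists_root_toZModPow_eq hn coeffList (approx a)
    (approx_spec hR a).2.2.1 (approx_spec hR a).2.2.2.1
  choose z hz0 hza using hz
  have hzinj : Function.Injective fun a => (z a : ℚ_[p]) := by
    intro a b h
    apply hinj
    dsimp only
    rw [← hza, ← hza, Subtype.ext h]
  have hmap (K : Type) [Field K] [Algebra ℚ K] :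
      (evalList coeffList (X : ℚ[X])).map (algebraMap ℚ K) = evalList coeffList X :=
    map_evalList_X _ _
  have heval {K : Type} [Field K] (x : K) : (evalList coeffList X : K[X]).eval x =
      evalList coeffList x := by
    rw [← coe_aeval_eq_eval]
    exact aeval_evalList_X _ x
  have hdeg (K : Type) [Field K] := natDegree_evalList_X_of_monic (A := K) (n := 24)
    (l := coeffList) rfl rfl
  have hsplit : ((evalList coeffList (X : ℚ[X])).map (algebraMap ℚ ℚ_[p])).Splits := by
    rw [hmap, splits_iff_card_roots]
    refine le_antisymm (card_roots' _) ?_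
    have h1 : Finset.univ.image (fun a => (z a : ℚ_[p])) ⊆
        (evalList coeffList (X : ℚ_[p][X])).roots.toFinset := by
      intro x hx
      obtain ⟨a, -, rfl⟩ := Finset.mem_image.mp hx
      rw [Multiset.mem_toFinset, mem_roots (hdeg _).1.ne_zero, IsRoot, heval]
      have := map_evalList (PadicInt.Coe.ringHom (p := p)) coeffList (z a)
      rw [hz0, map_zero] at this
      exact this.symm
    have h2 := Finset.card_le_card h1
    rw [Finset.card_image_of_injective _ hzinj] at h2
    rw [(hdeg _).2]
    exact h2.trans (Multiset.toFinset_card_le _)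
  let φ : L →ₐ[ℚ] ℚ_[p] := IsSplittingField.lift L (evalList coeffList X) hsplit
  have hL := IsSplittingField.splits L (evalList coeffList (X : ℚ[X]))
  have hroot (a : Bool × Fin 12) : ∃ x : L, evalList coeffList x = 0 ∧ φ x = z a := by
    rw [hmap] at hL
    have hz' : evalList coeffList (z a : ℚ_[p]) = 0 := by
      have := map_evalList (PadicInt.Coe.ringHom (p := p)) coeffList (z a)
      rw [hz0, map_zero] at this
      exact this.symm
    obtain ⟨x, hx⟩ := hL.mem_range_of_isRoot (hdeg _).1.ne_zero (i := φ.toRingHom) (x := z a) (by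
      rw [map_evalList_X, IsRoot, heval, hz'])
    refine ⟨x, φ.toRingHom.injective ?_, hx⟩
    rw [map_evalList, hx, hz', map_zero]
  choose r hr0 hr using hroot
  have hintegral (a : Bool × Fin 12) : IsIntegral ℤ (r a) :=
    ⟨evalList coeffList X, (natDegree_evalList_X_of_monic (A := ℤ) (n := 24) rfl rfl).1, by
      rw [← aeval_def, aeval_evalList_X, hr0]⟩
  refine ⟨integersToPadicInt φ.toRingHom, fun a => ⟨r a, hintegral a⟩, fun a => ?_, fun a => ?_, ?_⟩
  · rw [← hza a]
    congr 1
    exact Subtype.ext (hr a)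
  · apply NumberField.RingOfIntegers.ext
    have := map_evalList (algebraMap (NumberField.RingOfIntegers L) L) coeffList ⟨r a, hintegral a⟩
    exact this.trans (hr0 a)
  · intro x hx
    have hrinj : Function.Injective r := fun a b h => hzinj (by dsimp only; rw [← hr, ← hr, h])
    have h1 : Finset.univ.image r ⊆ (evalList coeffList (X : L[X])).roots.toFinset := by
      intro x hx
      obtain ⟨a, -, rfl⟩ := Finset.mem_image.mp hx
      rw [Multiset.mem_toFinset, mem_roots (hdeg _).1.ne_zero, IsRoot, heval, hr0]
    have h2 := Finset.eq_of_subset_of_card_le h1 (by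
      rw [Finset.card_image_of_injective _ hrinj]
      refine (Multiset.toFinset_card_le _).trans ((card_roots' _).trans_eq (hdeg L).2))
    have h3 : x ∈ (evalList coeffList (X : L[X])).roots.toFinset := by
      rw [Multiset.mem_toFinset, mem_roots (hdeg _).1.ne_zero, IsRoot, heval, hx]
    rw [← h2] at h3
    obtain ⟨a, -, rfl⟩ := Finset.mem_image.mp h3
    exact ⟨a, rfl⟩

end

theorem approx_injective : Function.Injective fun a => (approx a : ZMod (1270747 ^ 32)) := by
  intro a b h
  have h1 := (ZMod.natCast_eq_natCast_iff' _ _ _).mp h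
  revert a b
  have : ∀ a b : Bool × Fin 12, approx a % 1270747 ^ 32 = approx b % 1270747 ^ 32 → a = b := by
    decide +kernel
  exact fun a b _ => this a b

/-- The group of permutations of the labels that preserve the relations between signs. -/
def hexAut : Subgroup (Equiv.Perm (Bool × Fin 12)) where
  carrier := {π | IsHexAut π}
  one_mem' := ⟨fun _ _ => Iff.rfl, fun _ _ _ _ _ _ _ _ => Iff.rfl⟩
  mul_mem' {π π'} h h' := by
    refine ⟨fun a b => (h.1 _ _).trans (h'.1 _ _), fun a b c d hab hb hc hd => ?_⟩
    exact (h.2 _ _ _ _ (π'.injective.ne hab) ((h'.1 _ _).mpr hb) (mt (h'.1 _ _).mp hc)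
      (mt (h'.1 _ _).mp hd)).trans (h'.2 _ _ _ _ hab hb hc hd)
  inv_mem' {π} h := by
    have h0 (a : Bool × Fin 12) : π (π⁻¹ a) = a := π.apply_symm_apply a
    have h1 (a b : Bool × Fin 12) : (π⁻¹ a).1 = (π⁻¹ b).1 ↔ a.1 = b.1 := by
      rw [← h.1, h0, h0]
    refine ⟨h1, fun a b c d hab hb hc hd => ?_⟩
    rw [← h.2 _ _ _ _ (π⁻¹.injective.ne hab) ((h1 _ _).mpr hb) (mt (h1 _ _).mp hc)
      (mt (h1 _ _).mp hd)]
    simp only [h0]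

section rigidity
variable {π : Equiv.Perm (Bool × Fin 12)} {s : Bool} {F : List (Fin 12)}

theorem IsHexAut.signBit_iff (h : IsHexAut π) (hF : ∀ i ∈ F, π (s, i) = (s, i)) {k l k' l' : Fin 12}
    (hk : π (!s, k) = (!s, k')) (hl : π (!s, l) = (!s, l')) : ∀ i ∈ F, ∀ j ∈ F, i ≠ j →
      (signBit s i j k' = signBit s i j l' ↔ signBit s i j k = signBit s i j l) := by
  intro i hi j hj hij
  have := h.2 (s, i) (s, j) (!s, k) (!s, l) (by simpa using hij) rfl (by simp) (by simp)
  rwa [hF i hi, hF j hj, hk, hl] at this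

theorem IsHexAut.exists_image (h : IsHexAut π) {i : Fin 12} (hi : π (s, i) = (s, i))
    (t : Bool) (k : Fin 12) : ∃ m, π (t, k) = (t, m) := by
  refine ⟨(π (t, k)).2, Prod.ext ?_ rfl⟩
  have := h.1 (t, k) (s, i)
  rw [hi] at this
  dsimp only at this ⊢
  rcases Bool.eq_or_eq_not t s with rfl | rfl
  · exact this.mpr rfl
  · exact Bool.eq_not.mpr (mt this.mp (by simp))

theorem IsHexAut.apply_eq_of_ne (h : IsHexAut π) {i₀ : Fin 12} (h0 : i₀ ∈ F)
    (hF : ∀ i ∈ F, π (s, i) = (s, i)) {k : Fin 12}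
    (hk : ∀ m : Fin 12, (∀ l : Fin 12, ∃ l' : Fin 12, ∀ i ∈ F, ∀ j ∈ F, i ≠ j →
      (signBit s i j m = signBit s i j l' ↔ signBit s i j k = signBit s i j l)) → m = k) :
    π (!s, k) = (!s, k) := by
  obtain ⟨m, hm⟩ := h.exists_image (hF _ h0) (!s) k
  rw [hm, hk m]
  intro l
  obtain ⟨l', hl'⟩ := h.exists_image (hF _ h0) (!s) l
  exact ⟨l', h.signBit_iff hF hm hl'⟩

theorem IsHexAut.apply_eq_of_apply_eq (h : IsHexAut π) {i₀ : Fin 12} (h0 : i₀ ∈ F)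
    (hF : ∀ i ∈ F, π (s, i) = (s, i)) {k l : Fin 12} (hk : π (!s, k) = (!s, k))
    (hl : ∀ m : Fin 12, (∀ i ∈ F, ∀ j ∈ F, i ≠ j →
      (signBit s i j k = signBit s i j m ↔ signBit s i j k = signBit s i j l)) → m = l) :
    π (!s, l) = (!s, l) := by
  obtain ⟨m, hm⟩ := h.exists_image (hF _ h0) (!s) l
  rw [hm, hl m (h.signBit_iff hF hk hm)]

set_option synthInstance.maxSize 1000 in
set_option synthInstance.maxHeartbeats 200000 in
/-- A permutation that preserves the relations between signs is determined by the images of five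
labels. -/
theorem IsHexAut.eq_one (h : IsHexAut π) (hF : ∀ i : Fin 12, i < 5 → π (false, i) = (false, i)) :
    π = 1 := by
  have hF' : ∀ i ∈ ([0, 1, 2, 3, 4] : List (Fin 12)), π (false, i) = (false, i) := by
    intro i hi
    exact hF i (by revert i; decide)
  have h0 : π (true, 0) = (true, 0) :=
    h.apply_eq_of_ne (s := false) (List.mem_cons_self) hF' (by decide +kernel)
  have h1 : ∀ l ∈ ([0, 1, 4, 5, 6, 7, 8, 9, 10, 11] : List (Fin 12)), π (true, l) = (true, l) := by
    have : ∀ l ∈ ([0, 1, 4, 5, 6, 7, 8, 9, 10, 11] : List (Fin 12)), ∀ m : Fin 12,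
        (∀ i ∈ ([0, 1, 2, 3, 4] : List (Fin 12)), ∀ j ∈ ([0, 1, 2, 3, 4] : List (Fin 12)), i ≠ j →
        (signBit false i j (0 : Fin 12) = signBit false i j m ↔
          signBit false i j (0 : Fin 12) = signBit false i j l)) → m = l := by
      decide +kernel
    exact fun l hl =>
      h.apply_eq_of_apply_eq (s := false) (List.mem_cons_self) hF' h0 (this l hl)
  have h2 : ∀ l ∈ List.finRange 12, π (false, l) = (false, l) := by
    have : ∀ l m : Fin 12, (∀ i ∈ ([0, 1, 4, 5, 6, 7, 8, 9, 10, 11] : List (Fin 12)),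
        ∀ j ∈ ([0, 1, 4, 5, 6, 7, 8, 9, 10, 11] : List (Fin 12)), i ≠ j →
        (signBit true i j (0 : Fin 12) = signBit true i j m ↔
          signBit true i j (0 : Fin 12) = signBit true i j l)) → m = l := by
      decide +kernel
    exact fun l _ => h.apply_eq_of_apply_eq (s := true) (List.mem_cons_self) h1
      (hF 0 (by decide)) (this l)
  have h3 (l : Fin 12) : π (true, l) = (true, l) := by
    have : ∀ l m : Fin 12, (∀ i ∈ List.finRange 12, ∀ j ∈ List.finRange 12, i ≠ j →
        (signBit false i j (0 : Fin 12) = signBit false i j m ↔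
          signBit false i j (0 : Fin 12) = signBit false i j l)) → m = l := by
      decide +kernel
    exact h.apply_eq_of_apply_eq (s := false) (List.mem_finRange 0) h2 h0 (this l)
  ext1 ⟨s, l⟩
  cases s
  · exact h2 l (List.mem_finRange l)
  · exact h3 l

end rigidity

theorem card_hexAut_le : Nat.card hexAut ≤ 190080 := by
  let e (π : hexAut) : Bool × (Fin 5 ↪ Fin 12) :=
    ((π.1 (false, 0)).1, ⟨fun i => (π.1 (false, i.castLE (by norm_num))).2, fun i j hij => by
      have h := (π.2.1 (false, i.castLE (by norm_num)) (false, j.castLE (by norm_num))).mpr rfl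
      have := π.1.injective (Prod.ext h hij)
      simpa using this⟩)
  have he : Function.Injective e := by
    intro π π' h
    obtain ⟨h1, h2⟩ := Prod.ext_iff.mp h
    have h3 : (π'⁻¹ * π).1 = 1 := by
      refine IsHexAut.eq_one (π'⁻¹ * π).2 fun i hi => ?_
      rw [Subgroup.coe_mul, Subgroup.coe_inv, Equiv.Perm.mul_apply]
      refine (Equiv.symm_apply_eq _).mpr ?_
      refine Prod.ext ?_ ?_
      · exact ((π.2.1 (false, i) (false, 0)).mpr rfl).trans
          (h1.trans ((π'.2.1 (false, 0) (false, i)).mpr rfl))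
      · exact DFunLike.congr_fun h2 ⟨i, hi⟩
    rw [OneMemClass.coe_eq_one, inv_mul_eq_one] at h3
    exact h3.symm
  refine (Nat.card_le_card_of_injective e he).trans_eq ?_
  rw [Nat.card_eq_fintype_card, Fintype.card_prod, Fintype.card_embedding_eq]
  simp

section stabilizer
variable {α : Type*} [Finite α]

/-- The order of a subgroup is at least that of a point stabilizer times the size of the orbit. -/
theorem card_mul_card_inf_stabilizer_le (N : Subgroup (Equiv.Perm α)) (a : α) (S : Finset α)
    (h : ∀ x ∈ S, ∃ π ∈ N, π a = x) :
    S.card * Nat.card (N ⊓ MulAction.stabilizer (Equiv.Perm α) a : Subgroup (Equiv.Perm α)) ≤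
      Nat.card N := by
  choose! π hπ hπa using h
  rw [← Nat.card_eq_finsetCard, ← Nat.card_prod]
  refine Nat.card_le_card_of_injective (fun x => ⟨π x.1 * x.2, N.mul_mem (hπ _ x.1.2) x.2.2.1⟩) ?_
  rintro ⟨x, σ⟩ ⟨y, τ⟩ h
  have h1 : π x * σ.1 = π y * τ.1 := congrArg Subtype.val h
  have hxy : x = y := by
    have h2 := DFunLike.congr_fun h1 a
    have hσ : σ.1 a = a := σ.2.2
    have hτ : τ.1 a = a := τ.2.2
    rw [Equiv.Perm.mul_apply, Equiv.Perm.mul_apply, hσ, hτ, hπa _ x.2, hπa _ y.2] at h2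
    exact Subtype.ext h2
  subst hxy
  exact Prod.ext rfl (Subtype.ext (mul_left_cancel h1))

/-- An element of order prime to the numbers up to the index lies in the subgroup. -/
theorem mem_of_pow_prime_eq_one {G : Type*} [Group G] [Finite G] (H : Subgroup G) {p : ℕ}
    (hp : p.Prime) (hH : H.index < p) {u : G} (hu : u ^ p = 1) : u ∈ H := by
  obtain ⟨n, hn0, hn, h⟩ := H.exists_pow_mem_of_index_ne_zero H.index_ne_zero_of_finite u
  have hc : Nat.Coprime n p :=
    ((Nat.Prime.coprime_iff_not_dvd hp).mpr (Nat.not_dvd_of_pos_of_lt hn0 (hn.trans_lt hH))).symm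
  obtain ⟨m, hm⟩ := exists_pow_eq_self_of_coprime (x := u) (n := n)
    (hc.coprime_dvd_right (orderOf_dvd_of_pow_eq_one hu))
  rw [← hm]
  exact H.pow_mem h m

end stabilizer

/-- The map given by a table on each side. -/
def tableMap (t : List (List ℕ)) (a : Bool × Fin 12) : Bool × Fin 12 :=
  (a.1, Fin.ofNat 12 ((t.getD (cond a.1 1 0) []).getD a.2 0))

/-- Table of a permutation of order `11`. -/
def tableU : List (List ℕ) :=
  [[0, 5, 10, 9, 11, 2, 1, 4, 7, 6, 8, 3], [3, 2, 10, 1, 4, 8, 11, 5, 0, 7, 6, 9]]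

/-- Table of a permutation of order `11`. -/
def tableW : List (List ℕ) :=
  [[10, 3, 2, 0, 11, 7, 8, 4, 9, 1, 5, 6], [0, 10, 11, 8, 6, 2, 1, 3, 4, 7, 5, 9]]

/-- The composite of powers of two maps. -/
def wordMap {α : Type*} (u w : α → α) (l : List (ℕ × ℕ)) (a : α) : α :=
  l.foldr (fun e a => u^[e.1] (w^[e.2] a)) a

/-- Every map with the properties below is a permutation preserving the relations between signs. -/
theorem exists_perm_mem_hexAut {f : Bool × Fin 12 → Bool × Fin 12} (h11 : ∀ a, f^[11] a = a)
    (h1 : ∀ a, (f a).1 = a.1)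
    (h2 : ∀ s, ∀ i j k : Fin 12, i ≠ j → (labelBit (f (s, i)) (f (s, j)) (f (!s, k)) ^^
      labelBit (f (s, i)) (f (s, j)) (f (!s, 0))) = (signBit s i j k ^^ signBit s i j 0)) :
    ∃ π : hexAut, π ^ 11 = 1 ∧ ⇑π.1 = f := by
  let π : Equiv.Perm (Bool × Fin 12) := ⟨f, f^[10], h11, fun a => by
    rw [← Function.iterate_succ_apply' f 10]
    exact h11 a⟩
  have hπ : π ∈ hexAut := by
    refine ⟨fun a b => (by rw [← h1 a, ← h1 b]; rfl), ?_⟩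
    rintro ⟨s, i⟩ ⟨s', j⟩ ⟨t, k⟩ ⟨t', l⟩ hab rfl hc hd
    obtain rfl : t = !s' := Bool.eq_not.mpr hc
    obtain rfl : t' = !s' := Bool.eq_not.mpr hd
    have hij : i ≠ j := by rintro rfl; exact hab rfl
    have hk := h2 s' i j k hij
    have hl := h2 s' i j l hij
    change labelBit (f _) (f _) (f _) = labelBit (f _) (f _) (f _) ↔ signBit _ _ _ _ = signBit _ _ _ _
    revert hk hl
    generalize labelBit (f (s', i)) (f (s', j)) (f (!s', k)) = b1
    generalize labelBit (f (s', i)) (f (s', j)) (f (!s', l)) = b2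
    generalize labelBit (f (s', i)) (f (s', j)) (f (!s', 0)) = b3
    generalize signBit s' i j k = b4
    generalize signBit s' i j l = b5
    generalize signBit s' i j 0 = b6
    revert b1 b2 b3 b4 b5 b6
    decide
  refine ⟨⟨π, hπ⟩, Subtype.ext (Equiv.ext fun a => ?_), rfl⟩
  exact h11 a

theorem tableU_spec : ∃ π : hexAut, π ^ 11 = 1 ∧ ⇑π.1 = tableMap tableU :=
  exists_perm_mem_hexAut (by decide +kernel) (by decide +kernel) (by decide +kernel)

theorem tableW_spec : ∃ π : hexAut, π ^ 11 = 1 ∧ ⇑π.1 = tableMap tableW :=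
  exists_perm_mem_hexAut (by decide +kernel) (by decide +kernel) (by decide +kernel)

theorem iterate_mem {α : Type*} {N : Subgroup (Equiv.Perm α)} {f : α → α}
    (h : ∃ π ∈ N, ⇑π = f) (n : ℕ) : ∃ π ∈ N, ⇑π = f^[n] := by
  obtain ⟨π, hπ, rfl⟩ := h
  exact ⟨π ^ n, N.pow_mem hπ n, rfl⟩

theorem comp_mem {α : Type*} {N : Subgroup (Equiv.Perm α)} {f g : α → α}
    (h : ∃ π ∈ N, ⇑π = f) (h' : ∃ π ∈ N, ⇑π = g) : ∃ π ∈ N, ⇑π = f ∘ g := by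
  obtain ⟨π, hπ, rfl⟩ := h
  obtain ⟨τ, hτ, rfl⟩ := h'
  exact ⟨π * τ, N.mul_mem hπ hτ, rfl⟩

theorem wordMap_mem {α : Type*} {N : Subgroup (Equiv.Perm α)} {u w : α → α}
    (hu : ∃ π ∈ N, ⇑π = u) (hw : ∃ π ∈ N, ⇑π = w) (l : List (ℕ × ℕ)) :
    ∃ π ∈ N, ⇑π = wordMap u w l := by
  induction l with
  | nil => exact ⟨1, N.one_mem, rfl⟩
  | cons e l ih =>
    exact comp_mem (iterate_mem hu e.1) (comp_mem (iterate_mem hw e.2) ih)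

/-- The intersection of a group of permutations with the pointwise stabilizer of labels. -/
def fixFirst (H : Subgroup (Equiv.Perm (Bool × Fin 12))) :
    ℕ → Subgroup (Equiv.Perm (Bool × Fin 12))
  | 0 => H
  | n + 1 => fixFirst H n ⊓ MulAction.stabilizer (Equiv.Perm (Bool × Fin 12)) (false, Fin.ofNat 12 n)

theorem mem_fixFirst {H : Subgroup (Equiv.Perm (Bool × Fin 12))} {f : Bool × Fin 12 → Bool × Fin 12}
    (hf : ∃ π ∈ H, ⇑π = f) {n : ℕ}
    (h : ∀ k < n, f (false, Fin.ofNat 12 k) = (false, Fin.ofNat 12 k)) :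
    ∃ π ∈ fixFirst H n, ⇑π = f := by
  obtain ⟨π, hπ, rfl⟩ := hf
  refine ⟨π, ?_, rfl⟩
  induction n with
  | zero => exact hπ
  | succ n ih => exact ⟨ih fun k hk => h k (hk.trans n.lt_succ_self), h n n.lt_succ_self⟩

theorem mul_card_fixFirst_le {H : Subgroup (Equiv.Perm (Bool × Fin 12))} {n : ℕ}
    {f g : Bool × Fin 12 → Bool × Fin 12} (hf : ∃ π ∈ fixFirst H n, ⇑π = f)
    (hg : ∃ π ∈ fixFirst H n, ⇑π = g)
    (h : ∀ k : Fin 12, n ≤ k → ∃ i : Fin 11, ∃ j : Fin 11,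
      f^[i] (g^[j] (false, Fin.ofNat 12 n)) = (false, k)) :
    (12 - n) * Nat.card (fixFirst H (n + 1)) ≤ Nat.card (fixFirst H n) := by
  have := card_mul_card_inf_stabilizer_le (fixFirst H n) (false, Fin.ofNat 12 n)
    ((Finset.univ.filter fun k : Fin 12 => n ≤ k).image fun k => (false, k)) (fun x hx => by
      obtain ⟨k, hk, rfl⟩ := Finset.mem_image.mp hx
      obtain ⟨i, j, hij⟩ := h k (Finset.mem_filter.mp hk).2
      obtain ⟨π, hπ, hπ'⟩ := comp_mem (iterate_mem hf i) (iterate_mem hg j)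
      exact ⟨π, hπ, by rw [hπ']; exact hij⟩)
  rw [Finset.card_image_of_injective _ (Prod.mk_right_injective false)] at this
  refine le_trans (Nat.mul_le_mul_right _ ?_) this
  rcases le_or_gt 12 n with hn | hn
  · rw [Nat.sub_eq_zero_of_le hn]
    exact Nat.zero_le _
  · interval_cases n <;> decide

theorem card_eq_of_le_hexAut {H : Subgroup (Equiv.Perm (Bool × Fin 12))} (hH : H ≤ hexAut)
    (htrans : ∀ a b, ∃ π ∈ H, π a = b) (hcard : 31680 ≤ Nat.card H) : Nat.card H = 190080 := by
  have hidx : (H.subgroupOf hexAut).index < 11 := by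
    have h1 := (H.subgroupOf hexAut).index_mul_card
    rw [Nat.card_congr (Subgroup.subgroupOfEquivOfLe hH).toEquiv] at h1
    have h2 := card_hexAut_le
    nlinarith
  have hmem {f : Bool × Fin 12 → Bool × Fin 12} (hf : ∃ π : hexAut, π ^ 11 = 1 ∧ ⇑π.1 = f) :
      ∃ π ∈ H, ⇑π = f := by
    obtain ⟨π, h11, h⟩ := hf
    exact ⟨π, mem_of_pow_prime_eq_one _ (by norm_num) hidx h11, h⟩
  have hword (l : List (ℕ × ℕ)) := wordMap_mem (hmem tableU_spec) (hmem tableW_spec) l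
  have h0 : 24 * Nat.card (fixFirst H 1) ≤ Nat.card H :=
    card_mul_card_inf_stabilizer_le H (false, 0) Finset.univ fun x _ => htrans _ x
  have h1 := mul_card_fixFirst_le (n := 1)
    (mem_fixFirst (hword [(1, 0)]) (by decide +kernel))
    (mem_fixFirst (hword []) (by decide +kernel)) (by decide +kernel)
  have h2 := mul_card_fixFirst_le (n := 2)
    (mem_fixFirst (hword [(0, 1), (10, 8)]) (by decide +kernel))
    (mem_fixFirst (hword [(0, 6), (2, 3)]) (by decide +kernel)) (by decide +kernel)
  have h3 := mul_card_fixFirst_le (n := 3)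
    (mem_fixFirst (hword [(2, 5), (4, 4)]) (by decide +kernel))
    (mem_fixFirst (hword [(3, 2), (4, 5)]) (by decide +kernel)) (by decide +kernel)
  have h4 := mul_card_fixFirst_le (n := 4)
    (mem_fixFirst (hword [(3, 3), (2, 5), (2, 0)]) (by decide +kernel))
    (mem_fixFirst (hword [(3, 7), (8, 8), (1, 0)]) (by decide +kernel)) (by decide +kernel)
  simp only [Nat.reduceAdd, Nat.reduceSub] at h1 h2 h3 h4
  have h5 : 0 < Nat.card (fixFirst H 5) := Nat.card_pos
  have h6 : Nat.card H ≤ 190080 := (Subgroup.card_le_of_le hH).trans card_hexAut_le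
  omega

/-- Remainder of a coefficient list by a monic one of degree `n`, with coefficients modulo `p`. -/
def modList (p n : ℕ) (h l : List ℤ) : List ℤ := (divModList n h l).2.map (· % (p : ℤ))

/-- Power of a coefficient list modulo `p` and `h`, for an exponent with at most `k` binary digits. -/
def powModList (p n : ℕ) (h l : List ℤ) : ℕ → ℕ → List ℤ
  | 0, _ => [1]
  | k + 1, e =>
    let s := powModList p n h l k (e / 2)
    let t := modList p n h (mulList s s)
    if e % 2 = 1 then modList p n h (mulList l t) else t

/-- The power of exponent `p ^ k` of the variable modulo `p` and `h`. -/
def frobeniusModList (p n : ℕ) (h : List ℤ) : ℕ → List ℤ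
  | 0 => [0, 1]
  | k + 1 => powModList p n h (frobeniusModList p n h k) (p.log2 + 1) p

section modList
variable {A : Type*} [CommRing A] {p n : ℕ} [CharP A p] {h : List ℤ} {x : A}

theorem evalList_modList (hn : h.length = n + 1) (hlead : h.getD n 0 = 1) (hx : evalList h x = 0)
    (l : List ℤ) : evalList (modList p n h l) x = evalList l x := by
  have h1 := (evalList_divModList hn hlead l x).2
  rw [hx, mul_zero, zero_add] at h1
  rw [h1, modList]
  generalize (divModList n h l).2 = m
  induction m with
  | nil => rfl
  | cons c m ih =>
    rw [List.map_cons, evalList_cons, evalList_cons, ih]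
    congr 1
    rw [← sub_eq_zero, ← Int.cast_sub, CharP.intCast_eq_zero_iff A p, ← neg_sub, dvd_neg]
    exact Int.dvd_self_sub_emod

theorem evalList_frobeniusModList (hn : h.length = n + 1) (hlead : h.getD n 0 = 1)
    (hx : evalList h x = 0) (k : ℕ) : evalList (frobeniusModList p n h k) x = x ^ p ^ k := by
  have hpow (l : List ℤ) (k : ℕ) : ∀ e < 2 ^ k,
      evalList (powModList p n h l k e) x = evalList l x ^ e := by
    induction k with
    | zero => intro e he; simp [powModList, show e = 0 by simpa using he]
    | succ k ih =>
      intro e he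
      have h1 : evalList (modList p n h (mulList (powModList p n h l k (e / 2))
          (powModList p n h l k (e / 2)))) x = evalList l x ^ (2 * (e / 2)) := by
        rw [evalList_modList hn hlead hx, evalList_mulList, ih _ (by rw [pow_succ] at he; omega),
          ← pow_add, two_mul]
      rw [powModList]
      split_ifs with h2
      · rw [evalList_modList hn hlead hx, evalList_mulList, h1, ← pow_succ']
        congr 1; omega
      · rw [h1]
        congr 1; omega
  induction k with
  | zero => simp [frobeniusModList]
  | succ k ih => rw [frobeniusModList, hpow _ _ _ Nat.lt_log2_self, ih, ← pow_mul, pow_succ]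

end modList

/-- Whether, modulo `p`, the number `a` is a simple root of `F` and the roots of `h` are roots of
`F` that are fixed by the `n`-th iterate of the Frobenius map but not by the `m`-th one. -/
def checkFrobenius (p n m : ℕ) (F h u : List ℤ) (a v : ℤ) : Bool :=
  h.length == n + 1 && h.getD n 0 == 1 && (modList p n h F).all (· == 0) &&
  sameList (frobeniusModList p n h n) [0, 1] &&
  sameList (modList p n h (mulList u (addMulList (-1) [0, 1] (frobeniusModList p n h m)))) [1] &&
  (modList p 1 [-a, 1] F).all (· == 0) &&
  sameList (modList p 1 [-a, 1] (smulList v (derivList F))) [1]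

/-- The reduction of an algebraic integer modulo a prime, with a Frobenius element. -/
theorem exists_frobenius (L : Type) [Field L] [NumberField L] [IsGalois ℚ L] (p : ℕ)
    [Fact p.Prime] : ∃ (k : Type) (_ : Field k) (_ : IsAlgClosed k) (_ : CharP k p)
      (φ : NumberField.RingOfIntegers L →+* k) (σ : L ≃ₐ[ℚ] L), ∀ x, φ (σ • x) = φ x ^ p := by
  have hpZ : Prime (p : ℤ) := Nat.prime_iff_prime_int.mp Fact.out
  have hmax : (Ideal.span {(p : ℤ)}).IsMaximal :=
    PrincipalIdealRing.isMaximal_of_irreducible hpZ.irreducible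
  obtain ⟨Q, hQ, hQp⟩ := Ideal.exists_maximal_ideal_liesOver_of_isIntegral
    (S := NumberField.RingOfIntegers L) (Ideal.span {(p : ℤ)})
  have hu : Q.under ℤ = Ideal.span {(p : ℤ)} := hQp.over.symm
  have hQ0 : Q ≠ ⊥ := by
    rintro rfl
    have h1 : (p : ℤ) ∈ Ideal.under ℤ (⊥ : Ideal (NumberField.RingOfIntegers L)) := by
      rw [hu]; exact Ideal.mem_span_singleton_self _
    rw [Ideal.under_def, Ideal.mem_comap, Ideal.mem_bot] at h1
    exact hpZ.ne_zero (by simpa using h1)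
  have : Finite (NumberField.RingOfIntegers L ⧸ Q) := Ideal.finiteQuotientOfFreeOfNeBot Q hQ0
  obtain ⟨σ, hσ⟩ := IsArithFrobAt.exists_of_isInvariant ℤ (L ≃ₐ[ℚ] L) Q
  let := Ideal.Quotient.field Q
  have hpQ : ((p : ℕ) : NumberField.RingOfIntegers L ⧸ Q) = 0 := by
    have h1 : (p : ℤ) ∈ Ideal.under ℤ Q := by rw [hu]; exact Ideal.mem_span_singleton_self _
    rw [Ideal.under_def, Ideal.mem_comap] at h1
    rw [← map_natCast (Ideal.Quotient.mk Q), Ideal.Quotient.eq_zero_iff_mem]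
    simpa using h1
  obtain ⟨q, hq⟩ := CharP.exists (NumberField.RingOfIntegers L ⧸ Q)
  obtain rfl : q = p :=
    ((Nat.dvd_prime Fact.out).mp ((CharP.cast_eq_zero_iff _ q p).mp hpQ)).resolve_left
      (CharP.char_ne_one (NumberField.RingOfIntegers L ⧸ Q) q)
  refine ⟨AlgebraicClosure (NumberField.RingOfIntegers L ⧸ Q), inferInstance, inferInstance,
    charP_of_injective_algebraMap (algebraMap (NumberField.RingOfIntegers L ⧸ Q) _).injective q,
    (algebraMap _ _).comp (Ideal.Quotient.mk Q), σ, fun x => ?_⟩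
  have h1 := hσ.mk_apply x
  have h2 : Nat.card (ℤ ⧸ Q.under ℤ) = q := by
    rw [hu, Nat.card_congr (Int.quotientSpanNatEquivZMod q).toEquiv, Nat.card_zmod]
  rw [h2] at h1
  rw [RingHom.comp_apply, RingHom.comp_apply, ← map_pow]
  exact congrArg _ h1

/-- A Frobenius element that fixes a root and moves another one along a cycle of length `n`. -/
theorem exists_fixed_and_dvd_orderOf {L : Type} [Field L] [NumberField L] [IsGalois ℚ L]
    {p n m N : ℕ} [Fact p.Prime] {F h u : List ℤ} {a v : ℤ}
    (hc : checkFrobenius p n m F h u a v = true) (hn : n ≠ 0) (hm : ∀ d, d ∣ n → d ≠ n → d ∣ m)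
    (hF : F.length = N + 1) (hlead : F.getD N 0 = 1) {ι : Type} [Fintype ι]
    (hN : Fintype.card ι = N) {r : ι → NumberField.RingOfIntegers L} (hr : r.Injective)
    (hr0 : ∀ i, evalList F (r i) = 0) :
    ∃ σ : L ≃ₐ[ℚ] L, (∃ i, σ • r i = r i) ∧ n ∣ orderOf σ := by
  obtain ⟨k, _, _, _, φ, σ, hσ⟩ := exists_frobenius L p
  simp only [checkFrobenius, Bool.and_eq_true, beq_iff_eq] at hc
  obtain ⟨⟨⟨⟨⟨⟨hlen, hl⟩, hFh⟩, hfrob⟩, hu⟩, hFa⟩, hv⟩ := hc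
  have hmonic := natDegree_evalList_X_of_monic (A := NumberField.RingOfIntegers L) hF hlead
  have hprod : ∏ i, (X - C (r i)) = (evalList F X : (NumberField.RingOfIntegers L)[X]) := by
    have hsub : Finset.univ.val.map r ≤
        (evalList F (X : (NumberField.RingOfIntegers L)[X])).roots := by
      rw [Multiset.le_iff_subset (Finset.univ.nodup.map hr)]
      intro x hx
      obtain ⟨i, -, rfl⟩ := Multiset.mem_map.mp hx
      rw [mem_roots hmonic.1.ne_zero, IsRoot, ← coe_aeval_eq_eval, aeval_evalList_X, hr0]
    have hroots : Finset.univ.val.map r =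
        (evalList F (X : (NumberField.RingOfIntegers L)[X])).roots := by
      refine Multiset.eq_of_le_of_card_le hsub ?_
      rw [Multiset.card_map]
      exact (card_roots' _).trans (by rw [hmonic.2, ← hN]; rfl)
    rw [← prod_multiset_X_sub_C_of_monic_of_roots_card_eq hmonic.1
      (le_antisymm (card_roots' _) ?_), ← hroots, Multiset.map_map]
    · rfl
    · rw [← hroots, Multiset.card_map, hmonic.2, ← hN]; rfl
  have hroot {x : k} (hx : evalList F x = 0) : ∃ i, φ (r i) = x := by
    have h1 := congrArg (eval₂ φ x) hprod
    rw [eval₂_finsetProd] at h1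
    have h2 := map_evalList (eval₂RingHom φ x) F X
    rw [coe_eval₂RingHom, eval₂_X, hx] at h2
    rw [h2, Finset.prod_eq_zero_iff] at h1
    obtain ⟨i, -, hi⟩ := h1
    rw [eval₂_sub, eval₂_X, eval₂_C, sub_eq_zero] at hi
    exact ⟨i, hi.symm⟩
  refine ⟨σ, ?_, ?_⟩
  · have ha : evalList [-a, 1] (a : k) = 0 := by simp
    have hFa' : evalList F (a : k) = 0 := by
      rw [← evalList_modList (p := p) (n := 1) (h := [-a, 1]) rfl rfl ha]
      exact evalList_eq_zero_of_all _ _ hFa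
    obtain ⟨i, hi⟩ := hroot hFa'
    refine ⟨i, by_contra fun hne => ?_⟩
    have hσ0 : evalList F (σ • r i) = 0 := by
      have := map_evalList (MulSemiringAction.toRingHom (L ≃ₐ[ℚ] L) _ σ) F (r i)
      rw [hr0, map_zero] at this
      exact this.symm
    have hσa : φ (σ • r i) = a := by
      have : ExpChar k p := .prime Fact.out
      rw [hσ, hi]
      exact map_intCast (frobenius k p) a
    have hd : derivative (evalList F (X : (NumberField.RingOfIntegers L)[X])) =
        evalList (derivList F) X := derivative_evalList F
    obtain ⟨G, hG⟩ := dvd_iff_isRoot.mpr (show IsRoot (evalList F X) (r i) by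
      rw [IsRoot, ← coe_aeval_eq_eval, aeval_evalList_X, hr0])
    obtain ⟨H, hH⟩ := dvd_iff_isRoot.mpr (show IsRoot G (σ • r i) by
      have h1 := congrArg (eval (σ • r i)) hG
      rw [← coe_aeval_eq_eval, aeval_evalList_X, hσ0, coe_aeval_eq_eval, eval_mul, eval_sub,
        eval_X, eval_C] at h1
      exact (mul_eq_zero.mp h1.symm).resolve_left (sub_ne_zero.mpr hne))
    have h1 : evalList (derivList F) (r i) = (r i - σ • r i) * H.eval (r i) := by
      rw [← aeval_evalList_X (A := NumberField.RingOfIntegers L), ← hd, hG, hH, coe_aeval_eq_eval]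
      simp
    have h2 := congrArg φ h1
    rw [map_evalList, map_mul, map_sub, hσa, hi, sub_self, zero_mul] at h2
    have h3 := evalList_eq_of_sameList hv (a : k)
    rw [evalList_modList (p := p) (n := 1) (h := [-a, 1]) rfl rfl ha, evalList_smulList, h2] at h3
    simp at h3
  · obtain ⟨β, hβ⟩ := IsAlgClosed.exists_root (evalList h (X : k[X])) (by
      rw [degree_eq_natDegree (natDegree_evalList_X_of_monic hlen hl).1.ne_zero,
        (natDegree_evalList_X_of_monic hlen hl).2]
      exact_mod_cast hn)
    rw [IsRoot, ← coe_aeval_eq_eval, aeval_evalList_X] at hβ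
    obtain ⟨j, hj⟩ := hroot (x := β) (by
      rw [← evalList_modList (p := p) hlen hl hβ]
      exact evalList_eq_zero_of_all _ _ hFh)
    have hiter (e : ℕ) : (fun x : k => x ^ p)^[e] β = β ^ p ^ e := by
      induction e with
      | zero => simp
      | succ e ih => rw [Function.iterate_succ_apply', ih, ← pow_mul, pow_succ]
    have hper : Function.IsPeriodicPt (fun x : k => x ^ p) n β := by
      rw [Function.IsPeriodicPt, Function.IsFixedPt, hiter,
        ← evalList_frobeniusModList hlen hl hβ, evalList_eq_of_sameList hfrob]
      simp
    have hnper : ¬ Function.IsPeriodicPt (fun x : k => x ^ p) m β := by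
      intro hper
      rw [Function.IsPeriodicPt, Function.IsFixedPt, hiter] at hper
      have h1 := evalList_eq_of_sameList hu β
      rw [evalList_modList hlen hl hβ, evalList_mulList, evalList_addMulList,
        evalList_frobeniusModList hlen hl hβ, hper] at h1
      simp at h1
    have hmin : Function.minimalPeriod (fun x : k => x ^ p) β = n := by
      by_contra hne
      exact hnper ((Function.isPeriodicPt_iff_minimalPeriod_dvd).mpr
        (hm _ hper.minimalPeriod_dvd hne))
    have hσe (e : ℕ) : φ ((σ ^ e) • r j) = β ^ p ^ e := by
      induction e with
      | zero => simp [hj]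
      | succ e ih => rw [pow_succ', mul_smul, hσ, ih, ← pow_mul, pow_succ]
    rw [← hmin]
    refine Function.IsPeriodicPt.minimalPeriod_dvd ?_
    rw [Function.IsPeriodicPt, Function.IsFixedPt, hiter, ← hσe, pow_orderOf_eq_one, one_smul, hj]

theorem orderOf_dvd_card_inf_stabilizer {α : Type*} {H : Subgroup (Equiv.Perm α)}
    (htrans : ∀ a b, ∃ π ∈ H, π a = b) {π : Equiv.Perm α} (hπ : π ∈ H) {i : α} (hi : π i = i)
    (a : α) : orderOf π ∣
      Nat.card (H ⊓ MulAction.stabilizer (Equiv.Perm α) a : Subgroup (Equiv.Perm α)) := by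
  obtain ⟨τ, hτ, rfl⟩ := htrans i a
  have h1 : orderOf (τ * π * τ⁻¹) = orderOf π := by
    rw [← MulAut.conj_apply]
    exact orderOf_injective (MulAut.conj τ).toMonoidHom (MulAut.conj τ).injective π
  rw [← h1]
  refine Subgroup.orderOf_dvd_natCard _ ⟨H.mul_mem (H.mul_mem hτ hπ) (H.inv_mem hτ), ?_⟩
  simp [MulAction.mem_stabilizer_iff, hi]

/-- The action of the Galois group on labelled roots. -/
theorem exists_permutation_action {L : Type} [Field L] [NumberField L] {ι : Type} {F : List ℤ}
    {r : ι → NumberField.RingOfIntegers L} (hr : r.Injective) (hr0 : ∀ i, evalList F (r i) = 0)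
    (hroot : ∀ x : L, evalList F x = 0 → ∃ a, x = r a) :
    ∃ ψ : (L ≃ₐ[ℚ] L) →* Equiv.Perm ι, ∀ σ a, r (ψ σ a) = σ • r a := by
  have h (σ : L ≃ₐ[ℚ] L) (a : ι) : ∃ b, r b = σ • r a := by
    obtain ⟨b, hb⟩ := hroot (σ • r a : NumberField.RingOfIntegers L) (by
      have h1 := map_evalList ((algebraMap (NumberField.RingOfIntegers L) L).comp
        (MulSemiringAction.toRingHom (L ≃ₐ[ℚ] L) _ σ)) F (r a)
      rw [hr0, map_zero] at h1
      exact h1.symm)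
    exact ⟨b, NumberField.RingOfIntegers.ext hb.symm⟩
  choose b hb using h
  have hinv (σ τ : L ≃ₐ[ℚ] L) (a : ι) : b (σ * τ) a = b σ (b τ a) :=
    hr (by rw [hb, hb, hb, mul_smul])
  have hone (a : ι) : b 1 a = a := hr (by rw [hb, one_smul])
  exact ⟨MonoidHom.mk' (fun σ => ⟨b σ, b σ⁻¹, fun a => by rw [← hinv, inv_mul_cancel, hone],
    fun a => by rw [← hinv, mul_inv_cancel, hone]⟩) fun σ τ => Equiv.ext (hinv σ τ), hb⟩

theorem checkFrobenius_fiftyNine : checkFrobenius 59 8 4 coeffList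
    [52, 36, 36, 27, 26, 11, 23, 26, 1] [47, 16, 49, 47, 54, 13, 4, 36] 11 11 = true := by
  decide +kernel

theorem checkFrobenius_fortySeven : checkFrobenius 47 11 1 coeffList
    [9, 42, 25, 1, 26, 46, 4, 32, 6, 25, 20, 1] [29, 0, 5, 14, 32, 14, 2, 10, 26, 2, 35] 20 11 =
    true := by
  decide +kernel

set_option maxRecDepth 10000 in
theorem checkFrobenius_twoHundredSixtyNine : checkFrobenius 269 5 1 coeffList
    [22, 113, 60, 203, 170, 1] [229, 110, 142, 57, 231] 39 211 = true := by
  decide +kernel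

theorem checkFrobenius_five : checkFrobenius 5 3 1 coeffList [1, 1, 4, 1] [0, 4, 2] 1 4 = true := by
  decide +kernel

/-- The Galois group acts faithfully and transitively on labelled roots, and preserves the relations
between signs. -/
theorem exists_hexAut_action (L : Type) [Field L] [NumberField L] [IsGalois ℚ L]
    [IsSplittingField ℚ L (evalList coeffList X)] :
    ∃ (r : Bool × Fin 12 → NumberField.RingOfIntegers L)
      (ψ : (L ≃ₐ[ℚ] L) →* Equiv.Perm (Bool × Fin 12)),
      (r.Injective ∧ ∀ a, evalList coeffList (r a) = 0) ∧ (∀ σ a, r (ψ σ a) = σ • r a) ∧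
      Function.Injective ψ ∧ (∀ a b, ∃ π ∈ ψ.range, π a = b) ∧ ψ.range ≤ hexAut := by
  obtain ⟨Φ, r, hΦ, hr0, hroot⟩ := exists_labelling (L := L) (p := 1270747) (n := 32) (by norm_num)
    checkRoots_eq approx_injective
  have hr : r.Injective := fun a b h => approx_injective (by dsimp only; rw [← hΦ, ← hΦ, h])
  have hr0L (a) : evalList coeffList (r a : L) = 0 := by
    have := map_evalList (algebraMap (NumberField.RingOfIntegers L) L) coeffList (r a)
    rw [hr0, map_zero] at this
    exact this.symm
  obtain ⟨ψ, hψ⟩ := exists_permutation_action hr hr0 hroot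
  refine ⟨r, ψ, ⟨hr, hr0⟩, hψ, ?_, ?_, ?_⟩
  · rw [injective_iff_map_eq_one]
    intro σ hσ
    have h1 : (σ : L →ₐ[ℚ] L) = AlgHom.id ℚ L := by
      refine AlgHom.ext_of_adjoin_eq_top
        (IsSplittingField.adjoin_rootSet L (evalList coeffList (X : ℚ[X]))) fun x hx => ?_
      have h2 : evalList coeffList x = 0 := by
        rw [← aeval_evalList_X (A := ℚ)]
        exact (mem_rootSet.mp hx).2
      obtain ⟨a, rfl⟩ := hroot x h2
      have h3 := hψ σ a
      rw [hσ, Equiv.Perm.one_apply] at h3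
      exact congrArg (algebraMap (NumberField.RingOfIntegers L) L) h3.symm
    exact AlgEquiv.ext fun x => DFunLike.congr_fun h1 x
  · intro a b
    have hmin (c) : minpoly ℚ (r c : L) = evalList coeffList X :=
      (minpoly.eq_of_irreducible_of_monic irreducible_evalList_coeffList_rat
        (by rw [aeval_evalList_X, hr0L]) (natDegree_evalList_X_of_monic (n := 24) rfl rfl).1).symm
    obtain ⟨σ, hσ⟩ := (Normal.minpoly_eq_iff_mem_orbit (F := ℚ) (x := (r b : L))
      (y := (r a : L))).mp ((hmin b).trans (hmin a).symm)
    exact ⟨ψ σ, ⟨σ, rfl⟩, hr (by rw [hψ]; exact NumberField.RingOfIntegers.ext hσ)⟩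
  · rintro _ ⟨σ, rfl⟩
    exact isHexAut_of_smul (by norm_num) checkRoots_eq (fun s => ⟨_, checkSide_eq s⟩) hexBound_lt
      Φ hΦ hr0 hψ σ

theorem dvd_card_inf_stabilizer {L : Type} [Field L] [NumberField L] [IsGalois ℚ L]
    {r : Bool × Fin 12 → NumberField.RingOfIntegers L} (hr : r.Injective)
    (hr0 : ∀ a, evalList coeffList (r a) = 0)
    {ψ : (L ≃ₐ[ℚ] L) →* Equiv.Perm (Bool × Fin 12)} (hψ : ∀ σ a, r (ψ σ a) = σ • r a)
    (hψinj : Function.Injective ψ) (htrans : ∀ a b, ∃ π ∈ ψ.range, π a = b) {p n m : ℕ}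
    [Fact p.Prime] {h u : List ℤ} {a v : ℤ} (hc : checkFrobenius p n m coeffList h u a v = true)
    (hn : n ≠ 0) (hm : ∀ d, d ∣ n → d ≠ n → d ∣ m) (b : Bool × Fin 12) :
    n ∣ Nat.card (ψ.range ⊓ MulAction.stabilizer (Equiv.Perm (Bool × Fin 12)) b :
      Subgroup (Equiv.Perm (Bool × Fin 12))) := by
  obtain ⟨σ, ⟨i, hi⟩, hσ⟩ := exists_fixed_and_dvd_orderOf hc hn hm (N := 24) rfl rfl (by decide)
    hr hr0
  rw [← orderOf_injective ψ hψinj] at hσ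
  have hfix : ψ σ i = i := hr (by rw [hψ, hi])
  exact hσ.trans (orderOf_dvd_card_inf_stabilizer htrans ⟨σ, rfl⟩ hfix _)

theorem card_algEquiv_eq (L : Type) [Field L] [NumberField L] [IsGalois ℚ L]
    [IsSplittingField ℚ L (evalList coeffList X)] : Nat.card (L ≃ₐ[ℚ] L) = 190080 := by
  obtain ⟨r, ψ, ⟨hr, hr0⟩, hψ, hψinj, htrans, hle⟩ := exists_hexAut_action L
  have hprime {q : ℕ} (hq : q.Prime) : ∀ d, d ∣ q → d ≠ q → d ∣ 1 := fun d h1 h2 =>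
    (((Nat.dvd_prime hq).mp h1).resolve_right h2).dvd
  have := Fact.mk (show Nat.Prime 59 by norm_num)
  have := Fact.mk (show Nat.Prime 47 by norm_num)
  have := Fact.mk (show Nat.Prime 269 by norm_num)
  have := Fact.mk (show Nat.Prime 5 by norm_num)
  have h8 := dvd_card_inf_stabilizer hr hr0 hψ hψinj htrans checkFrobenius_fiftyNine
    (by norm_num) (by
    intro d h1 h2
    have : d ≤ 8 := Nat.le_of_dvd (by norm_num) h1
    interval_cases d <;> omega) (false, 0)
  have h11 := dvd_card_inf_stabilizer hr hr0 hψ hψinj htrans checkFrobenius_fortySeven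
    (by norm_num) (hprime (by norm_num)) (false, 0)
  have h5 := dvd_card_inf_stabilizer hr hr0 hψ hψinj htrans checkFrobenius_twoHundredSixtyNine
    (by norm_num) (hprime (by norm_num)) (false, 0)
  have h3 := dvd_card_inf_stabilizer hr hr0 hψ hψinj htrans checkFrobenius_five
    (by norm_num) (hprime (by norm_num)) (false, 0)
  have hstab := card_mul_card_inf_stabilizer_le ψ.range (false, 0) Finset.univ
    fun x _ => htrans _ x
  have hpos : 0 < Nat.card (ψ.range ⊓ MulAction.stabilizer (Equiv.Perm (Bool × Fin 12))
    (false, (0 : Fin 12)) :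
    Subgroup (Equiv.Perm (Bool × Fin 12))) := Nat.card_pos
  have harith (c N : ℕ) (h3 : 3 ∣ c) (h5 : 5 ∣ c) (h8 : 8 ∣ c) (h11 : 11 ∣ c) (hc : 0 < c)
      (hN : 24 * c ≤ N) : 31680 ≤ N := by omega
  exact (Nat.card_congr (MonoidHom.ofInjective hψinj).toEquiv).trans
    (card_eq_of_le_hexAut hle htrans (harith _ _ h3 h5 h8 h11 hpos hstab))

theorem card_gal_eq {f : ℚ[X]} (hf : f = evalList coeffList X) : Nat.card f.Gal = 190080 := by
  have h (L : Type) [Field L] [CharZero L] [inst : Algebra ℚ L]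
      [IsSplittingField ℚ L (evalList coeffList X)] : Nat.card (L ≃ₐ[ℚ] L) = 190080 := by
    obtain rfl : inst = DivisionRing.toRatAlgebra := Subsingleton.elim _ _
    have : FiniteDimensional ℚ L :=
      IsSplittingField.finiteDimensional L (evalList coeffList (X : ℚ[X]))
    have : NumberField L := {}
    have : IsGalois ℚ L :=
      IsGalois.of_separable_splitting_field irreducible_evalList_coeffList_rat.separable
    exact card_algEquiv_eq L
  have hsplit {k : Type} [Field k] {f g : k[X]} (hg : f = g) :
      IsSplittingField k f.SplittingField g := hg ▸ IsSplittingField.splittingField f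
  exact @h f.SplittingField _ (algebraRat.charZero _) _ (hsplit hf)

theorem evalList_coeffList_X : evalList coeffList (X : ℚ[X]) =
    X ^ 24 - 11 * X ^ 23 + 53 * X ^ 22 - 154 * X ^ 21 + 330 * X ^ 20 - 594 * X ^ 19
        + 1012 * X ^ 18 - 2255 * X ^ 17 + 6512 * X ^ 16 - 17710 * X ^ 15 + 42768 * X ^ 14
        - 89067 * X ^ 13 + 154308 * X ^ 12 - 237699 * X ^ 11 + 351252 * X ^ 10
        - 483318 * X ^ 9 + 623997 * X ^ 8 - 753291 * X ^ 7 + 733491 * X ^ 6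
        - 520641 * X ^ 5 + 278586 * X ^ 4 - 104841 * X ^ 3 + 15552 * X ^ 2 + 2673 * X + 81 := by
  simp only [_root_.coeffList, evalList_cons, evalList_nil]
  push_cast
  ring

/-- The degree-24 polynomial `f` below is irreducible over `ℚ`, its Galois
group has order `190080` (the order of `M₁₂.2`), and the number field `ℚ[x]/(f)` has
discriminant of absolute value `2¹²·3²⁴·11²²`. -/
theorem fC2_specialized_irreducible_gal_and_discr :
    let f : Polynomial ℚ :=
      X ^ 24 - 11 * X ^ 23 + 53 * X ^ 22 - 154 * X ^ 21 + 330 * X ^ 20 - 594 * X ^ 19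
        + 1012 * X ^ 18 - 2255 * X ^ 17 + 6512 * X ^ 16 - 17710 * X ^ 15 + 42768 * X ^ 14
        - 89067 * X ^ 13 + 154308 * X ^ 12 - 237699 * X ^ 11 + 351252 * X ^ 10
        - 483318 * X ^ 9 + 623997 * X ^ 8 - 753291 * X ^ 7 + 733491 * X ^ 6
        - 520641 * X ^ 5 + 278586 * X ^ 4 - 104841 * X ^ 3 + 15552 * X ^ 2 + 2673 * X + 81
    Irreducible f ∧ Nat.card f.Gal = 190080 ∧
      ∀ (K : Type) [Field K] [NumberField K] (x : K),
        Polynomial.aeval x f = 0 → IntermediateField.adjoin ℚ {x} = ⊤ →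
        |NumberField.discr K| = 2 ^ 12 * 3 ^ 24 * 11 ^ 22 := by
  intro f
  have hf : f = evalList coeffList X := evalList_coeffList_X.symm
  refine ⟨hf ▸ irreducible_evalList_coeffList_rat, card_gal_eq hf, fun K _ _ x hx htop => ?_⟩
  exact abs_discr_eq_of_adjoin_eq_top x (hf ▸ hx) htop
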